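/- arXiv:1107.5611 — 4 statements merged into one kernel-verified Lean document; each statement's English description precedes it below -/
import Mathlib

section
/- Let p, q, a, b ≥ 0 with pq > 1, and let (u, v) be a positive (entire) solution of the Hénon–Lane–Emden system on ℝ^N. Then there is a constant C > 0, independent of R, such that for all R > 1: ∫_{B_R} |x|^a v^p ≤ C R^{N − 2 − ((b+2)p + (a+2))/(pq−1)} and ∫_{B_R} |x|^b u^q ≤ C R^{N − 2 − ((a+2)q + (b+2))/(pq−1)}, where B_R is the ball of radius R centered at the origin. -/
open MeasureTheory Real Metric

/-- The Laplacian of a function on Euclidean space, as the sum of its second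
partial derivatives in the coordinate directions. -/
noncomputable def lap {N : ℕ} (f : EuclideanSpace ℝ (Fin N) → ℝ)
    (x : EuclideanSpace ℝ (Fin N)) : ℝ :=
  ∑ i : Fin N,
    fderiv ℝ (fun y => fderiv ℝ f y (EuclideanSpace.single i 1)) x (EuclideanSpace.single i 1)

noncomputable def hcut {N : ℕ} (y : EuclideanSpace ℝ (Fin N)) : ℝ := max (4 - ‖y‖ ^ 2) 0

lemma hcut_nonneg {N : ℕ} (y : EuclideanSpace ℝ (Fin N)) : 0 ≤ hcut y := le_max_right _ _

lemma hcut_cont {N : ℕ} : Continuous (hcut (N := N)) := by unfold hcut; fun_prop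

lemma hcut_zero {N : ℕ} {y : EuclideanSpace ℝ (Fin N)} (h : y ∉ closedBall (0 : EuclideanSpace ℝ (Fin N)) 2) :
    hcut y = 0 := by
  simp at h
  apply max_eq_right
  nlinarith

lemma hcut_supp {N : ℕ} {g : EuclideanSpace ℝ (Fin N) → ℝ} (hg : ∀ y, hcut y = 0 → g y = 0) :
    HasCompactSupport g :=
  HasCompactSupport.intro (isCompact_closedBall (0 : EuclideanSpace ℝ (Fin N)) 2)
    (fun x hx => hg x (hcut_zero hx))

lemma hcut_int {N : ℕ} {g : EuclideanSpace ℝ (Fin N) → ℝ} (hc : Continuous g)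
    (hg : ∀ y, hcut y = 0 → g y = 0) : Integrable g :=
  hc.integrable_of_hasCompactSupport (hcut_supp hg)

lemma maxcube (s : ℝ) : HasDerivAt (fun s : ℝ => max s 0 ^ 3) (3 * max s 0 ^ 2) s := by
  rcases lt_trichotomy s 0 with h | h | h
  · rw [max_eq_right h.le]
    have : HasDerivAt (fun _ : ℝ => (0:ℝ)) (3 * 0 ^ 2) s := by simpa using hasDerivAt_const s (0:ℝ)
    refine this.congr_of_eventuallyEq ?_
    filter_upwards [Iio_mem_nhds h] with x hx
    rw [max_eq_right (le_of_lt hx)]; simp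
  · subst h
    rw [← hasDerivWithinAt_univ, ← Set.Iic_union_Ici (a := (0:ℝ))]
    apply HasDerivWithinAt.union
    · have : HasDerivWithinAt (fun _ : ℝ => (0:ℝ)) (3 * max 0 0 ^ 2) (Set.Iic 0) 0 := by
        simpa using hasDerivWithinAt_const (0:ℝ) (Set.Iic (0:ℝ)) (0:ℝ)
      refine this.congr ?_ (by simp)
      intro x hx; rw [max_eq_right hx]; simp
    · have : HasDerivWithinAt (fun x : ℝ => x ^ 3) (3 * max 0 0 ^ 2) (Set.Ici 0) 0 := by
        simpa using (hasDerivAt_pow 3 (0:ℝ)).hasDerivWithinAt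
      refine this.congr ?_ (by simp)
      intro x hx; rw [max_eq_left hx]
  · rw [max_eq_left h.le]
    have : HasDerivAt (fun x : ℝ => x ^ 3) (3 * s ^ 2) s := by simpa using (hasDerivAt_pow 3 s)
    refine this.congr_of_eventuallyEq ?_
    filter_upwards [Ioi_mem_nhds h] with x hx
    rw [max_eq_left (le_of_lt hx)]

lemma hcut_fderiv {N : ℕ} (y : EuclideanSpace ℝ (Fin N)) :
    HasFDerivAt (fun y : EuclideanSpace ℝ (Fin N) => hcut y ^ 3)
      ((-6 * hcut y ^ 2) • innerSL ℝ y) y := by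
  have h1 : HasFDerivAt (fun y : EuclideanSpace ℝ (Fin N) => 4 - ‖y‖ ^ 2) (-(2 • innerSL ℝ y)) y :=
    (hasStrictFDerivAt_norm_sq y).hasFDerivAt.const_sub 4
  have := (maxcube (4 - ‖y‖ ^ 2)).comp_hasFDerivAt y h1
  refine this.congr_fderiv ?_
  ext w
  simp [hcut]; ring

lemma lap_cont {N : ℕ} {u : EuclideanSpace ℝ (Fin N) → ℝ} (hu : ContDiff ℝ 2 u) : Continuous (lap u) := by
  unfold lap
  refine continuous_finsetSum _ fun i _ => ?_
  have h1 : ContDiff ℝ 1 (fun y => fderiv ℝ u y (EuclideanSpace.single i 1)) :=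
    (hu.fderiv_right (m := 1) (by norm_num)).clm_apply contDiff_const
  exact (h1.continuous_fderiv (by norm_num)).clm_apply continuous_const

lemma ibp {N : ℕ} {u : EuclideanSpace ℝ (Fin N) → ℝ} (hu : ContDiff ℝ 2 u)
    (z : EuclideanSpace ℝ (Fin N)) (r : ℝ) :
    ∫ y, 6 * hcut y ^ 2 * fderiv ℝ u (z + r • y) y = ∫ y, hcut y ^ 3 * (r * lap u (z + r • y)) := by
  have hcf : Continuous (fderiv ℝ u) := hu.continuous_fderiv (by norm_num)
  have hcc := hcut_cont (N := N)
  have key : ∀ i : Fin N, ∫ y, 6 * hcut y ^ 2 * (y i * fderiv ℝ u (z + r • y) (EuclideanSpace.single i 1)) =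
      ∫ y, hcut y ^ 3 * (r * fderiv ℝ (fun y => fderiv ℝ u y (EuclideanSpace.single i 1)) (z + r • y) (EuclideanSpace.single i 1)) := by
    intro i
    set e : EuclideanSpace ℝ (Fin N) := EuclideanSpace.single i 1 with he
    have h1 : ContDiff ℝ 1 (fun y => fderiv ℝ u y e) :=
      (hu.fderiv_right (m := 1) (by norm_num)).clm_apply contDiff_const
    have hc1 : Continuous (fderiv ℝ (fun y => fderiv ℝ u y e)) := h1.continuous_fderiv (by norm_num)
    have hd : ∀ y, HasFDerivAt (fun y => fderiv ℝ u (z + r • y) e)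
        ((fderiv ℝ (fun y => fderiv ℝ u y e) (z + r • y)).comp (r • ContinuousLinearMap.id ℝ _)) y := by
      intro y
      have ha : HasFDerivAt (fun y : EuclideanSpace ℝ (Fin N) => z + r • y) (r • ContinuousLinearMap.id ℝ _) y :=
        ((hasFDerivAt_id y).const_smul r).const_add z
      exact ((h1.differentiable (by norm_num) (z + r • y)).hasFDerivAt).comp y ha
    have hin : ∀ y : EuclideanSpace ℝ (Fin N), inner ℝ y e = y i := by
      intro y; simp [he, EuclideanSpace.inner_single_right]
    have e1 : ∀ y, fderiv ℝ (fun y : EuclideanSpace ℝ (Fin N) => hcut y ^ 3) y e = -(6 * hcut y ^ 2 * y i) := by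
      intro y; rw [(hcut_fderiv y).fderiv]; simp [hin]
    have e2 : ∀ y, fderiv ℝ (fun y => fderiv ℝ u (z + r • y) e) y e =
        r * fderiv ℝ (fun y => fderiv ℝ u y e) (z + r • y) e := by
      intro y; rw [(hd y).fderiv]; simp
    have := integral_mul_fderiv_eq_neg_fderiv_mul_of_integrable (μ := (volume : Measure (EuclideanSpace ℝ (Fin N))))
      (f := fun y : EuclideanSpace ℝ (Fin N) => hcut y ^ 3) (g := fun y => fderiv ℝ u (z + r • y) e) (v := e)
      (by
        simp only [e1]
        refine hcut_int (by fun_prop) ?_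
        intro y hy; simp [hy])
      (by
        simp only [e2]
        refine hcut_int (by fun_prop) ?_
        intro y hy; simp [hy])
      (by
        refine hcut_int (by fun_prop) ?_
        intro y hy; simp [hy])
      (fun y _ => (hcut_fderiv y).differentiableAt) (fun y _ => (hd y).differentiableAt)
    simp only [e1, e2] at this
    rw [this, ← integral_neg]
    congr 1; ext y; ring
  have hl : ∀ y, 6 * hcut y ^ 2 * fderiv ℝ u (z + r • y) y =
      ∑ i : Fin N, 6 * hcut y ^ 2 * (y i * fderiv ℝ u (z + r • y) (EuclideanSpace.single i 1)) := by
    intro y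
    rw [← Finset.mul_sum]
    congr 1
    generalize fderiv ℝ u (z + r • y) = L
    conv_lhs => rw [← (EuclideanSpace.basisFun (Fin N) ℝ).sum_repr y]
    simp
  simp only [hl, lap, Finset.mul_sum]
  rw [integral_finsetSum, integral_finsetSum]
  · exact Finset.sum_congr rfl fun i _ => key i
  · intro i _
    have h1 : ContDiff ℝ 1 (fun y => fderiv ℝ u y (EuclideanSpace.single i 1)) :=
      (hu.fderiv_right (m := 1) (by norm_num)).clm_apply contDiff_const
    have hc1 := h1.continuous_fderiv (by norm_num)
    refine hcut_int (by fun_prop) ?_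
    intro y hy; simp [hy]
  · intro i _
    refine hcut_int (by fun_prop) ?_
    intro y hy; simp [hy]

lemma derivM {N : ℕ} {u : EuclideanSpace ℝ (Fin N) → ℝ} (hu : ContDiff ℝ 2 u)
    (z : EuclideanSpace ℝ (Fin N)) (r : ℝ) :
    HasDerivAt (fun r : ℝ => ∫ y, 6 * hcut y ^ 2 * u (z + r • y))
      (∫ y, hcut y ^ 3 * (r * lap u (z + r • y))) r := by
  rw [← ibp hu]
  have hcf : Continuous (fderiv ℝ u) := hu.continuous_fderiv (by norm_num)
  have hcu : Continuous u := hu.continuous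
  have hcc := hcut_cont (N := N)
  obtain ⟨C, hC⟩ := ((isCompact_closedBall r 1).prod
    (isCompact_closedBall (0 : EuclideanSpace ℝ (Fin N)) 2)).exists_bound_of_continuousOn
    (f := fun t : ℝ × EuclideanSpace ℝ (Fin N) => fderiv ℝ u (z + t.1 • t.2) t.2)
    (by fun_prop)
  refine (hasDerivAt_integral_of_dominated_loc_of_deriv_le (bound := fun y => 6 * hcut y ^ 2 * C)
    (F' := fun r y => 6 * hcut y ^ 2 * fderiv ℝ u (z + r • y) y)
    (s := ball r 1) (ball_mem_nhds r one_pos) ?_ ?_ ?_ ?_ ?_ ?_).2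
  · exact Filter.Eventually.of_forall fun x => Continuous.aestronglyMeasurable (by fun_prop)
  · refine hcut_int (by fun_prop) ?_
    intro y hy; simp [hy]
  · exact Continuous.aestronglyMeasurable (by fun_prop)
  · refine Filter.Eventually.of_forall fun y x hx => ?_
    by_cases hy : y ∈ closedBall (0 : EuclideanSpace ℝ (Fin N)) 2
    · rw [norm_mul, Real.norm_of_nonneg (by positivity)]
      have := hC (x, y) ⟨ball_subset_closedBall hx, hy⟩
      gcongr
    · simp [hcut_zero hy]
  · refine hcut_int (by fun_prop) ?_
    intro y hy; simp [hy]
  · refine Filter.Eventually.of_forall fun y x hx => ?_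
    have ha : HasDerivAt (fun x : ℝ => z + x • y) y x := by
      simpa using ((hasDerivAt_id x).smul_const y).const_add z
    exact (((hu.differentiable (by norm_num) _).hasFDerivAt).comp_hasDerivAt x ha).const_mul _

lemma lower {N : ℕ} {u : EuclideanSpace ℝ (Fin N) → ℝ} (hu : ContDiff ℝ 2 u)
    (hl : ∀ x, 0 ≤ - lap u x)
    (z : EuclideanSpace ℝ (Fin N)) (R r : ℝ) (hR : 0 < R) (hr : R ≤ r) (hr2 : r ≤ 2 * R) :
    ∫ y, hcut y ^ 3 * (r * lap u (z + r • y)) ≤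
      - (27 * R * ((2 * R) ^ N)⁻¹ * ∫ x in ball z R, - lap u x) := by
  have hcl := lap_cont hu
  have hcc := hcut_cont (N := N)
  have hr0 : 0 < r := by linarith
  have h1 : ∫ x in ball z R, - lap u x = r ^ N * ∫ y, (ball z R).indicator (fun x => - lap u x) (z + r • y) := by
    rw [← integral_indicator measurableSet_ball]
    have := Measure.integral_comp_smul (volume : Measure (EuclideanSpace ℝ (Fin N)))
      (fun x => (ball z R).indicator (fun x => - lap u x) (z + x)) r
    rw [this, integral_add_left_eq_self (μ := volume) (fun x => (ball z R).indicator (fun x => - lap u x) x) z]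
    simp only [finrank_euclideanSpace, Fintype.card_fin, smul_eq_mul]
    rw [abs_of_nonneg (by positivity), ← mul_assoc, mul_inv_cancel₀ (by positivity), one_mul]
  have hI : 0 ≤ ∫ x in ball z R, - lap u x := integral_nonneg hl
  have h2 : 27 * r * ∫ y, (ball z R).indicator (fun x => - lap u x) (z + r • y) ≤
      ∫ y, hcut y ^ 3 * (r * - lap u (z + r • y)) := by
    rw [← integral_const_mul]
    refine integral_mono_of_nonneg ?_ ?_ ?_
    · refine Filter.Eventually.of_forall fun y => ?_
      have : 0 ≤ (ball z R).indicator (fun x => - lap u x) (z + r • y) := Set.indicator_nonneg (fun x _ => hl x) _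
      simp only [Pi.zero_apply]
      positivity
    · refine hcut_int (by fun_prop) ?_
      intro y hy; simp [hy]
    · refine Filter.Eventually.of_forall fun y => ?_
      have hn := hl (z + r • y)
      simp only
      by_cases hy : z + r • y ∈ ball z R
      · rw [Set.indicator_of_mem hy]
        simp [norm_smul, abs_of_pos hr0] at hy
        have hy1 : ‖y‖ < 1 := by
          by_contra hh
          push Not at hh
          nlinarith
        have : 3 ≤ hcut y := le_trans (by nlinarith [norm_nonneg y]) (le_max_left _ _)
        have : (3:ℝ) ^ 3 ≤ hcut y ^ 3 := by gcongr
        have h5 : 0 ≤ r * - lap u (z + r • y) := by positivity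
        nlinarith
      · rw [Set.indicator_of_notMem hy, mul_zero]
        have := hcut_nonneg y
        positivity
  have h3 : ∫ y, hcut y ^ 3 * (r * lap u (z + r • y)) = - ∫ y, hcut y ^ 3 * (r * - lap u (z + r • y)) := by
    rw [← integral_neg]; congr 1; ext y; ring
  rw [h3]
  apply neg_le_neg
  refine le_trans ?_ h2
  set K := ∫ y, (ball z R).indicator (fun x => - lap u x) (z + r • y)
  have hK : K = (r ^ N)⁻¹ * ∫ x in ball z R, - lap u x := by
    rw [h1, ← mul_assoc, inv_mul_cancel₀ (by positivity), one_mul]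
  rw [hK, ← mul_assoc]
  gcongr

lemma keyc (N : ℕ) : ∃ c > 0, ∀ u : EuclideanSpace ℝ (Fin N) → ℝ, ContDiff ℝ 2 u →
    (∀ x, 0 < u x) → (∀ x, 0 ≤ - lap u x) → ∀ z R, 0 < R →
    c * R ^ (2 - (N : ℝ)) * (∫ x in ball z R, - lap u x) ≤ u z := by
  set K := ∫ y : EuclideanSpace ℝ (Fin N), 6 * hcut y ^ 2 with hKdef
  have hcc := hcut_cont (N := N)
  have hK : 0 < K := by
    refine Continuous.integral_pos_of_hasCompactSupport_nonneg_nonzero (x := 0) (by fun_prop)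
      (hcut_supp fun y hy => by simp [hy]) (fun y => by simp only [Pi.zero_apply]; positivity) (by simp [hcut])
  refine ⟨27 * (2 ^ N)⁻¹ / K, by positivity, ?_⟩
  intro u hu hpos hl z R hR
  set M : ℝ → ℝ := fun r : ℝ => ∫ y, 6 * hcut y ^ 2 * u (z + r • y)
  have hM : ∀ r, HasDerivAt M (∫ y, hcut y ^ 3 * (r * lap u (z + r • y))) r := derivM hu z
  have hdiff : Differentiable ℝ M := fun r => (hM r).differentiableAt
  have hM0 : M 0 = K * u z := by simp [M, K, integral_mul_const]
  have hM2 : 0 ≤ M (2 * R) := integral_nonneg fun y => by have := hpos (z + (2 * R) • y); positivity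
  have hMR : M R ≤ M 0 := by
    refine antitoneOn_of_deriv_nonpos (convex_Ici 0) hdiff.continuous.continuousOn hdiff.differentiableOn
      ?_ (Set.mem_Ici.2 le_rfl) (Set.mem_Ici.2 hR.le) hR.le
    intro r hr
    rw [interior_Ici, Set.mem_Ioi] at hr
    rw [(hM r).deriv]
    refine integral_nonpos fun y => ?_
    have h1 := hl (z + r • y)
    have h2 : 0 ≤ hcut y ^ 3 := pow_nonneg (hcut_nonneg y) 3
    have : 0 ≤ hcut y ^ 3 * (r * - lap u (z + r • y)) := by positivity
    simp only [Pi.zero_apply]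
    linarith
  have hdec := (convex_Icc R (2 * R)).image_sub_le_mul_sub_of_deriv_le hdiff.continuous.continuousOn
    hdiff.differentiableOn (C := - (27 * R * ((2 * R) ^ N)⁻¹ * ∫ x in ball z R, - lap u x))
    (by
      intro r hr
      rw [interior_Icc] at hr
      rw [(hM r).deriv]
      exact lower hu hl z R r hR hr.1.le hr.2.le)
    R ⟨le_rfl, by linarith⟩ (2 * R) ⟨by linarith, le_rfl⟩ (by linarith)
  have e : R ^ (2 - (N : ℝ)) = R ^ 2 * (R ^ N)⁻¹ := by
    rw [Real.rpow_sub hR, Real.rpow_natCast, Real.rpow_ofNat, div_eq_mul_inv]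
  rw [e]
  set I := ∫ x in ball z R, - lap u x
  have : 27 * (2 ^ N)⁻¹ * (R ^ 2 * (R ^ N)⁻¹) * I ≤ K * u z := by
    rw [mul_pow, mul_inv] at hdec
    nlinarith
  rw [div_mul_eq_mul_div, div_mul_eq_mul_div, div_le_iff₀ hK]
  linarith

lemma weight_low (N : ℕ) (hN : N ≠ 0) (b : ℝ) (hb : 0 ≤ b) : ∃ k > 0, ∀ R : ℝ, 0 < R →
    ∫ x in ball (0 : EuclideanSpace ℝ (Fin N)) R, ‖x‖ ^ b = k * R ^ (b + N) := by
  have : Nonempty (Fin N) := ⟨⟨0, Nat.pos_of_ne_zero hN⟩⟩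
  have hcont : Continuous fun x : EuclideanSpace ℝ (Fin N) => ‖x‖ ^ b :=
    continuous_norm.rpow_const fun x => Or.inr hb
  refine ⟨∫ x in ball (0 : EuclideanSpace ℝ (Fin N)) 1, ‖x‖ ^ b, ?_, ?_⟩
  · rw [gt_iff_lt, setIntegral_pos_iff_support_of_nonneg_ae]
    · have ho : IsOpen ({x : EuclideanSpace ℝ (Fin N) | x ≠ 0} ∩ ball 0 1) := isOpen_ne.inter isOpen_ball
      have hne : ({x : EuclideanSpace ℝ (Fin N) | x ≠ 0} ∩ ball 0 1).Nonempty := by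
        let i : Fin N := ⟨0, Nat.pos_of_ne_zero hN⟩
        refine ⟨EuclideanSpace.single i (1/2 : ℝ), ?_, ?_⟩
        · intro h
          have := congrArg norm h
          simp at this
        · simp; norm_num
      refine lt_of_lt_of_le (ho.measure_pos volume hne) (measure_mono ?_)
      rintro x ⟨hx, hx1⟩
      refine ⟨?_, hx1⟩
      have : 0 < ‖x‖ := norm_pos_iff.2 hx
      exact (Real.rpow_pos_of_pos this b).ne'
    · exact Filter.Eventually.of_forall fun x => Real.rpow_nonneg (norm_nonneg x) b
    · exact (hcont.continuousOn.integrableOn_compact (isCompact_closedBall 0 1)).mono_set ball_subset_closedBall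
  · intro R hR
    rw [← integral_indicator measurableSet_ball, ← integral_indicator measurableSet_ball]
    have := Measure.integral_comp_smul (volume : Measure (EuclideanSpace ℝ (Fin N)))
      ((ball (0 : EuclideanSpace ℝ (Fin N)) R).indicator (fun x => ‖x‖ ^ b)) R
    simp only [finrank_euclideanSpace, Fintype.card_fin, smul_eq_mul] at this
    rw [abs_of_nonneg (by positivity)] at this
    have h2 : ∀ x : EuclideanSpace ℝ (Fin N), (ball (0 : EuclideanSpace ℝ (Fin N)) R).indicator (fun x => ‖x‖ ^ b) (R • x)
        = R ^ b * (ball (0 : EuclideanSpace ℝ (Fin N)) 1).indicator (fun x => ‖x‖ ^ b) x := by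
      intro x
      by_cases hx : x ∈ ball (0 : EuclideanSpace ℝ (Fin N)) 1
      · rw [Set.indicator_of_mem hx, Set.indicator_of_mem]
        · rw [norm_smul, Real.norm_of_nonneg hR.le, Real.mul_rpow hR.le (norm_nonneg _)]
        · simp [norm_smul, abs_of_pos hR] at hx ⊢
          nlinarith
      · rw [Set.indicator_of_notMem hx, Set.indicator_of_notMem, mul_zero]
        simp [norm_smul, abs_of_pos hR] at hx ⊢
        nlinarith
    simp only [h2] at this
    rw [integral_const_mul] at this
    rw [Real.rpow_add hR, Real.rpow_natCast, mul_comm _ (R ^ b * R ^ N), mul_comm (R ^ b), mul_assoc, this,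
      ← mul_assoc, mul_inv_cancel₀ (by positivity), one_mul]

lemma real_core (p q A B c α β γ : ℝ) (hp : 0 ≤ p) (hq : 0 ≤ q) (hpq : 1 < p * q)
    (hA : 0 < A) (hB : 0 < B) (hc : 0 < c) :
    ∃ C > 0, ∀ R I J : ℝ, 0 < R → 0 ≤ I → 0 ≤ J → A * R ^ α * (c * R ^ γ * I) ^ q ≤ J →
      B * R ^ β * (c * R ^ γ * J) ^ p ≤ I →
      I ≤ C * R ^ (-(β + γ * p + (α + γ * q) * p) / (p * q - 1)) := by
  set D := B * (c * (A * c ^ q)) ^ p with hD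
  have hDpos : 0 < D := by positivity
  have hs : 0 < p * q - 1 := by linarith
  refine ⟨(D⁻¹) ^ (1 / (p * q - 1)), by positivity, ?_⟩
  intro R I J hR hI hJ h1 h2
  rcases hI.eq_or_lt with h0 | hI
  · rw [← h0]; positivity
  set e := β + γ * p + (α + γ * q) * p with he
  have h3 : D * R ^ e * I ^ (p * q) ≤ I := by
    refine le_trans (le_of_eq ?_) (le_trans (show B * R ^ β * (c * R ^ γ * (A * R ^ α * (c * R ^ γ * I) ^ q)) ^ p ≤ _ by gcongr) h2)
    rw [hD, he, Real.rpow_add hR, Real.rpow_add hR, Real.rpow_mul hR.le, Real.rpow_mul hR.le, Real.rpow_add hR,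
      Real.rpow_mul hR.le, mul_comm p q, Real.rpow_mul hI.le]
    have hRg : 0 < R ^ γ := by positivity
    have hRa : 0 < R ^ α := by positivity
    rw [Real.mul_rpow (by positivity) hI.le, Real.mul_rpow hc.le hRg.le]
    have e1 : c * R ^ γ * (A * R ^ α * (c ^ q * (R ^ γ) ^ q * I ^ q)) =
      (c * (A * c ^ q)) * (R ^ γ * ((R ^ α * (R ^ γ) ^ q) * I ^ q)) := by ring
    have hIq : 0 < I ^ q := by positivity
    rw [e1, Real.mul_rpow (x := c * (A * c ^ q)) (by positivity) (by positivity),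
      Real.mul_rpow (x := R ^ γ) (by positivity) (by positivity),
      Real.mul_rpow (x := R ^ α * (R ^ γ) ^ q) (by positivity) (by positivity)]
    ring
  have h4 : I ^ (p * q - 1) ≤ D⁻¹ * R ^ (-e) := by
    rw [Real.rpow_sub hI, Real.rpow_one, div_le_iff₀ hI, Real.rpow_neg hR.le, ← mul_inv,
      inv_mul_eq_div, le_div_iff₀ (by positivity)]
    linarith
  calc I = (I ^ (p * q - 1)) ^ (1 / (p * q - 1)) := by
        rw [← Real.rpow_mul hI.le, mul_one_div_cancel hs.ne', Real.rpow_one]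
    _ ≤ (D⁻¹ * R ^ (-e)) ^ (1 / (p * q - 1)) := by gcongr
    _ = _ := by
        rw [Real.mul_rpow (by positivity) (by positivity), ← Real.rpow_mul hR.le, mul_one_div]

lemma step (N : ℕ) (hN : N ≠ 0) (b q : ℝ) (hb : 0 ≤ b) (hq : 0 ≤ q) :
    ∃ k > 0, ∃ c > 0, ∀ u : EuclideanSpace ℝ (Fin N) → ℝ, ContDiff ℝ 2 u →
    (∀ x, 0 < u x) → (∀ x, 0 ≤ - lap u x) → ∀ R, 0 < R →
    k * R ^ (b + N) * (c * R ^ (2 - (N : ℝ)) * ∫ x in ball (0 : EuclideanSpace ℝ (Fin N)) R, - lap u x) ^ q ≤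
      ∫ x in ball (0 : EuclideanSpace ℝ (Fin N)) R, ‖x‖ ^ b * u x ^ q := by
  obtain ⟨k, hk, hk'⟩ := weight_low N hN b hb
  obtain ⟨c, hc, hc'⟩ := keyc N
  refine ⟨k, hk, c * 2 ^ (2 - (N : ℝ)), by positivity, ?_⟩
  intro u hu hpos hl R hR
  set I := ∫ x in ball (0 : EuclideanSpace ℝ (Fin N)) R, - lap u x with hI
  have hI0 : 0 ≤ I := integral_nonneg hl
  have hint : ∀ (f : EuclideanSpace ℝ (Fin N) → ℝ), Continuous f → ∀ z r, IntegrableOn f (ball z r) :=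
    fun f hf z r => (hf.continuousOn.integrableOn_compact (isCompact_closedBall z r)).mono_set ball_subset_closedBall
  have hlow : ∀ z ∈ ball (0 : EuclideanSpace ℝ (Fin N)) R, c * 2 ^ (2 - (N : ℝ)) * R ^ (2 - (N : ℝ)) * I ≤ u z := by
    intro z hz
    refine le_trans ?_ (hc' u hu hpos hl z (2 * R) (by positivity))
    rw [Real.mul_rpow (by norm_num) hR.le, mul_assoc c]
    gcongr
    refine setIntegral_mono_set (hint _ (lap_cont hu).neg _ _) (Filter.Eventually.of_forall hl) ?_
    refine Filter.Eventually.of_forall ?_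
    refine ball_subset_ball' ?_
    rw [mem_ball, dist_comm] at hz
    linarith
  rw [← hk' R hR, ← integral_mul_const]
  have hcb : Continuous fun x : EuclideanSpace ℝ (Fin N) => ‖x‖ ^ b :=
    continuous_norm.rpow_const fun x => Or.inr hb
  refine setIntegral_mono_on (hint _ (hcb.mul continuous_const) _ _)
    (hint _ (hcb.mul (hu.continuous.rpow_const fun x => Or.inr hq)) _ _) measurableSet_ball ?_
  intro x hx
  have := hlow x hx
  gcongr

/-- **Weighted integral estimates for the Hénon–Lane–Emden system.**
If `(u, v)` is a positive entire solution of `-Δu = |x|^a v^p`, `-Δv = |x|^b u^q` on `ℝ^N`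
with `p, q, a, b ≥ 0` and `pq > 1`, then there is a constant `C > 0` independent of `R`
such that for all `R > 1`:
`∫_{B_R} |x|^a v^p ≤ C R^(N - 2 - ((b+2)p + (a+2))/(pq-1))` and
`∫_{B_R} |x|^b u^q ≤ C R^(N - 2 - ((a+2)q + (b+2))/(pq-1))`. -/
theorem henon_lane_emden_weighted_estimates
    (N : ℕ) (p q a b : ℝ) (hp : 0 ≤ p) (hq : 0 ≤ q) (ha : 0 ≤ a) (hb : 0 ≤ b)
    (hpq : 1 < p * q)
    (u v : EuclideanSpace ℝ (Fin N) → ℝ)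
    (hu : ContDiff ℝ 2 u) (hv : ContDiff ℝ 2 v)
    (hupos : ∀ x, 0 < u x) (hvpos : ∀ x, 0 < v x)
    (hequ : ∀ x, -lap u x = ‖x‖ ^ a * v x ^ p)
    (heqv : ∀ x, -lap v x = ‖x‖ ^ b * u x ^ q) :
    ∃ C > 0, ∀ R : ℝ, 1 < R →
      (∫ x in ball (0 : EuclideanSpace ℝ (Fin N)) R, ‖x‖ ^ a * v x ^ p) ≤
        C * R ^ ((N : ℝ) - 2 - ((b + 2) * p + (a + 2)) / (p * q - 1)) ∧
      (∫ x in ball (0 : EuclideanSpace ℝ (Fin N)) R, ‖x‖ ^ b * u x ^ q) ≤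
        C * R ^ ((N : ℝ) - 2 - ((a + 2) * q + (b + 2)) / (p * q - 1)) := by
  have hfu : ∀ x, 0 ≤ -lap u x := fun x => by
    rw [hequ]; have := hvpos x; positivity
  have hfv : ∀ x, 0 ≤ -lap v x := fun x => by
    rw [heqv]; have := hupos x; positivity
  rcases eq_or_ne N 0 with hN | hN
  · subst hN
    refine ⟨1, one_pos, fun R hR => ?_⟩
    have hR0 : 0 < R := by linarith
    simp only [← hequ, ← heqv]
    simp only [lap, Finset.univ_eq_empty, Finset.sum_empty, neg_zero, integral_zero]
    constructor <;> positivity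
  obtain ⟨A, hA, c, hc, hstep⟩ := step N hN b q hb hq
  obtain ⟨B, hB, d, hd, hstep'⟩ := step N hN a p ha hp
  have hcd : 0 < min c d := lt_min hc hd
  obtain ⟨C₁, hC₁, h₁⟩ := real_core p q A B (min c d) (b + N) (a + N) (2 - N) hp hq hpq hA hB hcd
  obtain ⟨C₂, hC₂, h₂⟩ := real_core q p B A (min c d) (a + N) (b + N) (2 - N) hq hp
    (by linarith) hB hA hcd
  refine ⟨max C₁ C₂, lt_max_of_lt_left hC₁, fun R hR => ?_⟩
  have hR0 : 0 < R := by linarith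
  have s1 := hstep u hu hupos hfu R hR0
  have s2 := hstep' v hv hvpos hfv R hR0
  simp only [hequ] at s1
  simp only [heqv] at s2
  have hI : 0 ≤ ∫ x in ball (0 : EuclideanSpace ℝ (Fin N)) R, ‖x‖ ^ a * v x ^ p :=
    integral_nonneg fun x => by have := hvpos x; positivity
  have hJ : 0 ≤ ∫ x in ball (0 : EuclideanSpace ℝ (Fin N)) R, ‖x‖ ^ b * u x ^ q :=
    integral_nonneg fun x => by have := hupos x; positivity
  set I := ∫ x in ball (0 : EuclideanSpace ℝ (Fin N)) R, ‖x‖ ^ a * v x ^ p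
  set J := ∫ x in ball (0 : EuclideanSpace ℝ (Fin N)) R, ‖x‖ ^ b * u x ^ q
  have t1 : A * R ^ (b + N) * (min c d * R ^ (2 - (N : ℝ)) * I) ^ q ≤ J := by
    refine le_trans ?_ s1
    gcongr
    exact min_le_left _ _
  have t2 : B * R ^ (a + N) * (min c d * R ^ (2 - (N : ℝ)) * J) ^ p ≤ I := by
    refine le_trans ?_ s2
    gcongr
    exact min_le_right _ _
  have r1 := h₁ R I J hR0 hI hJ t1 t2
  have r2 := h₂ R J I hR0 hJ hI t2 t1
  have hs : p * q - 1 ≠ 0 := by linarith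
  have hs' : q * p - 1 ≠ 0 := by linarith
  constructor
  · refine r1.trans ?_
    have e : -(a + N + (2 - N) * p + (b + N + (2 - N) * q) * p) / (p * q - 1) =
        (N : ℝ) - 2 - ((b + 2) * p + (a + 2)) / (p * q - 1) := by
      field_simp; ring
    rw [e]
    gcongr
    exact le_max_left _ _
  · refine r2.trans ?_
    have e : -(b + N + (2 - N) * q + (a + N + (2 - N) * p) * q) / (q * p - 1) =
        (N : ℝ) - 2 - ((a + 2) * q + (b + 2)) / (p * q - 1) := by
      rw [mul_comm q p]; field_simp; ring
    rw [e]
    gcongr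
    exact le_max_right _ _
end

section
/- Let p, q, a, b ≥ 0 with pq > 1, and let (u, v) be a positive solution of the Hénon–Lane–Emden system on ℝ^N. Then there is a constant C > 0, independent of R, such that for all R > 1: ∫_{B_R} |∇v| ≤ C R^{N − 1 − ((a+2)q + (b+2))/(pq−1)} and ∫_{B_R} |∇u| ≤ C R^{N − 1 − ((b+2)p + (a+2))/(pq−1)}. -/
open MeasureTheory Real Metric

namespace HLE

/-- partial derivative -/
noncomputable def pd {N : ℕ} (i : Fin N) (f : EuclideanSpace ℝ (Fin N) → ℝ)
    (x : EuclideanSpace ℝ (Fin N)) : ℝ := fderiv ℝ f x (EuclideanSpace.single i 1)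

lemma lap_eq {N : ℕ} (f : EuclideanSpace ℝ (Fin N) → ℝ) (x) :
    lap f x = ∑ i, pd i (pd i f) x := rfl

/-- the base profile -/
noncomputable def bs {N : ℕ} (y : EuclideanSpace ℝ (Fin N)) : ℝ := max 0 (1 - ‖y‖ ^ 2)

lemma hasDerivAt_maxpow (n : ℕ) (t : ℝ) :
    HasDerivAt (fun t : ℝ => (max 0 t) ^ (n + 2)) ((n + 2 : ℝ) * (max 0 t) ^ (n + 1)) t := by
  rcases lt_trichotomy t 0 with h | h | h
  · have : (fun t : ℝ => (max 0 t) ^ (n + 2)) =ᶠ[nhds t] fun _ => 0 := by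
      filter_upwards [Iio_mem_nhds h] with s hs
      rw [max_eq_left (le_of_lt hs)]; simp
    rw [max_eq_left h.le]
    simpa using (hasDerivAt_const t (0:ℝ)).congr_of_eventuallyEq this
  · subst h
    simp only [max_self]
    rw [hasDerivAt_iff_isLittleO]
    have : (fun x' : ℝ => max 0 x' ^ (n + 2) - max 0 0 ^ (n + 2) -
        (x' - 0) • ((n + 2 : ℝ) * 0 ^ (n + 1))) = fun x' : ℝ => max 0 x' ^ (n + 2) := by
      ext; simp
    rw [this]
    simp only [sub_zero]
    have h1 : (fun x : ℝ => max 0 x ^ (n + 2)) =O[nhds 0] fun x : ℝ => x ^ (n + 2) := by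
      refine Asymptotics.IsBigO.of_bound 1 (Filter.Eventually.of_forall fun x => ?_)
      rw [norm_pow, norm_pow, one_mul]
      gcongr
      rw [Real.norm_eq_abs, Real.norm_eq_abs, abs_of_nonneg (le_max_left _ _)]
      exact max_le (abs_nonneg _) (le_abs_self _)
    refine h1.trans_isLittleO ?_
    have := Asymptotics.isLittleO_pow_id (𝕜 := ℝ) (n := n + 2) (by omega)
    simpa using this
  · have : (fun t : ℝ => (max 0 t) ^ (n + 2)) =ᶠ[nhds t] fun t => t ^ (n + 2) := by
      filter_upwards [Ioi_mem_nhds h] with s hs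
      rw [max_eq_right (le_of_lt hs)]
    rw [max_eq_right h.le]
    have h2 := (hasDerivAt_pow (n + 2) t).congr_of_eventuallyEq this
    have e : (n + 2 : ℝ) * t ^ (n + 1) = ((n + 2 : ℕ) : ℝ) * t ^ (n + 2 - 1) := by
      push_cast; rfl
    rw [e]; exact h2

variable {N : ℕ}

local notation "E" => EuclideanSpace ℝ (Fin N)

lemma bs_cont : Continuous (bs : E → ℝ) := by unfold bs; fun_prop

lemma bs_nonneg (y : E) : 0 ≤ bs y := le_max_left _ _

lemma bs_le_one (y : E) : bs y ≤ 1 := by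
  unfold bs; exact max_le zero_le_one (by nlinarith [sq_nonneg ‖y‖])

lemma bs_zero {y : E} (hy : y ∉ closedBall (0 : E) 1) : bs y = 0 := by
  rw [mem_closedBall_zero_iff, not_le] at hy
  unfold bs; apply max_eq_left; nlinarith

lemma bs_hasFDerivAt (n : ℕ) (y : E) :
    HasFDerivAt (fun y : E => bs y ^ (n + 2))
      (((n + 2 : ℝ) * bs y ^ (n + 1)) • (-(2 • (innerSL ℝ y)) : E →L[ℝ] ℝ)) y := by
  have h1 : HasFDerivAt (fun y : E => 1 - ‖y‖ ^ 2) (-(2 • (innerSL ℝ y)) : E →L[ℝ] ℝ) y :=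
    (hasStrictFDerivAt_norm_sq y).hasFDerivAt.const_sub 1
  exact (hasDerivAt_maxpow n (1 - ‖y‖ ^ 2)).comp_hasFDerivAt y h1

lemma bs_diff (n : ℕ) : Differentiable ℝ (fun y : E => bs y ^ (n + 2)) :=
  fun y => (bs_hasFDerivAt n y).differentiableAt

lemma bs_pd (n : ℕ) (i : Fin N) (y : E) :
    pd i (fun y : E => bs y ^ (n + 2)) y = -(2 * (n + 2) * bs y ^ (n + 1) * y i) := by
  unfold pd
  rw [(bs_hasFDerivAt n y).fderiv]
  simp [EuclideanSpace.inner_single_right]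
  ring

lemma bs_supp (n : ℕ) : HasCompactSupport (fun y : E => bs y ^ (n + 1)) :=
  HasCompactSupport.intro (isCompact_closedBall (0 : E) 1) (fun y hy => by
    simp [bs_zero hy])

/-- Integration by parts -/
lemma ibp (i : Fin N) (f g : E → ℝ) (hf : Differentiable ℝ f) (hf' : Continuous (pd i f))
    (hs : HasCompactSupport f) (hg : Differentiable ℝ g) (hg' : Continuous (pd i g)) :
    ∫ y, f y * pd i g y = -∫ y, pd i f y * g y := by
  have hs' : HasCompactSupport (pd i f) := hs.fderiv_apply (𝕜 := ℝ) _
  refine integral_mul_fderiv_eq_neg_fderiv_mul_of_integrable ?_ ?_ ?_ (fun x _ => hf x)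
    (fun x _ => hg x)
  · exact (hf'.mul hg.continuous).integrable_of_hasCompactSupport hs'.mul_right
  · exact (hf.continuous.mul hg').integrable_of_hasCompactSupport hs.mul_right
  · exact (hf.continuous.mul hg.continuous).integrable_of_hasCompactSupport hs.mul_right

lemma pd_contDiff {n : ℕ∞} (i : Fin N) {f : E → ℝ} (hf : ContDiff ℝ (n + 1) f) :
    ContDiff ℝ n (pd i f) := by
  unfold pd
  exact (hf.fderiv_right le_rfl).clm_apply contDiff_const

lemma pd_cont (i : Fin N) {f : E → ℝ} (hf : ContDiff ℝ 1 f) : Continuous (pd i f) :=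
  (pd_contDiff (n := 0) i (by simpa using hf)).continuous

lemma pd_C1 (i : Fin N) {f : E → ℝ} (hf : ContDiff ℝ 2 f) : ContDiff ℝ 1 (pd i f) :=
  pd_contDiff (n := 1) i (by convert hf using 1; norm_num)

lemma lap_cont {f : E → ℝ} (hf : ContDiff ℝ 2 f) : Continuous (lap f) := by
  have : lap f = fun x => ∑ i, pd i (pd i f) x := rfl
  rw [this]
  exact continuous_finsetSum _ fun i _ => pd_cont i (pd_C1 i hf)

lemma pd_symm (i j : Fin N) {f : E → ℝ} (hf : ContDiff ℝ 2 f) (x : E) :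
    pd i (pd j f) x = pd j (pd i f) x := by
  have h := (hf.contDiffAt (x := x)).isSymmSndFDerivAt (by simp)
  have hd : DifferentiableAt ℝ (fderiv ℝ f) x :=
    ((hf.fderiv_right (m := 1) (by norm_num)).differentiable (by norm_num)) x
  have key : ∀ i j : Fin N, pd i (pd j f) x =
      fderiv ℝ (fderiv ℝ f) x (EuclideanSpace.single i 1) (EuclideanSpace.single j 1) := by
    intro i j
    unfold pd
    rw [fderiv_clm_apply hd (by fun_prop)]
    simp
  rw [key, key]; exact h _ _

lemma fderiv_eq_sum (f : E → ℝ) (x y : E) : fderiv ℝ f x y = ∑ i, y i * pd i f x := by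
  conv_lhs => rw [show y = ∑ i, y i • (EuclideanSpace.single i (1:ℝ)) by
    ext j; simp [Finset.sum_apply, Pi.single_apply]]
  rw [map_sum]
  simp [pd]

lemma comp_aff_C1 {h : E → ℝ} (hh : ContDiff ℝ 1 h) (x : E) (r : ℝ) :
    ContDiff ℝ 1 (fun y => h (x + r • y)) := hh.comp (by fun_prop)

lemma pd_comp (i : Fin N) {h : E → ℝ} (hh : Differentiable ℝ h) (x : E) (r : ℝ) (y : E) :
    pd i (fun y => h (x + r • y)) y = r * pd i h (x + r • y) := by
  unfold pd
  have h1 : HasFDerivAt (fun y : E => x + r • y) (r • ContinuousLinearMap.id ℝ E) y :=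
    ((hasFDerivAt_id y).const_smul r).const_add x
  have := ((hh (x + r • y)).hasFDerivAt.comp y h1).fderiv
  unfold Function.comp at this
  rw [this]; simp

/-- first identity -/
lemma id1 {w : E → ℝ} (hw : ContDiff ℝ 2 w) (x : E) (r : ℝ) :
    ∫ y, bs y ^ 2 * fderiv ℝ w (x + r • y) y =
      r * ∫ y, bs y ^ 3 / 6 * lap w (x + r • y) := by
  have hInt1 : ∀ i : Fin N, Integrable (fun y : E => bs y ^ 2 * (y i * pd i w (x + r • y))) := by
    intro i
    have := pd_cont i (hw.of_le (by norm_num))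
    have := bs_cont (N := N)
    exact Continuous.integrable_of_hasCompactSupport (by fun_prop) (bs_supp 1).mul_right
  have hInt2 : ∀ i : Fin N, Integrable (fun y : E => bs y ^ 3 * pd i (pd i w) (x + r • y)) := by
    intro i
    have := pd_cont i (pd_C1 i hw)
    have := bs_cont (N := N)
    exact Continuous.integrable_of_hasCompactSupport (by fun_prop) (bs_supp 2).mul_right
  have e : ∀ i : Fin N, ∫ y : E, bs y ^ 2 * (y i * pd i w (x + r • y)) =
      r / 6 * ∫ y : E, bs y ^ 3 * pd i (pd i w) (x + r • y) := by
    intro i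
    have hC := comp_aff_C1 (pd_C1 i hw) x r
    have hb := bs_cont (N := N)
    have := ibp i (fun y : E => bs y ^ (1 + 2)) (fun y => pd i w (x + r • y)) (bs_diff 1)
      (by simp_rw [funext (bs_pd 1 i)]; fun_prop) (bs_supp 2)
      (hC.differentiable (by norm_num)) (pd_cont i hC)
    simp_rw [bs_pd, pd_comp i ((pd_C1 i hw).differentiable (by norm_num))] at this
    have h1 : (fun y : E => bs y ^ (1 + 2) * (r * pd i (pd i w) (x + r • y))) =
      fun y => r * (bs y ^ 3 * pd i (pd i w) (x + r • y)) := by ext y; ring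
    have h2 : (fun y : E => -(2 * ((1:ℕ) + 2) * bs y ^ (1 + 1) * y i) * pd i w (x + r • y)) =
      fun y => (-6) * (bs y ^ 2 * (y i * pd i w (x + r • y))) := by
      ext y; push_cast; ring
    rw [h1, h2, integral_const_mul, integral_const_mul] at this
    linarith
  simp_rw [fderiv_eq_sum, Finset.mul_sum, lap_eq]
  rw [integral_finsetSum _ (fun i _ => hInt1 i)]
  simp_rw [e, ← Finset.mul_sum]
  rw [← integral_finsetSum _ (fun i _ => hInt2 i)]
  have : (fun y : E => bs y ^ 3 / 6 * ∑ i, pd i (pd i w) (x + r • y)) =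
      fun y => (1/6) * ∑ i, bs y ^ 3 * pd i (pd i w) (x + r • y) := by
    ext y; rw [← Finset.mul_sum]; ring
  rw [this, integral_const_mul]; ring

/-- rotation identity -/
lemma rot {g : E → ℝ} (hg : ContDiff ℝ 1 g) (i j : Fin N) :
    ∫ y : E, bs y ^ 2 * y i * pd j g y = ∫ y : E, bs y ^ 2 * y j * pd i g y := by
  have hb := bs_cont (N := N)
  have hpd : ∀ i j : Fin N, ∀ y : E, pd j (fun y : E => bs y ^ (0 + 2) * y i) y =
      -(4 * bs y * y j * y i) + bs y ^ 2 * (if i = j then 1 else 0) := by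
    intro i j y
    have h1 := bs_hasFDerivAt 0 y
    have h2 : HasFDerivAt (fun y : E => y i)
        (EuclideanSpace.proj i : E →L[ℝ] ℝ) y := (EuclideanSpace.proj i : E →L[ℝ] ℝ).hasFDerivAt
    have h3 : HasFDerivAt (fun y : E => bs y ^ (0 + 2) * y i) _ y := h1.mul h2
    unfold pd
    rw [h3.fderiv]
    simp [EuclideanSpace.inner_single_right]
    ring
  have main : ∀ i j : Fin N, ∫ y : E, bs y ^ 2 * y i * pd j g y =
      -∫ y : E, (-(4 * bs y * y j * y i) + bs y ^ 2 * (if i = j then 1 else 0)) * g y := by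
    intro i j
    have d1 : Differentiable ℝ (fun y : E => y i) := by fun_prop
    have d2 : Differentiable ℝ (fun y : E => bs y ^ (0 + 2) * y i) := (bs_diff 0).fun_mul d1
    have s1 : HasCompactSupport (fun y : E => bs y ^ (0 + 2) * y i) := (bs_supp 1).mul_right
    have := ibp j (fun y : E => bs y ^ (0 + 2) * y i) g d2 (by
        rw [funext (hpd i j)]; fun_prop) s1
      (hg.differentiable (by norm_num)) (pd_cont j hg)
    simp_rw [hpd] at this
    simpa using this
  rw [main i j, main j i]
  congr 2
  ext y
  simp only [eq_comm (a := i) (b := j)]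
  ring

/-- second identity -/
lemma id2 {w : E → ℝ} (hw : ContDiff ℝ 2 w) (j : Fin N) (x : E) (r : ℝ) (hr : r ≠ 0) :
    ∫ y, bs y ^ 2 * fderiv ℝ (pd j w) (x + r • y) y =
      ∫ y : E, bs y ^ 2 * y j * lap w (x + r • y) := by
  have hb := bs_cont (N := N)
  have e : ∀ i : Fin N, ∫ y : E, bs y ^ 2 * (y i * pd i (pd j w) (x + r • y)) =
      ∫ y : E, bs y ^ 2 * y j * pd i (pd i w) (x + r • y) := by
    intro i
    have := rot (comp_aff_C1 (pd_C1 i hw) x r) i j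
    simp_rw [pd_comp _ ((pd_C1 i hw).differentiable (by norm_num)), pd_symm j i hw] at this
    have h1 : ∀ k : Fin N, ∀ F : E → ℝ, (fun y : E => bs y ^ 2 * y k * (r * F y)) =
      fun y => r * (bs y ^ 2 * y k * F y) := by intro k F; ext y; ring
    rw [h1 i (fun y => pd i (pd j w) (x + r • y)), h1 j (fun y => pd i (pd i w) (x + r • y)),
      integral_const_mul, integral_const_mul] at this
    simp_rw [← mul_assoc]
    exact mul_left_cancel₀ hr this
  simp_rw [fderiv_eq_sum, Finset.mul_sum, lap_eq, Finset.mul_sum]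
  rw [integral_finsetSum, integral_finsetSum]
  · exact Finset.sum_congr rfl fun i _ => e i
  · intro i _
    have := pd_cont i (pd_C1 i hw)
    exact Continuous.integrable_of_hasCompactSupport (by fun_prop) ((bs_supp 1).mul_right.mul_right)
  · intro i _
    have := pd_cont i (pd_C1 j hw)
    exact Continuous.integrable_of_hasCompactSupport (by fun_prop) ((bs_supp 1).mul_right)

/-- Fubini for continuous functions on products of compact sets -/
lemma fub {X Y : Type*} [TopologicalSpace X] [TopologicalSpace Y] [MeasurableSpace X]
    [MeasurableSpace Y] [SecondCountableTopology X] [SecondCountableTopology Y]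
    [T2Space X] [T2Space Y] [BorelSpace X] [BorelSpace Y]
    (μ : Measure X) (ν : Measure Y) [SFinite μ] [SFinite ν]
    [IsFiniteMeasureOnCompacts μ] [IsFiniteMeasureOnCompacts ν]
    (f : X → Y → ℝ) (hf : Continuous f.uncurry) {s s' : Set X} {t : Set Y}
    (hs : IsCompact s) (hs' : s' ⊆ s) (ht : IsCompact t) :
    ∫ x in s', ∫ y in t, f x y ∂ν ∂μ = ∫ y in t, ∫ x in s', f x y ∂μ ∂ν := by
  apply integral_integral_swap
  rw [Measure.prod_restrict]
  have : IntegrableOn (Function.uncurry f) (s ×ˢ t) (μ.prod ν) := by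
    rw [IntegrableOn, ← Measure.prod_restrict]
    have : IsFiniteMeasure (μ.restrict s) := ⟨by simpa using hs.measure_lt_top⟩
    have : IsFiniteMeasure (ν.restrict t) := ⟨by simpa using ht.measure_lt_top⟩
    obtain ⟨M, hM⟩ := (hs.prod ht).bddAbove_image hf.norm.continuousOn
    refine Integrable.of_bound hf.aestronglyMeasurable M ?_
    rw [Measure.prod_restrict]
    filter_upwards [ae_restrict_mem (hs.prod ht).measurableSet] with z hz
    exact hM ⟨z, hz, rfl⟩
  exact this.mono_set (Set.prod_mono hs' le_rfl)

lemma int_ball (F : E → ℝ) (hF : ∀ y ∉ closedBall (0:E) 1, F y = 0) :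
    ∫ y, F y = ∫ y in closedBall (0:E) 1, F y :=
  (setIntegral_eq_integral_of_forall_compl_eq_zero hF).symm

/-- fundamental theorem in the scale -/
lemma ftc {h : E → ℝ} (hh : ContDiff ℝ 1 h) (x : E) (R : ℝ) (hR : 0 ≤ R) :
    (∫ y, bs y ^ 2 * h (x + R • y)) - (∫ y : E, bs y ^ 2) * h x =
      ∫ r in (0:ℝ)..R, ∫ y : E, bs y ^ 2 * fderiv ℝ h (x + r • y) y := by
  have hb := bs_cont (N := N)
  have hcf : Continuous (fderiv ℝ h) := hh.continuous_fderiv (by norm_num)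
  have hc := hh.continuous
  rw [intervalIntegral.integral_of_le hR]
  have e1 : ∀ r : ℝ, ∫ y : E, bs y ^ 2 * fderiv ℝ h (x + r • y) y =
    ∫ y in closedBall (0:E) 1, bs y ^ 2 * fderiv ℝ h (x + r • y) y := fun r =>
      int_ball _ fun y hy => by simp [bs_zero hy]
  simp_rw [e1]
  rw [fub volume volume (fun (r : ℝ) (y : E) => bs y ^ 2 * fderiv ℝ h (x + r • y) y) (by
    unfold Function.uncurry; fun_prop) isCompact_Icc Set.Ioc_subset_Icc_self
    (isCompact_closedBall _ _)]
  have e2 : ∀ y : E, ∫ r in Set.Ioc 0 R, bs y ^ 2 * fderiv ℝ h (x + r • y) y =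
      bs y ^ 2 * h (x + R • y) - bs y ^ 2 * h x := by
    intro y
    rw [← intervalIntegral.integral_of_le hR, intervalIntegral.integral_const_mul]
    have : ∀ r : ℝ, HasDerivAt (fun r : ℝ => h (x + r • y)) (fderiv ℝ h (x + r • y) y) r := by
      intro r
      have h1 : HasDerivAt (fun r : ℝ => x + r • y) y r := by
        simpa using ((hasDerivAt_id r).smul_const y).const_add x
      exact ((hh.differentiable (by norm_num)) _).hasFDerivAt.comp_hasDerivAt r h1
    rw [intervalIntegral.integral_eq_sub_of_hasDerivAt (fun r _ => this r)
      (Continuous.intervalIntegrable (by fun_prop) _ _)]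
    simp; ring
  simp_rw [e2]
  rw [← int_ball _ (fun y hy => by simp [bs_zero hy]), integral_sub, integral_mul_const]
  · exact Continuous.integrable_of_hasCompactSupport (by fun_prop) (bs_supp 1).mul_right
  · exact Continuous.integrable_of_hasCompactSupport (by fun_prop) (bs_supp 1).mul_right

end HLE

namespace HLE
variable {N : ℕ}
local notation "E" => EuclideanSpace ℝ (Fin N)

lemma c0_pos : 0 < ∫ y : E, bs y ^ 2 := by
  have hb := bs_cont (N := N)
  refine Continuous.integral_pos_of_hasCompactSupport_nonneg_nonzero (x := 0) (by fun_prop)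
    (bs_supp 1) (fun y => sq_nonneg _) ?_
  simp [bs]

/-- mean value lower bound -/
lemma L1 : ∃ c > 0, ∀ w : E → ℝ, ContDiff ℝ 2 w → (∀ x, 0 < w x) → (∀ x, lap w x ≤ 0) →
    ∀ x ∈ closedBall (0:E) 1, c * ∫ y in closedBall (0:E) 4, w y ≤ w x := by
  have hb := bs_cont (N := N)
  set c0 := ∫ y : E, bs y ^ 2 with hc0
  have hc0p : 0 < c0 := c0_pos
  set s : ℝ := |(8 ^ Module.finrank ℝ E : ℝ)⁻¹| with hs
  have hsp : 0 < s := by positivity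
  refine ⟨c0⁻¹ * (s * (1/4)), by positivity, fun w hw hpos hlap x hx => ?_⟩
  have hwc := hw.continuous
  have h1 := ftc (hw.of_le (by norm_num : (1:WithTop ℕ∞) ≤ 2)) x 8 (by norm_num)
  have h2 : (∫ r in (0:ℝ)..8, ∫ y : E, bs y ^ 2 * fderiv ℝ w (x + r • y) y) ≤ 0 := by
    simp_rw [id1 hw]
    rw [← neg_nonneg, ← intervalIntegral.integral_neg]
    refine intervalIntegral.integral_nonneg (by norm_num) fun r hr => ?_
    rw [neg_nonneg]
    refine mul_nonpos_of_nonneg_of_nonpos hr.1 (integral_nonpos fun y => ?_)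
    exact mul_nonpos_of_nonneg_of_nonpos (by have := bs_nonneg y; positivity) (hlap _)
  set F : E → ℝ := fun z => bs ((1/8 : ℝ) • (z - x)) ^ 2 * w z with hF
  have hFc : Continuous F := by fun_prop
  have hFs : HasCompactSupport F := HasCompactSupport.intro (isCompact_closedBall x 8) (by
    intro z hz
    have : bs ((1/8 : ℝ) • (z - x)) = 0 := by
      apply bs_zero
      rw [mem_closedBall, not_le, dist_eq_norm] at hz
      rw [mem_closedBall_zero_iff, not_le, norm_smul]
      norm_num; linarith
    simp only [hF]; rw [this]; simp)
  have h3 : ∫ y : E, bs y ^ 2 * w (x + (8:ℝ) • y) = s * ∫ z, F z := by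
    have e : (fun y : E => bs y ^ 2 * w (x + (8:ℝ) • y)) = fun y => F (x + (8:ℝ) • y) := by
      ext y; simp [hF, smul_smul]
    rw [e, Measure.integral_comp_smul volume (fun z => F (x + z)) 8,
      integral_add_left_eq_self F x]
    rfl
  have h4 : (1/4) * ∫ y in closedBall (0:E) 4, w y ≤ ∫ z, F z := by
    rw [← integral_const_mul]
    have hFi := hFc.integrable_of_hasCompactSupport (μ := volume) hFs
    refine le_trans ?_ (setIntegral_le_integral (s := closedBall (0:E) 4) hFi
      (Filter.Eventually.of_forall fun z => by have := hpos z; simp only [hF, Pi.zero_apply]; positivity))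
    refine setIntegral_mono_on ?_ hFi.integrableOn isClosed_closedBall.measurableSet ?_
    · exact (Continuous.continuousOn (by fun_prop)).integrableOn_compact (isCompact_closedBall _ _)
    · intro z hz
      simp only [hF]
      have hz' : ‖(1/8 : ℝ) • (z - x)‖ ≤ 5/8 := by
        rw [mem_closedBall_zero_iff] at hx hz
        rw [norm_smul]
        have := norm_sub_le z x
        norm_num; linarith
      have : (1/2 : ℝ) ≤ bs ((1/8 : ℝ) • (z - x)) := by
        unfold bs
        refine le_trans ?_ (le_max_right _ _)
        nlinarith [norm_nonneg ((1/8 : ℝ) • (z - x))]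
      have := hpos z
      gcongr
      nlinarith
  rw [mul_assoc, inv_mul_le_iff₀ hc0p, mul_assoc]
  calc s * (1/4 * ∫ y in closedBall (0:E) 4, w y) ≤ s * ∫ z, F z := by gcongr
    _ ≤ c0 * w x := by rw [← h3]; linarith

/-- mass bound of the Laplacian -/
lemma L2 : ∃ C > 0, ∀ w : E → ℝ, ContDiff ℝ 2 w → (∀ x, 0 < w x) → (∀ x, lap w x ≤ 0) →
    ∫ y in closedBall (0:E) 2, -lap w y ≤ C * ∫ y in closedBall (0:E) 4, w y := by
  let φ : ContDiffBump (0:E) := ⟨2, 4, by norm_num, by norm_num⟩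
  have hφ : ContDiff ℝ 2 (φ : E → ℝ) := φ.contDiff
  have hφs : HasCompactSupport (φ : E → ℝ) := φ.hasCompactSupport
  have hφlc := lap_cont hφ
  have hpds : ∀ {f : E → ℝ}, HasCompactSupport f → ∀ i : Fin N, HasCompactSupport (pd i f) :=
    fun hf i => hf.fderiv_apply (𝕜 := ℝ) _
  obtain ⟨M, hM⟩ := (isCompact_closedBall (0:E) 4).bddAbove_image hφlc.norm.continuousOn
  refine ⟨max M 1, by positivity, fun w hw hpos hlap => ?_⟩
  have hwc := hw.continuous
  have hlc := lap_cont hw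
  have hw1 : ContDiff ℝ 1 w := hw.of_le (by norm_num)
  have hφ1 : ContDiff ℝ 1 (φ : E → ℝ) := hφ.of_le (by norm_num)
  have green : ∫ y : E, φ y * lap w y = ∫ y : E, lap φ y * w y := by
    simp_rw [lap_eq, Finset.mul_sum, Finset.sum_mul]
    rw [integral_finsetSum, integral_finsetSum]
    · refine Finset.sum_congr rfl fun i _ => ?_
      rw [ibp i φ (pd i w) (hφ1.differentiable (by norm_num)) (pd_cont i hφ1) hφs
        ((pd_C1 i hw).differentiable (by norm_num)) (pd_cont i (pd_C1 i hw)),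
        ibp i (pd i φ) w ((pd_C1 i hφ).differentiable (by norm_num)) (pd_cont i (pd_C1 i hφ))
        (hpds hφs i) (hw1.differentiable (by norm_num)) (pd_cont i hw1), neg_neg]
    · intro i _
      exact ((pd_cont i (pd_C1 i hφ)).mul hwc).integrable_of_hasCompactSupport
        (hpds (hpds hφs i) i).mul_right
    · intro i _
      exact (hφ.continuous.mul (pd_cont i (pd_C1 i hw))).integrable_of_hasCompactSupport
        hφs.mul_right
  have hi : Integrable (fun y : E => φ y * -lap w y) :=
    (hφ.continuous.mul hlc.neg).integrable_of_hasCompactSupport hφs.mul_right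
  have hz : ∀ y ∉ closedBall (0:E) 4, lap φ y * w y = 0 := by
    intro y hy
    have ht : y ∉ tsupport (φ : E → ℝ) := by rw [φ.tsupport_eq]; exact hy
    have : lap φ y = 0 := by
      rw [lap_eq]
      refine Finset.sum_eq_zero fun i _ => ?_
      refine image_eq_zero_of_notMem_tsupport fun h => ht ?_
      exact tsupport_fderiv_apply_subset ℝ _ (tsupport_fderiv_apply_subset ℝ _ h)
    rw [this, zero_mul]
  calc ∫ y in closedBall (0:E) 2, -lap w y = ∫ y in closedBall (0:E) 2, φ y * -lap w y := by
        refine setIntegral_congr_fun isClosed_closedBall.measurableSet fun y hy => ?_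
        have : φ y = 1 := φ.one_of_mem_closedBall hy
        simp [this]
    _ ≤ ∫ y, φ y * -lap w y := setIntegral_le_integral hi (Filter.Eventually.of_forall fun y =>
        mul_nonneg φ.nonneg (neg_nonneg.2 (hlap y)))
    _ = - ∫ y, lap φ y * w y := by rw [← green, ← integral_neg]; simp
    _ = ∫ y in closedBall (0:E) 4, -(lap φ y * w y) := by
        rw [integral_neg, setIntegral_eq_integral_of_forall_compl_eq_zero hz]
    _ ≤ ∫ y in closedBall (0:E) 4, max M 1 * w y := by
        refine setIntegral_mono_on ?_ ?_ isClosed_closedBall.measurableSet ?_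
        · exact (Continuous.continuousOn (by fun_prop)).integrableOn_compact
            (isCompact_closedBall _ _)
        · exact (Continuous.continuousOn (by fun_prop)).integrableOn_compact
            (isCompact_closedBall _ _)
        · intro y hy
          rw [← neg_mul]
          refine mul_le_mul_of_nonneg_right ?_ (hpos y).le
          exact (neg_le_abs _).trans ((hM ⟨y, hy, rfl⟩).trans (le_max_left _ _))
    _ = _ := integral_const_mul _ _

/-- translation averaging -/
lemma T1 {h : E → ℝ} (hc : Continuous h) (h0 : ∀ x, 0 ≤ h x) (r : ℝ) (hr : r ∈ Set.Icc (0:ℝ) 1) :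
    ∫ x in closedBall (0:E) 1, ∫ y in closedBall (0:E) 1, h (x + r • y) ≤
      volume.real (closedBall (0:E) 1) * ∫ z in closedBall (0:E) 2, h z := by
  rw [fub volume volume (fun x y : E => h (x + r • y)) (by unfold Function.uncurry; fun_prop)
    (isCompact_closedBall _ _) le_rfl (isCompact_closedBall _ _)]
  have key : ∀ y ∈ closedBall (0:E) 1, ∫ x in closedBall (0:E) 1, h (x + r • y) ≤
      ∫ z in closedBall (0:E) 2, h z := by
    intro y hy
    rw [← integral_indicator isClosed_closedBall.measurableSet,
      ← integral_indicator isClosed_closedBall.measurableSet,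
      ← integral_add_right_eq_self (Set.indicator (closedBall (0:E) 2) h) (r • y)]
    have i2 : Integrable (Set.indicator (closedBall (0:E) 2) h) :=
      (integrable_indicator_iff isClosed_closedBall.measurableSet).2
        (hc.continuousOn.integrableOn_compact (isCompact_closedBall _ _))
    refine integral_mono ?_ (i2.comp_add_right (r • y)) ?_
    · exact (integrable_indicator_iff isClosed_closedBall.measurableSet).2
        ((Continuous.continuousOn (by fun_prop)).integrableOn_compact (isCompact_closedBall _ _))
    · intro x
      by_cases hx : x ∈ closedBall (0:E) 1
      · show _ ≤ Set.indicator (closedBall (0:E) 2) h (x + r • y)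
        have hx2 : x + r • y ∈ closedBall (0:E) 2 := by
          rw [mem_closedBall_zero_iff] at *
          have h1 := norm_add_le x (r • y)
          rw [norm_smul, Real.norm_eq_abs, abs_of_nonneg hr.1] at h1
          nlinarith [hr.1, hr.2, norm_nonneg y]
        rw [Set.indicator_of_mem hx, Set.indicator_of_mem hx2]
      · rw [Set.indicator_of_notMem hx]
        exact Set.indicator_nonneg (fun _ _ => h0 _) _
  have hcc : Continuous fun y : E => ∫ x in closedBall (0:E) 1, h (x + r • y) :=
    continuous_parametric_integral_of_continuous (f := fun y x : E => h (x + r • y))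
      (by unfold Function.uncurry; fun_prop) (isCompact_closedBall _ _)
  refine (setIntegral_mono_on (hcc.continuousOn.integrableOn_compact (isCompact_closedBall _ _))
    ((continuous_const (y := ∫ z in closedBall (0:E) 2, h z)).continuousOn.integrableOn_compact
      (isCompact_closedBall _ _)) isClosed_closedBall.measurableSet key).trans ?_
  simp

lemma T2 {h : E → ℝ} (hc : Continuous h) (h0 : ∀ x, 0 ≤ h x) :
    ∫ x in closedBall (0:E) 1, ∫ r in (0:ℝ)..1, ∫ y in closedBall (0:E) 1, h (x + r • y) ≤
      volume.real (closedBall (0:E) 1) * ∫ z in closedBall (0:E) 2, h z := by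
  have hcc : Continuous fun p : ℝ × E => ∫ y in closedBall (0:E) 1, h (p.2 + p.1 • y) :=
    continuous_parametric_integral_of_continuous (f := fun (p : ℝ × E) (y : E) => h (p.2 + p.1 • y))
      (by unfold Function.uncurry; fun_prop) (isCompact_closedBall _ _)
  simp_rw [intervalIntegral.integral_of_le zero_le_one]
  rw [← fub volume volume (fun (r : ℝ) (x : E) => ∫ y in closedBall (0:E) 1, h (x + r • y)) hcc
    isCompact_Icc Set.Ioc_subset_Icc_self (isCompact_closedBall _ _)]
  have hc3 : Continuous fun r : ℝ => ∫ x in closedBall (0:E) 1,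
      ∫ y in closedBall (0:E) 1, h (x + r • y) :=
    continuous_parametric_integral_of_continuous
      (f := fun (r : ℝ) (x : E) => ∫ y in closedBall (0:E) 1, h (x + r • y)) hcc
      (isCompact_closedBall _ _)
  set A := volume.real (closedBall (0:E) 1) * ∫ z in closedBall (0:E) 2, h z
  refine (setIntegral_mono_on (g := fun _ => A) ((hc3.continuousOn.integrableOn_compact
    isCompact_Icc).mono_set Set.Ioc_subset_Icc_self) (by simp)
    measurableSet_Ioc (fun r hr => T1 hc h0 r ⟨hr.1.le, hr.2⟩)).trans ?_
  simp

/-- pointwise gradient bound -/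
lemma ptw {w : E → ℝ} (hw : ContDiff ℝ 2 w) (hpos : ∀ x, 0 < w x) (hlap : ∀ x, lap w x ≤ 0)
    (j : Fin N) (x : E) :
    (∫ y : E, bs y ^ 2) * |pd j w x| ≤ 4 * (∫ y in closedBall (0:E) 1, w (x + (1:ℝ) • y)) +
      ∫ r in (0:ℝ)..1, ∫ y in closedBall (0:E) 1, -lap w (x + r • y) := by
  have hb := bs_cont (N := N)
  have hwc := hw.continuous
  have hlc := lap_cont hw
  have hw1 : ContDiff ℝ 1 w := hw.of_le (by norm_num)
  have h1 := ftc (pd_C1 j hw) x 1 zero_le_one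
  have hcoord : ∀ y ∈ closedBall (0:E) 1, |y j| ≤ 1 := by
    intro y hy
    rw [mem_closedBall_zero_iff] at hy
    have := PiLp.norm_apply_le y j
    rw [Real.norm_eq_abs] at this
    linarith
  have hA : |∫ y : E, bs y ^ 2 * pd j w (x + (1:ℝ) • y)| ≤
      4 * ∫ y in closedBall (0:E) 1, w (x + (1:ℝ) • y) := by
    have hC := comp_aff_C1 hw1 x 1
    have := ibp j (fun y : E => bs y ^ (0 + 2)) (fun y => w (x + (1:ℝ) • y)) (bs_diff 0)
      (by rw [funext (bs_pd 0 j)]; fun_prop) (bs_supp 1)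
      (hC.differentiable (by norm_num)) (pd_cont j hC)
    simp_rw [bs_pd, pd_comp j (hw1.differentiable (by norm_num)), zero_add, one_mul] at this
    rw [this, abs_neg, int_ball _ (fun y hy => by simp [bs_zero hy]), ← integral_const_mul]
    rw [← Real.norm_eq_abs]
    refine norm_integral_le_of_norm_le ?_ ?_
    · exact (Continuous.continuousOn (by fun_prop)).integrableOn_compact (isCompact_closedBall _ _)
    · filter_upwards [ae_restrict_mem isClosed_closedBall.measurableSet] with y hy
      rw [Real.norm_eq_abs, abs_mul, abs_of_pos (hpos _)]
      refine mul_le_mul_of_nonneg_right ?_ (hpos _).le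
      rw [abs_neg, abs_mul, pow_one, abs_of_nonneg (by have := bs_nonneg y; positivity)]
      have := bs_nonneg y
      have := bs_le_one y
      have := hcoord y hy
      have := abs_nonneg (y j)
      push_cast
      nlinarith [mul_le_mul ‹bs y ≤ 1› ‹|y j| ≤ 1› ‹0 ≤ |y j|› zero_le_one]
  have hcB : Continuous fun r : ℝ => ∫ y in closedBall (0:E) 1, -lap w (x + r • y) :=
    continuous_parametric_integral_of_continuous
      (f := fun (r : ℝ) (y : E) => -lap w (x + r • y)) (by unfold Function.uncurry; fun_prop)
      (isCompact_closedBall _ _)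
  have hB : |∫ r in (0:ℝ)..1, ∫ y : E, bs y ^ 2 * fderiv ℝ (pd j w) (x + r • y) y| ≤
      ∫ r in (0:ℝ)..1, ∫ y in closedBall (0:E) 1, -lap w (x + r • y) := by
    rw [← Real.norm_eq_abs]
    refine intervalIntegral.norm_integral_le_of_norm_le zero_le_one ?_ (hcB.intervalIntegrable _ _)
    refine Filter.Eventually.of_forall fun r hr => ?_
    rw [id2 hw j x r hr.1.ne', int_ball _ (fun y hy => by simp [bs_zero hy])]
    refine norm_integral_le_of_norm_le ?_ ?_
    · exact (Continuous.continuousOn (by fun_prop)).integrableOn_compact (isCompact_closedBall _ _)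
    · filter_upwards [ae_restrict_mem isClosed_closedBall.measurableSet] with y hy
      rw [Real.norm_eq_abs, abs_mul, abs_of_nonpos (hlap _)]
      have := hlap (x + r • y)
      have h5 : |bs y ^ 2 * y j| ≤ 1 := by
        rw [abs_mul, abs_of_nonneg (sq_nonneg _)]
        exact mul_le_one₀ (pow_le_one₀ (bs_nonneg y) (bs_le_one y)) (abs_nonneg _) (hcoord y hy)
      nlinarith
  have : (∫ y : E, bs y ^ 2) * pd j w x = (∫ y : E, bs y ^ 2 * pd j w (x + (1:ℝ) • y)) -
      ∫ r in (0:ℝ)..1, ∫ y : E, bs y ^ 2 * fderiv ℝ (pd j w) (x + r • y) y := by linarith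
  rw [← abs_of_pos (c0_pos (N := N)), ← abs_mul, this]
  exact (abs_sub _ _).trans (add_le_add hA hB)

lemma grad_norm_eq (f : E → ℝ) (x : E) : ‖gradient f x‖ = ‖fderiv ℝ f x‖ := by
  rw [← toDual_gradient, LinearIsometryEquiv.norm_map]

lemma grad_norm_le (f : E → ℝ) (x : E) : ‖gradient f x‖ ≤ ∑ j, |pd j f x| := by
  have h : ∀ j, (gradient f x) j = pd j f x := by
    intro j
    unfold pd
    rw [← toDual_gradient, InnerProductSpace.toDual_apply_apply]
    rw [EuclideanSpace.inner_single_right]; simp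
  have : gradient f x = ∑ j, (gradient f x) j • (EuclideanSpace.single j (1:ℝ)) := by
    ext k; simp [Finset.sum_apply, Pi.single_apply]
  rw [this]
  refine (norm_sum_le _ _).trans (Finset.sum_le_sum fun j _ => ?_)
  rw [norm_smul, h]; simp

/-- gradient bound -/
lemma L3 : ∃ C > 0, ∀ w : E → ℝ, ContDiff ℝ 2 w → (∀ x, 0 < w x) → (∀ x, lap w x ≤ 0) →
    ∫ x in closedBall (0:E) 1, ‖gradient w x‖ ≤ C * ∫ y in closedBall (0:E) 4, w y := by
  obtain ⟨C2, hC2, H2⟩ := L2 (N := N)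
  set c0 := ∫ y : E, bs y ^ 2 with hc0
  have hc0p : 0 < c0 := c0_pos
  set V := volume.real (closedBall (0:E) 1)
  have hV : 0 ≤ V := measureReal_nonneg
  refine ⟨N * (c0⁻¹ * (4 * V + V * C2)) + 1, by positivity, fun w hw hpos hlap => ?_⟩
  have hwc := hw.continuous
  have hlc := lap_cont hw
  set M := ∫ y in closedBall (0:E) 4, w y
  have hM : 0 ≤ M := setIntegral_nonneg isClosed_closedBall.measurableSet fun y _ => (hpos y).le
  have hM2 : ∫ y in closedBall (0:E) 2, w y ≤ M := by
    refine setIntegral_mono_set (hwc.continuousOn.integrableOn_compact (isCompact_closedBall _ _))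
      (Filter.Eventually.of_forall fun y => (hpos y).le)
      (Filter.Eventually.of_forall (closedBall_subset_closedBall (by norm_num)))
  have cf1 : Continuous fun x : E => ∫ y in closedBall (0:E) 1, w (x + (1:ℝ) • y) :=
    continuous_parametric_integral_of_continuous (f := fun x y : E => w (x + (1:ℝ) • y))
      (by unfold Function.uncurry; fun_prop) (isCompact_closedBall _ _)
  have cf2' : Continuous fun p : E × ℝ => ∫ y in closedBall (0:E) 1, -lap w (p.1 + p.2 • y) :=
    continuous_parametric_integral_of_continuous
      (f := fun (p : E × ℝ) (y : E) => -lap w (p.1 + p.2 • y))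
      (by unfold Function.uncurry; fun_prop) (isCompact_closedBall _ _)
  have cf2 : Continuous fun x : E => ∫ r in (0:ℝ)..1, ∫ y in closedBall (0:E) 1,
      -lap w (x + r • y) :=
    intervalIntegral.continuous_parametric_intervalIntegral_of_continuous'
      (f := fun (x : E) (r : ℝ) => ∫ y in closedBall (0:E) 1, -lap w (x + r • y)) cf2' _ _
  have icb : ∀ {f : E → ℝ}, Continuous f → IntegrableOn f (closedBall (0:E) 1) :=
    fun hf => hf.continuousOn.integrableOn_compact (isCompact_closedBall _ _)
  have hj : ∀ j : Fin N, ∫ x in closedBall (0:E) 1, |pd j w x| ≤ c0⁻¹ * (4 * V + V * C2) * M := by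
    intro j
    have hpc := pd_cont j (hw.of_le (by norm_num : (1:WithTop ℕ∞) ≤ 2))
    rw [mul_assoc, le_inv_mul_iff₀ hc0p, ← integral_const_mul]
    refine (setIntegral_mono (icb (by fun_prop)) (icb (by fun_prop))
      (fun x => ptw hw hpos hlap j x)).trans ?_
    rw [integral_add (icb (by fun_prop)) (icb cf2), integral_const_mul]
    have t1 := T1 hwc (fun x => (hpos x).le) 1 (by simp)
    have t2 := T2 hlc.neg (fun x => neg_nonneg.2 (hlap x))
    have t3 := H2 w hw hpos hlap
    simp only [Pi.neg_apply] at t2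
    have t4 := mul_le_mul_of_nonneg_left hM2 hV
    have t5 := mul_le_mul_of_nonneg_left t3 hV
    have : (4 * V + V * C2) * M = 4 * (V * M) + V * (C2 * M) := by ring
    rw [this]
    have t1' := t1.trans t4
    have t2' := t2.trans t5
    linarith
  have hgc : Continuous fun x => ‖gradient w x‖ := by
    have : (fun x => ‖gradient w x‖) = fun x => ‖fderiv ℝ w x‖ := by
      ext x; exact grad_norm_eq w x
    rw [this]
    exact (hw.continuous_fderiv (by norm_num)).norm
  calc ∫ x in closedBall (0:E) 1, ‖gradient w x‖
      ≤ ∫ x in closedBall (0:E) 1, ∑ j, |pd j w x| := by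
        refine setIntegral_mono (icb hgc) (icb ?_) (fun x => grad_norm_le w x)
        exact continuous_finsetSum _ fun j _ =>
          (pd_cont j (hw.of_le (by norm_num : (1:WithTop ℕ∞) ≤ 2))).abs
    _ = ∑ j, ∫ x in closedBall (0:E) 1, |pd j w x| :=
        integral_finsetSum _ fun j _ => icb
          (pd_cont j (hw.of_le (by norm_num : (1:WithTop ℕ∞) ≤ 2))).abs
    _ ≤ ∑ _j : Fin N, c0⁻¹ * (4 * V + V * C2) * M := Finset.sum_le_sum fun j _ => hj j
    _ = N * (c0⁻¹ * (4 * V + V * C2)) * M := by simp; ring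
    _ ≤ _ := by nlinarith

end HLE

namespace HLE
variable {N : ℕ}
local notation "E" => EuclideanSpace ℝ (Fin N)

lemma pd_scale (i : Fin N) {h : E → ℝ} (hh : Differentiable ℝ h) (R : ℝ) :
    pd i (fun y => h (R • y)) = fun y => R * pd i h (R • y) := by
  ext y
  have := pd_comp i hh 0 R y
  simpa using this

lemma lap_scale {h : E → ℝ} (hh : ContDiff ℝ 2 h) (R : ℝ) (x : E) :
    lap (fun y => h (R • y)) x = R ^ 2 * lap h (R • x) := by
  rw [lap_eq, lap_eq, Finset.mul_sum]
  refine Finset.sum_congr rfl fun i _ => ?_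
  rw [pd_scale i (hh.differentiable (by norm_num))]
  have hd := (pd_C1 i hh).differentiable (by norm_num)
  have h1 : pd i (fun y => R * pd i h (R • y)) x = R * pd i (fun y => pd i h (R • y)) x := by
    conv_lhs => unfold pd
    rw [fderiv_const_mul]
    · rfl
    · exact (hd.comp (differentiable_id.const_smul R)) x
  rw [h1, pd_scale i hd]; ring

lemma grad_scale {h : E → ℝ} (hh : Differentiable ℝ h) {R : ℝ} (hR : 0 < R) (x : E) :
    ‖gradient (fun y => h (R • y)) x‖ = R * ‖gradient h (R • x)‖ := by
  rw [grad_norm_eq, grad_norm_eq]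
  have h1 : HasFDerivAt (fun y : E => R • y) (R • ContinuousLinearMap.id ℝ E) x :=
    (hasFDerivAt_id x).const_smul R
  have h2 : HasFDerivAt (fun y : E => h (R • y)) _ x := (hh (R • x)).hasFDerivAt.comp x h1
  rw [h2.fderiv]
  simp [norm_smul, abs_of_pos hR]

lemma grad_int {h : E → ℝ} (hh : ContDiff ℝ 2 h) {R : ℝ} (hR : 0 < R) :
    ∫ x in ball (0:E) R, ‖gradient h x‖ ≤
      R ^ ((N : ℝ) - 1) * ∫ x in closedBall (0:E) 1, ‖gradient (fun y => h (R • y)) x‖ := by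
  have hgc : Continuous fun x => ‖gradient h x‖ := by
    have : (fun x => ‖gradient h x‖) = fun x => ‖fderiv ℝ h x‖ := by
      ext x; exact grad_norm_eq h x
    rw [this]
    exact (hh.continuous_fderiv (by norm_num)).norm
  simp_rw [grad_scale (hh.differentiable (by norm_num)) hR]
  rw [integral_const_mul]
  rw [Measure.setIntegral_comp_smul_of_pos volume (fun x => ‖gradient h x‖) _ hR,
    _root_.smul_closedBall _ _ zero_le_one, smul_zero, mul_one, Real.norm_eq_abs, abs_of_pos hR,
    finrank_euclideanSpace_fin, smul_eq_mul, ← mul_assoc, ← mul_assoc]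
  have : R ^ ((N : ℝ) - 1) * R * (R ^ N)⁻¹ = 1 := by
    rw [Real.rpow_sub hR, Real.rpow_natCast, Real.rpow_one]
    field_simp
  rw [this, one_mul]
  exact setIntegral_mono_set (hgc.continuousOn.integrableOn_compact (isCompact_closedBall _ _))
      (Filter.Eventually.of_forall fun y => norm_nonneg _)
      (Filter.Eventually.of_forall ball_subset_closedBall)

lemma K (hN : 0 < N) (p a : ℝ) (hp : 0 ≤ p) (ha : 0 ≤ a) : ∃ C > 0, ∀ u v : E → ℝ,
    ContDiff ℝ 2 u → ContDiff ℝ 2 v → (∀ x, 0 < u x) → (∀ x, 0 < v x) → (∀ x, lap v x ≤ 0) →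
    ∀ S > 0, (∀ x, -lap u x = S * (‖x‖ ^ a * v x ^ p)) →
    S * (∫ y in closedBall (0:E) 4, v y) ^ p ≤ C * ∫ y in closedBall (0:E) 4, u y := by
  obtain ⟨c, hc, H1⟩ := L1 (N := N)
  obtain ⟨C, hC, H2⟩ := L2 (N := N)
  set z : E := EuclideanSpace.single (⟨0, hN⟩ : Fin N) (3/4 : ℝ)
  have hz : ‖z‖ = 3/4 := by simp [z]
  set B := closedBall z (1/4)
  set V := volume.real B
  have hV : 0 < V := ENNReal.toReal_pos (measure_closedBall_pos _ _ (by norm_num)).ne'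
    (isCompact_closedBall _ _).measure_lt_top.ne
  have hB : ∀ y ∈ B, 1/2 ≤ ‖y‖ ∧ ‖y‖ ≤ 1 := by
    intro y hy
    rw [mem_closedBall, dist_eq_norm] at hy
    have h1 := norm_sub_norm_le y z
    have h2 := norm_sub_norm_le z y
    rw [norm_sub_rev] at h2
    constructor <;> linarith
  set k := (1/2 : ℝ) ^ a * c ^ p * V
  have hk : 0 < k := by positivity
  refine ⟨C / k, by positivity, fun u v hu hv hup hvp hlv S hS heq => ?_⟩
  set M := ∫ y in closedBall (0:E) 4, v y
  have hM : 0 ≤ M := setIntegral_nonneg isClosed_closedBall.measurableSet fun y _ => (hvp y).le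
  have hlu : ∀ x, 0 ≤ -lap u x := by
    intro x; rw [heq]; have := hvp x; positivity
  have h2 := H2 u hu hup (fun x => by linarith [hlu x])
  have hic : IntegrableOn (fun x => -lap u x) (closedBall (0:E) 2) :=
    (lap_cont hu).neg.continuousOn.integrableOn_compact (isCompact_closedBall _ _)
  have hsub : B ⊆ closedBall (0:E) 2 := fun y hy => by
    rw [mem_closedBall_zero_iff]; linarith [(hB y hy).2]
  have h3 : ∫ y in B, -lap u y ≤ ∫ y in closedBall (0:E) 2, -lap u y :=
    setIntegral_mono_set hic (Filter.Eventually.of_forall hlu) (Filter.Eventually.of_forall hsub)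
  have h4 : S * ((1/2 : ℝ) ^ a * (c * M) ^ p) * V ≤ ∫ y in B, -lap u y := by
    have : ∫ y in B, S * ((1/2 : ℝ) ^ a * (c * M) ^ p) = S * ((1/2 : ℝ) ^ a * (c * M) ^ p) * V := by
      rw [setIntegral_const, smul_eq_mul, mul_comm]
    rw [← this]
    refine setIntegral_mono_on
      (continuous_const.continuousOn.integrableOn_compact (isCompact_closedBall _ _))
      (hic.mono_set hsub) isClosed_closedBall.measurableSet fun y hy => ?_
    rw [heq]
    have := H1 v hv hvp hlv y (by rw [mem_closedBall_zero_iff]; exact (hB y hy).2)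
    have := (hB y hy).1
    have := hvp y
    gcongr
  rw [Real.mul_rpow hc.le hM] at h4
  rw [div_mul_eq_mul_div, le_div_iff₀ hk]
  calc S * M ^ p * k = S * ((1/2 : ℝ) ^ a * (c ^ p * M ^ p)) * V := by simp only [k]; ring
    _ ≤ _ := h4.trans (h3.trans h2)

lemma alg {p q a b C1 C2 : ℝ} (hp : 0 ≤ p) (hq : 0 ≤ q) (hpq : 1 < p * q) (h1 : 0 < C1)
    (h2 : 0 < C2) {R X Y : ℝ} (hR : 0 < R) (hX : 0 ≤ X) (hY : 0 ≤ Y)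
    (e1 : R ^ (a + 2) * X ^ p ≤ C1 * Y) (e2 : R ^ (b + 2) * Y ^ q ≤ C2 * X) :
    X ≤ (C1 ^ q * C2) ^ (1 / (p * q - 1)) * R ^ (-(((a + 2) * q + (b + 2)) / (p * q - 1))) := by
  rcases hX.eq_or_lt with hX0 | hX0
  · rw [← hX0]; positivity
  have ht : 0 < p * q - 1 := by linarith
  have f1 : R ^ ((a + 2) * q) * X ^ (p * q) ≤ C1 ^ q * Y ^ q := by
    have := Real.rpow_le_rpow (by positivity) e1 hq
    rwa [Real.mul_rpow (by positivity) (by positivity), Real.mul_rpow h1.le hY,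
      ← Real.rpow_mul hR.le, ← Real.rpow_mul hX] at this
  have f2 : R ^ ((a + 2) * q + (b + 2)) * X ^ (p * q - 1) ≤ C1 ^ q * C2 := by
    have e : R ^ ((a + 2) * q + (b + 2)) * X ^ (p * q - 1) * X =
        R ^ (b + 2) * (R ^ ((a + 2) * q) * X ^ (p * q)) := by
      rw [Real.rpow_add hR, Real.rpow_sub hX0, Real.rpow_one]; field_simp
    refine le_of_mul_le_mul_right ?_ hX0
    rw [e]
    calc R ^ (b + 2) * (R ^ ((a + 2) * q) * X ^ (p * q)) ≤ R ^ (b + 2) * (C1 ^ q * Y ^ q) := by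
          gcongr
      _ = C1 ^ q * (R ^ (b + 2) * Y ^ q) := by ring
      _ ≤ C1 ^ q * (C2 * X) := by gcongr
      _ = _ := by ring
  have f3 : X ^ (p * q - 1) ≤ C1 ^ q * C2 * R ^ (-((a + 2) * q + (b + 2))) := by
    rw [Real.rpow_neg hR.le, ← div_eq_mul_inv, le_div_iff₀ (by positivity)]
    linarith
  have f4 := Real.rpow_le_rpow (by positivity) f3 (by positivity : 0 ≤ 1 / (p * q - 1))
  rw [← Real.rpow_mul hX, mul_one_div_cancel ht.ne', Real.rpow_one,
    Real.mul_rpow (by positivity) (by positivity), ← Real.rpow_mul hR.le] at f4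
  convert f4 using 3
  ring

end HLE

/-- **`L¹`-estimates on the gradients of solutions of the Hénon–Lane–Emden system.**
If `(u, v)` is a positive solution of `-Δu = |x|^a v^p`, `-Δv = |x|^b u^q` on `ℝ^N` with
`p, q, a, b ≥ 0` and `pq > 1`, then there is a constant `C > 0` independent of `R` such that
for all `R > 1`:
`∫_{B_R} |∇v| ≤ C R^(N - 1 - ((a+2)q + (b+2))/(pq-1))` and
`∫_{B_R} |∇u| ≤ C R^(N - 1 - ((b+2)p + (a+2))/(pq-1))`. -/
theorem henon_lane_emden_gradient_L1_estimates
    (N : ℕ) (p q a b : ℝ) (hp : 0 ≤ p) (hq : 0 ≤ q) (ha : 0 ≤ a) (hb : 0 ≤ b)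
    (hpq : 1 < p * q)
    (u v : EuclideanSpace ℝ (Fin N) → ℝ)
    (hu : ContDiff ℝ 2 u) (hv : ContDiff ℝ 2 v)
    (hupos : ∀ x, 0 < u x) (hvpos : ∀ x, 0 < v x)
    (hequ : ∀ x, -lap u x = ‖x‖ ^ a * v x ^ p)
    (heqv : ∀ x, -lap v x = ‖x‖ ^ b * u x ^ q) :
    ∃ C > 0, ∀ R : ℝ, 1 < R →
      (∫ x in ball (0 : EuclideanSpace ℝ (Fin N)) R, ‖gradient v x‖) ≤
        C * R ^ ((N : ℝ) - 1 - ((a + 2) * q + (b + 2)) / (p * q - 1)) ∧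
      (∫ x in ball (0 : EuclideanSpace ℝ (Fin N)) R, ‖gradient u x‖) ≤
        C * R ^ ((N : ℝ) - 1 - ((b + 2) * p + (a + 2)) / (p * q - 1)) := by
  rcases Nat.eq_zero_or_pos N with hN | hN
  · subst hN
    have hg : ∀ f : EuclideanSpace ℝ (Fin 0) → ℝ, ∀ x, ‖gradient f x‖ = 0 := by
      intro f x; rw [Subsingleton.elim (gradient f x) 0, norm_zero]
    refine ⟨1, one_pos, fun R hR => ?_⟩
    simp only [hg, integral_zero]
    constructor <;> positivity
  obtain ⟨C1, hC1, K1⟩ := HLE.K hN p a hp ha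
  obtain ⟨C2, hC2, K2⟩ := HLE.K hN q b hq hb
  obtain ⟨C3, hC3, K3⟩ := HLE.L3 (N := N)
  set D1 := (C1 ^ q * C2) ^ (1 / (p * q - 1)) with hD1
  set D2 := (C2 ^ p * C1) ^ (1 / (q * p - 1)) with hD2
  have hD1p : 0 < D1 := by positivity
  have hD2p : 0 < D2 := by positivity
  refine ⟨C3 * (D1 + D2), by positivity, fun R hR => ?_⟩
  have hR0 : 0 < R := by linarith
  set uR : EuclideanSpace ℝ (Fin N) → ℝ := fun y => u (R • y) with huR
  set vR : EuclideanSpace ℝ (Fin N) → ℝ := fun y => v (R • y) with hvR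
  have cu : ContDiff ℝ 2 uR := hu.comp (by fun_prop)
  have cv : ContDiff ℝ 2 vR := hv.comp (by fun_prop)
  have pu : ∀ x, 0 < uR x := fun x => hupos _
  have pv : ∀ x, 0 < vR x := fun x => hvpos _
  have sc : ∀ (c : ℝ) (x : EuclideanSpace ℝ (Fin N)) (t : ℝ), R ^ 2 * (‖R • x‖ ^ c * t) =
      R ^ (c + 2) * (‖x‖ ^ c * t) := by
    intro c x t
    rw [norm_smul, Real.norm_eq_abs, abs_of_pos hR0, Real.mul_rpow hR0.le (norm_nonneg _),
      Real.rpow_add hR0, Real.rpow_two]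
    ring
  have eu : ∀ x, -lap uR x = R ^ (a + 2) * (‖x‖ ^ a * vR x ^ p) := by
    intro x
    rw [HLE.lap_scale hu, ← mul_neg, hequ, sc]
  have ev : ∀ x, -lap vR x = R ^ (b + 2) * (‖x‖ ^ b * uR x ^ q) := by
    intro x
    rw [HLE.lap_scale hv, ← mul_neg, heqv, sc]
  have lu : ∀ x, lap uR x ≤ 0 := fun x => by
    have := eu x; have := pv x
    have : 0 ≤ -lap uR x := by rw [eu x]; positivity
    linarith
  have lv : ∀ x, lap vR x ≤ 0 := fun x => by
    have := pu x
    have : 0 ≤ -lap vR x := by rw [ev x]; positivity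
    linarith
  have e1 := K1 uR vR cu cv pu pv lv (R ^ (a + 2)) (by positivity) eu
  have e2 := K2 vR uR cv cu pv pu lu (R ^ (b + 2)) (by positivity) ev
  have Mu : 0 ≤ ∫ y in closedBall (0 : EuclideanSpace ℝ (Fin N)) 4, uR y :=
    setIntegral_nonneg isClosed_closedBall.measurableSet fun y _ => (pu y).le
  have Mv : 0 ≤ ∫ y in closedBall (0 : EuclideanSpace ℝ (Fin N)) 4, vR y :=
    setIntegral_nonneg isClosed_closedBall.measurableSet fun y _ => (pv y).le
  have bv := HLE.alg hp hq hpq hC1 hC2 hR0 Mv Mu e1 e2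
  have bu := HLE.alg hq hp (by rwa [mul_comm]) hC2 hC1 hR0 Mu Mv e2 e1
  rw [← hD1] at bv
  rw [← hD2, mul_comm q p] at bu
  have gv := K3 vR cv pv lv
  have gu := K3 uR cu pu lu
  have fin : ∀ (f : EuclideanSpace ℝ (Fin N) → ℝ) (G M D s : ℝ), ContDiff ℝ 2 f →
      (∫ x in closedBall (0 : EuclideanSpace ℝ (Fin N)) 1, ‖gradient (fun y => f (R • y)) x‖)
        ≤ C3 * M → M ≤ D * R ^ (-s) → D ≤ D1 + D2 →
      (∫ x in ball (0 : EuclideanSpace ℝ (Fin N)) R, ‖gradient f x‖) ≤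
        C3 * (D1 + D2) * R ^ ((N : ℝ) - 1 - s) := by
    intro f G M D s hf h1 h2 h3
    refine (HLE.grad_int hf hR0).trans ?_
    rw [sub_eq_add_neg ((N : ℝ) - 1) s, Real.rpow_add hR0]
    calc _ ≤ R ^ ((N : ℝ) - 1) * (C3 * ((D1 + D2) * R ^ (-s))) := by
          refine mul_le_mul_of_nonneg_left (h1.trans ?_) (by positivity)
          refine mul_le_mul_of_nonneg_left (h2.trans ?_) hC3.le
          gcongr
      _ = _ := by ring
  exact ⟨fin v 0 _ _ _ hv gv bv (by linarith), fin u 0 _ _ _ hu gu bu (by linarith)⟩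
end

section
/- Let a ≥ 0, N ≥ 5 and 1 < p < (N+4+2a)/(N−4). Let u be a positive C⁴ solution of Δ²u = |x|^a u^p on ℝ^N that is stable outside a compact set and satisfies Δu ∈ L²(ℝ^N) and |x|^a u^{p+1} ∈ L¹(ℝ^N). Then the energy identity ∫_{ℝ^N} |Δu|² = ∫_{ℝ^N} |x|^a u^{p+1} holds. -/
open MeasureTheory Real Metric

namespace Henon
variable {N : ℕ}

noncomputable def pd (i : Fin N) (f : EuclideanSpace ℝ (Fin N) → ℝ)
    (x : EuclideanSpace ℝ (Fin N)) : ℝ := fderiv ℝ f x (EuclideanSpace.single i 1)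

lemma lap_eq (f : EuclideanSpace ℝ (Fin N) → ℝ) (x) : lap f x = ∑ i, pd i (pd i f) x := rfl

lemma pd_contDiff (i : Fin N) {f : EuclideanSpace ℝ (Fin N) → ℝ} {n m : WithTop ℕ∞}
    (hf : ContDiff ℝ n f) (h : m + 1 ≤ n) : ContDiff ℝ m (pd i f) :=
  (hf.fderiv_right h).clm_apply contDiff_const

lemma lap_contDiff {f : EuclideanSpace ℝ (Fin N) → ℝ} {n m k : WithTop ℕ∞}
    (hf : ContDiff ℝ n f) (h : m + 1 ≤ n) (h' : k + 1 ≤ m) : ContDiff ℝ k (lap f) := by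
  have : lap f = fun x => ∑ i, pd i (pd i f) x := rfl
  rw [this]
  exact ContDiff.sum fun i _ => pd_contDiff i (pd_contDiff i hf h) h'

lemma pd_mul (i : Fin N) {f g : EuclideanSpace ℝ (Fin N) → ℝ} (hf : Differentiable ℝ f)
    (hg : Differentiable ℝ g) (x) :
    pd i (fun y => f y * g y) x = f x * pd i g x + g x * pd i f x := by
  unfold pd
  rw [fderiv_fun_mul (hf x) (hg x)]
  simp

lemma pd_add (i : Fin N) {f g : EuclideanSpace ℝ (Fin N) → ℝ} (hf : Differentiable ℝ f)
    (hg : Differentiable ℝ g) (x) :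
    pd i (fun y => f y + g y) x = pd i f x + pd i g x := by
  unfold pd
  rw [fderiv_fun_add (hf x) (hg x)]
  simp

lemma pd_diff (i : Fin N) {f : EuclideanSpace ℝ (Fin N) → ℝ} (hf : ContDiff ℝ 2 f) :
    Differentiable ℝ (pd i f) :=
  (pd_contDiff (m := 1) i hf (by norm_num)).differentiable (by norm_num)

lemma lap_mul {f g : EuclideanSpace ℝ (Fin N) → ℝ} (hf : ContDiff ℝ 2 f)
    (hg : ContDiff ℝ 2 g) (x) :
    lap (fun y => f y * g y) x
      = f x * lap g x + 2 * ∑ i, pd i f x * pd i g x + g x * lap f x := by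
  have hf1 := hf.differentiable (by norm_num)
  have hg1 := hg.differentiable (by norm_num)
  simp only [lap_eq, Finset.mul_sum, ← Finset.sum_add_distrib]
  refine Finset.sum_congr rfl fun i _ => ?_
  have : pd i (fun y => f y * g y) = fun y => f y * pd i g y + g y * pd i f y :=
    funext fun y => pd_mul i hf1 hg1 y
  rw [this, pd_add i (f := fun y => f y * pd i g y) (g := fun y => g y * pd i f y)
      (hf1.mul (pd_diff i hg)) (hg1.mul (pd_diff i hf)),
    pd_mul i hf1 (pd_diff i hg), pd_mul i hg1 (pd_diff i hf)]
  ring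

lemma pd_cs (i : Fin N) {f : EuclideanSpace ℝ (Fin N) → ℝ} (hf : HasCompactSupport f) :
    HasCompactSupport (pd i f) := hf.fderiv_apply ℝ _

lemma lap_cs {f : EuclideanSpace ℝ (Fin N) → ℝ} (hf : HasCompactSupport f) :
    HasCompactSupport (lap f) := by
  refine HasCompactSupport.intro (K := tsupport f) hf fun x hx => ?_
  rw [lap_eq]
  refine Finset.sum_eq_zero fun i _ => ?_
  refine image_eq_zero_of_notMem_tsupport fun h => hx ?_
  exact tsupport_fderiv_apply_subset ℝ _ (tsupport_fderiv_apply_subset ℝ _ h)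

lemma ibp (i : Fin N) {f g : EuclideanSpace ℝ (Fin N) → ℝ} (hf : ContDiff ℝ 1 f)
    (hg : ContDiff ℝ 1 g) (hc : HasCompactSupport g) :
    ∫ x, f x * pd i g x = - ∫ x, pd i f x * g x := by
  have hf' := (pd_contDiff (m := 0) i hf (by norm_num)).continuous
  have hg' := (pd_contDiff (m := 0) i hg (by norm_num)).continuous
  refine integral_mul_fderiv_eq_neg_fderiv_mul_of_integrable ?_ ?_ ?_
    (fun x _ => hf.differentiable (by norm_num) x) (fun x _ => hg.differentiable (by norm_num) x)
  · exact (hf'.mul hg.continuous).integrable_of_hasCompactSupport hc.mul_left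
  · exact (hf.continuous.mul hg').integrable_of_hasCompactSupport (pd_cs i hc).mul_left
  · exact (hf.continuous.mul hg.continuous).integrable_of_hasCompactSupport hc.mul_left

lemma green {f g : EuclideanSpace ℝ (Fin N) → ℝ} (hf : ContDiff ℝ 2 f)
    (hg : ContDiff ℝ 2 g) (hc : HasCompactSupport g) :
    ∫ x, f x * lap g x = ∫ x, lap f x * g x := by
  simp only [lap_eq, Finset.mul_sum, Finset.sum_mul]
  have h1 : ∀ i : Fin N, ContDiff ℝ 1 (pd i f) := fun i => pd_contDiff i hf (by norm_num)
  have h2 : ∀ i : Fin N, ContDiff ℝ 1 (pd i g) := fun i => pd_contDiff i hg (by norm_num)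
  have h3 : ∀ i : Fin N, Continuous (pd i (pd i f)) := fun i =>
    (pd_contDiff (m := 0) i (h1 i) (by norm_num)).continuous
  have h4 : ∀ i : Fin N, Continuous (pd i (pd i g)) := fun i =>
    (pd_contDiff (m := 0) i (h2 i) (by norm_num)).continuous
  rw [integral_finsetSum, integral_finsetSum]
  · refine Finset.sum_congr rfl fun i _ => ?_
    rw [ibp i (hf.of_le (by norm_num)) (h2 i) (pd_cs i hc), ibp i (h1 i)
      (hg.of_le (by norm_num)) hc, neg_neg]
  · intro i _
    exact ((h3 i).mul hg.continuous).integrable_of_hasCompactSupport hc.mul_left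
  · intro i _
    exact (hf.continuous.mul (h4 i)).integrable_of_hasCompactSupport
      (pd_cs i (pd_cs i hc)).mul_left

lemma pd_scale (i : Fin N) {f : EuclideanSpace ℝ (Fin N) → ℝ} (c : ℝ) (x) :
    pd i (fun y => f (c • y)) x = c * pd i f (c • x) := by
  unfold pd
  rw [fderiv_comp_smul]
  simp

lemma lap_const_mul {f : EuclideanSpace ℝ (Fin N) → ℝ} (hf : ContDiff ℝ 2 f) (c : ℝ) (x) :
    lap (fun y => c * f y) x = c * lap f x := by
  have := lap_mul (f := fun _ : EuclideanSpace ℝ (Fin N) => c) (g := f) contDiff_const hf x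
  rw [this]
  simp [lap, pd]

lemma lap_scale {f : EuclideanSpace ℝ (Fin N) → ℝ} (hf : ContDiff ℝ 2 f) (c : ℝ) (x) :
    lap (fun y => f (c • y)) x = c ^ 2 * lap f (c • x) := by
  simp only [lap_eq, Finset.mul_sum]
  refine Finset.sum_congr rfl fun i _ => ?_
  have : pd i (fun y => f (c • y)) = fun y => (fun _ => c) y * (fun y => pd i f (c • y)) y :=
    funext fun y => pd_scale i c y
  rw [this, pd_mul i (g := fun y => pd i f (c • y)) (differentiable_const c)
    ((pd_diff i hf).comp (differentiable_id.const_smul c)), pd_scale]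
  simp [pd]
  ring

/-- annulus -/
def ann (N : ℕ) (R : ℝ) : Set (EuclideanSpace ℝ (Fin N)) := {x | R ≤ ‖x‖ ∧ ‖x‖ ≤ 2 * R}

lemma eta_contDiff {ψ : EuclideanSpace ℝ (Fin N) → ℝ} {n m : WithTop ℕ∞} (h : ContDiff ℝ n ψ)
   (hm : m + 1 ≤ n) : ContDiff ℝ m (fun y => ∑ i, pd i ψ y ^ 2) :=
  ContDiff.sum fun i _ => (pd_contDiff i h hm).pow 2

lemma pd_zero_of (i : Fin N) {f : EuclideanSpace ℝ (Fin N) → ℝ} {U : Set (EuclideanSpace ℝ (Fin N))}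
    (hU : IsOpen U) {c : ℝ} (h : ∀ x ∈ U, f x = c) : ∀ x ∈ U, pd i f x = 0 := by
  intro x hx
  have : f =ᶠ[nhds x] fun _ => c := by
    filter_upwards [hU.mem_nhds hx] with y hy using h y hy
  unfold pd
  rw [this.fderiv_eq]
  simp

lemma lap_zero_of {f : EuclideanSpace ℝ (Fin N) → ℝ} {U : Set (EuclideanSpace ℝ (Fin N))}
    (hU : IsOpen U) {c : ℝ} (h : ∀ x ∈ U, f x = c) : ∀ x ∈ U, lap f x = 0 := fun x hx =>
  Finset.sum_eq_zero fun i _ => pd_zero_of i hU (pd_zero_of i hU h) x hx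

lemma cutoff (N : ℕ) : ∃ C : ℝ, 0 ≤ C ∧ ∀ R : ℝ, 1 ≤ R → ∃ ψ : EuclideanSpace ℝ (Fin N) → ℝ,
    ContDiff ℝ 4 ψ ∧ HasCompactSupport ψ ∧ (∀ x, 0 ≤ ψ x) ∧ (∀ x, ψ x ≤ 1) ∧
    (∀ x, ‖x‖ < R → ψ x = 1) ∧
    (∀ x, |lap ψ x| ≤ (ann N R).indicator (fun _ => C / R ^ 2) x) ∧
    (∀ x, ∑ i, pd i ψ x ^ 2 ≤ (ann N R).indicator (fun _ => C / R ^ 2) x) ∧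
    (∀ x, |lap (fun y => ∑ i, pd i ψ y ^ 2) x| ≤ (ann N R).indicator (fun _ => C / R ^ 4) x) := by
  let b : ContDiffBump (0 : EuclideanSpace ℝ (Fin N)) := ⟨1, 2, by norm_num, by norm_num⟩
  have hb : ContDiff ℝ 4 b := b.contDiff
  have hbc : HasCompactSupport b := b.hasCompactSupport
  have hone : ∀ x ∈ ball (0 : EuclideanSpace ℝ (Fin N)) 1, b x = 1 := fun x hx =>
    b.one_of_mem_closedBall (ball_subset_closedBall hx)
  have hzero : ∀ x ∈ (closedBall (0 : EuclideanSpace ℝ (Fin N)) 2)ᶜ, b x = 0 := fun x hx =>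
    b.zero_of_le_dist (by simpa using (not_le.1 (by simpa using hx) : (2:ℝ) < ‖x‖).le)
  have ho : IsOpen (closedBall (0 : EuclideanSpace ℝ (Fin N)) 2)ᶜ := isClosed_closedBall.isOpen_compl
  set η : EuclideanSpace ℝ (Fin N) → ℝ := fun y => ∑ i, pd i b y ^ 2 with hη
  have hηc : ContDiff ℝ 2 η := eta_contDiff hb (by norm_num)
  have hη1 : ∀ x ∈ ball (0 : EuclideanSpace ℝ (Fin N)) 1, η x = 0 := fun x hx =>
    Finset.sum_eq_zero fun i _ => by rw [pd_zero_of i isOpen_ball hone x hx]; simp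
  have hη2 : ∀ x ∈ (closedBall (0 : EuclideanSpace ℝ (Fin N)) 2)ᶜ, η x = 0 := fun x hx =>
    Finset.sum_eq_zero fun i _ => by rw [pd_zero_of i ho hzero x hx]; simp
  have bound : ∀ f : EuclideanSpace ℝ (Fin N) → ℝ, Continuous f →
      (∀ x ∈ ball (0 : EuclideanSpace ℝ (Fin N)) 1, f x = 0) →
      (∀ x ∈ (closedBall (0 : EuclideanSpace ℝ (Fin N)) 2)ᶜ, f x = 0) →
      ∃ C, 0 ≤ C ∧ ∀ x, |f x| ≤ (ann N 1).indicator (fun _ => C) x := by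
    intro f hf h1 h2
    obtain ⟨C, hC⟩ := (isCompact_closedBall (0 : EuclideanSpace ℝ (Fin N)) 2).exists_bound_of_continuousOn
      hf.continuousOn
    refine ⟨|C|, abs_nonneg _, fun x => ?_⟩
    by_cases hx : x ∈ ann N 1
    · rw [Set.indicator_of_mem hx]
      exact (hC x (by simpa using (by simpa using hx.2 : ‖x‖ ≤ 2))).trans (le_abs_self C)
    · rw [Set.indicator_of_notMem hx]
      by_cases h : ‖x‖ < 1
      · rw [h1 x (by simpa using h)]; simp
      · rw [h2 x]; · simp
        simp only [Set.mem_compl_iff, mem_closedBall, dist_zero_right, not_le]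
        by_contra h'
        exact hx ⟨by linarith, by linarith⟩
  obtain ⟨C1, hC1, H1⟩ := bound (lap b) (lap_contDiff (m := 1) (k := 0) (hb.of_le (by norm_num : (2 : WithTop ℕ∞) ≤ 4))
    (by norm_num) (by norm_num)).continuous (lap_zero_of isOpen_ball hone) (lap_zero_of ho hzero)
  obtain ⟨C2, hC2, H2⟩ := bound η hηc.continuous hη1 hη2
  obtain ⟨C3, hC3, H3⟩ := bound (lap η) (lap_contDiff (m := 1) (k := 0) hηc
    (by norm_num) (by norm_num)).continuous (lap_zero_of isOpen_ball hη1) (lap_zero_of ho hη2)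
  refine ⟨C1 + C2 + C3, by positivity, fun R hR => ?_⟩
  have hR0 : 0 < R := by linarith
  have key : ∀ (g : EuclideanSpace ℝ (Fin N) → ℝ) (D : ℝ) (k : ℕ), D ≤ C1 + C2 + C3 →
      (∀ x, |g x| ≤ (ann N 1).indicator (fun _ => D) x) →
      ∀ x, R⁻¹ ^ k * |g (R⁻¹ • x)| ≤ (ann N R).indicator (fun _ => (C1 + C2 + C3) / R ^ k) x := by
    intro g D k hD hg x
    have h := hg (R⁻¹ • x)
    have hnorm : ‖R⁻¹ • x‖ = ‖x‖ / R := by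
      rw [norm_smul, Real.norm_of_nonneg (by positivity)]; field_simp
    have hiff : R⁻¹ • x ∈ ann N 1 ↔ x ∈ ann N R := by
      simp only [ann, Set.mem_ofPred_eq, hnorm, le_div_iff₀ hR0, div_le_iff₀ hR0]; simp
    by_cases hx : x ∈ ann N R
    · rw [Set.indicator_of_mem hx]
      rw [Set.indicator_of_mem (hiff.2 hx)] at h
      rw [div_eq_inv_mul, inv_pow]
      gcongr
      linarith
    · rw [Set.indicator_of_notMem hx]
      rw [Set.indicator_of_notMem (mt hiff.1 hx)] at h
      have : |g (R⁻¹ • x)| = 0 := le_antisymm h (abs_nonneg _)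
      rw [this]; simp
  have hsm : ContDiff ℝ 4 (fun y : EuclideanSpace ℝ (Fin N) => R⁻¹ • y) := contDiff_id.const_smul _
  have hηs : (fun y => ∑ i, pd i (fun y => b (R⁻¹ • y)) y ^ 2)
      = fun y => R⁻¹ ^ 2 * η (R⁻¹ • y) := by
    funext y
    simp only [hη, Finset.mul_sum, pd_scale, mul_pow]
  refine ⟨fun y => b (R⁻¹ • y), hb.comp hsm, hbc.comp_smul (by positivity), fun x => b.nonneg,
    fun x => b.le_one, ?_, ?_, ?_, ?_⟩
  · intro x hx
    refine hone _ ?_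
    rw [mem_ball_zero_iff, norm_smul, Real.norm_of_nonneg (by positivity), inv_mul_lt_iff₀ hR0]
    simpa using hx
  · intro x
    rw [lap_scale (hb.of_le (by norm_num)), abs_mul, abs_of_nonneg (by positivity)]
    exact key _ C1 2 (by linarith) H1 x
  · intro x
    have := key _ C2 2 (by linarith) H2 x
    rw [congrFun hηs x]
    exact le_trans (by gcongr; exact le_abs_self _) this
  · intro x
    rw [hηs, lap_const_mul (f := fun y => η (R⁻¹ • y)) (hηc.comp (hsm.of_le (by norm_num))), lap_scale hηc, ← mul_assoc,
      ← pow_add, abs_mul, abs_of_nonneg (by positivity)]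
    exact key _ C3 4 (by linarith) H3 x

lemma pointwise {a p R r t : ℝ} (hN : 5 ≤ N) (ha : 0 ≤ a) (hp : 1 < p)
    (hsub : p < ((N : ℝ) + 4 + 2 * a) / ((N : ℝ) - 4)) (hR : 1 ≤ R) (hr : R ≤ r) (ht : 0 < t) :
    t ^ 2 ≤ R ^ 4 * (r ^ a * t ^ (p + 1)) + R ^ 4 / R ^ N := by
  have hR0 : 0 < R := by linarith
  have hr0 : 0 < r := by linarith
  have hN' : (5 : ℝ) ≤ N := by exact_mod_cast hN
  rw [lt_div_iff₀ (by linarith)] at hsub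
  by_cases h : R ^ (-4 - a) ≤ t ^ (p - 1)
  · have h1 : t ^ 2 ≤ R ^ 4 * (r ^ a * t ^ (p + 1)) := by
      have e1 : t ^ (p + 1) = t ^ 2 * t ^ (p - 1) := by
        rw [← Real.rpow_natCast t 2, ← Real.rpow_add ht]; congr 1; push_cast; ring
      have e2 : R ^ 4 * (R ^ a * R ^ (-4 - a)) = 1 := by
        rw [← Real.rpow_natCast R 4, ← Real.rpow_add hR0, ← Real.rpow_add hR0]
        norm_num
      calc t ^ 2 = R ^ 4 * (R ^ a * R ^ (-4 - a)) * t ^ 2 := by rw [e2, one_mul]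
        _ = R ^ 4 * (R ^ a * (t ^ 2 * R ^ (-4 - a))) := by ring
        _ ≤ R ^ 4 * (r ^ a * t ^ (p + 1)) := by
          rw [e1]; gcongr
    have : 0 ≤ R ^ 4 / R ^ N := by positivity
    linarith
  · push Not at h
    have h1 : t ≤ R ^ ((-4 - a) / (p - 1)) := by
      have : t = (t ^ (p - 1)) ^ (1 / (p - 1)) := by
        rw [← Real.rpow_mul ht.le, mul_one_div_cancel (by linarith), Real.rpow_one]
      rw [this, div_eq_mul_one_div (-4 - a), Real.rpow_mul hR0.le]
      exact Real.rpow_le_rpow (by positivity) h.le (by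
        apply div_nonneg <;> linarith)
    have h2 : t ^ 2 ≤ R ^ 4 / R ^ N := by
      calc t ^ 2 ≤ (R ^ ((-4 - a) / (p - 1))) ^ 2 := by gcongr
        _ = R ^ (((-4 - a) / (p - 1)) * 2) := by
          rw [← Real.rpow_natCast, ← Real.rpow_mul hR0.le]; norm_num
        _ ≤ R ^ ((4 : ℝ) - N) := by
          apply Real.rpow_le_rpow_of_exponent_le hR
          rw [div_mul_eq_mul_div, div_le_iff₀ (by linarith)]
          nlinarith
        _ = R ^ 4 / R ^ N := by
          rw [Real.rpow_sub hR0, Real.rpow_natCast]; norm_cast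
    have : 0 ≤ R ^ 4 * (r ^ a * t ^ (p + 1)) := by positivity
    linarith

lemma ann_closed (R : ℝ) : IsClosed (ann N R) :=
  (isClosed_le continuous_const continuous_norm).inter
    (isClosed_le continuous_norm continuous_const)

lemma ann_sub (R : ℝ) : ann N R ⊆ closedBall 0 (2 * R) := fun x hx => by simpa using hx.2

lemma ann_compact (R : ℝ) : IsCompact (ann N R) :=
  (isCompact_closedBall _ _).of_isClosed_subset (ann_closed R) (ann_sub R)

lemma ann_bound {a p : ℝ} (hN : 5 ≤ N) (ha : 0 ≤ a) (hp : 1 < p)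
    (hsub : p < ((N : ℝ) + 4 + 2 * a) / ((N : ℝ) - 4))
    {u : EuclideanSpace ℝ (Fin N) → ℝ} (hu : Continuous u) (hupos : ∀ x, 0 < u x)
    (hpot : Integrable (fun x => ‖x‖ ^ a * u x ^ (p + 1))
      (volume : Measure (EuclideanSpace ℝ (Fin N)))) :
    ∃ M : ℝ, 0 ≤ M ∧ ∀ R : ℝ, 1 ≤ R → ∫ x in ann N R, u x ^ 2 ≤ M * R ^ 4 := by
  set P := ∫ x, ‖x‖ ^ a * u x ^ (p + 1)
  have hnn : ∀ x, 0 ≤ ‖x‖ ^ a * u x ^ (p + 1) := fun x =>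
    mul_nonneg (by positivity) (Real.rpow_nonneg (hupos x).le _)
  have hP : 0 ≤ P := integral_nonneg hnn
  set w := (volume : Measure (EuclideanSpace ℝ (Fin N))).real (ball 0 1)
  have hw : 0 ≤ w := measureReal_nonneg
  refine ⟨P + 2 ^ N * w, by positivity, fun R hR => ?_⟩
  have hR0 : 0 < R := by linarith
  have hfin : (volume : Measure (EuclideanSpace ℝ (Fin N))) (ann N R) ≠ ⊤ :=
    (ann_compact R).measure_lt_top.ne
  have hi : IntegrableOn (fun _ : EuclideanSpace ℝ (Fin N) => R ^ 4 / R ^ N) (ann N R) :=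
    integrableOn_const hfin
  have hvol : (volume : Measure (EuclideanSpace ℝ (Fin N))).real (ann N R) ≤ (2 * R) ^ N * w := by
    have h1 := measureReal_mono (μ := (volume : Measure (EuclideanSpace ℝ (Fin N)))) (ann_sub R)
      (isCompact_closedBall _ _).measure_lt_top.ne
    rw [Measure.addHaar_real_closedBall _ _ (by positivity)] at h1
    simpa using h1
  calc ∫ x in ann N R, u x ^ 2
      ≤ ∫ x in ann N R, (R ^ 4 * (‖x‖ ^ a * u x ^ (p + 1)) + R ^ 4 / R ^ N) := by
        refine setIntegral_mono_on ?_ ?_ (ann_closed R).measurableSet ?_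
        · exact (hu.pow 2).continuousOn.integrableOn_compact (ann_compact R)
        · exact (hpot.const_mul _).integrableOn.add hi
        · intro x hx
          exact pointwise hN ha hp hsub hR hx.1 (hupos x)
    _ = R ^ 4 * (∫ x in ann N R, ‖x‖ ^ a * u x ^ (p + 1))
        + (volume : Measure (EuclideanSpace ℝ (Fin N))).real (ann N R) * (R ^ 4 / R ^ N) := by
        rw [integral_add (hpot.const_mul _).integrableOn hi, integral_const_mul, setIntegral_const,
          smul_eq_mul]
    _ ≤ R ^ 4 * P + ((2 * R) ^ N * w) * (R ^ 4 / R ^ N) := by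
        gcongr
        exact setIntegral_le_integral hpot (Filter.Eventually.of_forall hnn)
    _ = (P + 2 ^ N * w) * R ^ 4 := by
        rw [mul_pow]; field_simp

/-- the commutator term -/
noncomputable def FF (u ψ : EuclideanSpace ℝ (Fin N) → ℝ) (x : EuclideanSpace ℝ (Fin N)) : ℝ :=
  2 * ∑ i, pd i u x * pd i ψ x + u x * lap ψ x

lemma FF_cont {u ψ : EuclideanSpace ℝ (Fin N) → ℝ} (hu : ContDiff ℝ 4 u) (hψ : ContDiff ℝ 4 ψ) :
    Continuous (FF u ψ) := by
  have h1 : ∀ i : Fin N, Continuous (pd i u) := fun i =>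
    (pd_contDiff (m := 3) i hu (by norm_num)).continuous
  have h2 : ∀ i : Fin N, Continuous (pd i ψ) := fun i =>
    (pd_contDiff (m := 3) i hψ (by norm_num)).continuous
  have h3 : Continuous (lap ψ) :=
    (lap_contDiff (m := 3) (k := 2) hψ (by norm_num) (by norm_num)).continuous
  have h4 := hu.continuous
  unfold FF
  fun_prop

lemma FF_cs {u ψ : EuclideanSpace ℝ (Fin N) → ℝ} (hψ : HasCompactSupport ψ) :
    HasCompactSupport (FF u ψ) := by
  refine HasCompactSupport.intro (K := tsupport ψ) hψ fun x hx => ?_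
  have ho : IsOpen (tsupport ψ)ᶜ := (isClosed_tsupport ψ).isOpen_compl
  have h0 : ∀ y ∈ (tsupport ψ)ᶜ, ψ y = 0 := fun y hy => image_eq_zero_of_notMem_tsupport hy
  simp [FF, pd_zero_of _ ho h0 x hx, lap_zero_of ho h0 x hx]

lemma FF_zero {u ψ : EuclideanSpace ℝ (Fin N) → ℝ} {R : ℝ} (h1 : ∀ x, ‖x‖ < R → ψ x = 1) :
    ∀ x, ‖x‖ < R → FF u ψ x = 0 := by
  intro x hx
  have h0 : ∀ y ∈ ball (0 : EuclideanSpace ℝ (Fin N)) R, ψ y = 1 := fun y hy =>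
    h1 y (by simpa using hy)
  have hx' : x ∈ ball (0 : EuclideanSpace ℝ (Fin N)) R := by simpa using hx
  simp [FF, pd_zero_of _ isOpen_ball h0 x hx', lap_zero_of isOpen_ball h0 x hx']

lemma FF_bound {u ψ : EuclideanSpace ℝ (Fin N) → ℝ} {R C M : ℝ} (hu : ContDiff ℝ 4 u)
    (hlap : Integrable (fun x => (lap u x) ^ 2)
      (volume : Measure (EuclideanSpace ℝ (Fin N))))
    (hC : 0 ≤ C) (hR : 1 ≤ R)
    (hM : ∫ x in ann N R, u x ^ 2 ≤ M * R ^ 4)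
    (hψ : ContDiff ℝ 4 ψ) (hc : HasCompactSupport ψ)
    (b1 : ∀ x, |lap ψ x| ≤ (ann N R).indicator (fun _ => C / R ^ 2) x)
    (b2 : ∀ x, ∑ i, pd i ψ x ^ 2 ≤ (ann N R).indicator (fun _ => C / R ^ 2) x)
    (b3 : ∀ x, |lap (fun y => ∑ i, pd i ψ y ^ 2) x| ≤
      (ann N R).indicator (fun _ => C / R ^ 4) x) :
    ∫ x, FF u ψ x ^ 2 ≤ (12 * C + 2 * C ^ 2) * M + 8 * C * ∫ x, lap u x ^ 2 := by
  have hR0 : 0 < R := by linarith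
  set η : EuclideanSpace ℝ (Fin N) → ℝ := fun y => ∑ i, pd i ψ y ^ 2 with hη
  have hηC : ContDiff ℝ 2 η := eta_contDiff hψ (by norm_num)
  have hη0 : ∀ x, 0 ≤ η x := fun x => Finset.sum_nonneg fun i _ => sq_nonneg _
  have ho : IsOpen (tsupport ψ)ᶜ := (isClosed_tsupport ψ).isOpen_compl
  have h0 : ∀ y ∈ (tsupport ψ)ᶜ, ψ y = 0 := fun y hy => image_eq_zero_of_notMem_tsupport hy
  have hηc : HasCompactSupport η := by
    refine HasCompactSupport.intro (K := tsupport ψ) hc fun x hx => ?_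
    simp [hη, pd_zero_of _ ho h0 x hx]
  have cu := hu.continuous
  have cpu : ∀ i : Fin N, Continuous (pd i u) := fun i =>
    (pd_contDiff (m := 3) i hu (by norm_num)).continuous
  have clu : Continuous (lap u) :=
    (lap_contDiff (m := 3) (k := 2) hu (by norm_num) (by norm_num)).continuous
  have clη : Continuous (lap η) :=
    (lap_contDiff (m := 1) (k := 0) hηC (by norm_num) (by norm_num)).continuous
  have cη := hηC.continuous
  have hu2 : ContDiff ℝ 2 u := hu.of_le (by norm_num)
  set G : EuclideanSpace ℝ (Fin N) → ℝ := fun x => ∑ i, pd i u x ^ 2 with hG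
  have cG : Continuous G := by fun_prop
  -- the dominating functions
  set U : EuclideanSpace ℝ (Fin N) → ℝ := (ann N R).indicator fun x => u x ^ 2 with hU
  have iU : Integrable U := (integrable_indicator_iff (ann_closed R).measurableSet).2
    ((cu.pow 2).continuousOn.integrableOn_compact (ann_compact R))
  have hUM : ∫ x, U x ≤ M * R ^ 4 := by
    rw [hU, integral_indicator (ann_closed R).measurableSet]; exact hM
  have iGη : Integrable (fun x => G x * η x) :=
    (cG.mul cη).integrable_of_hasCompactSupport hηc.mul_left
  -- integration by parts
  have hg := green (f := fun y => u y * u y) (g := η) (hu2.mul hu2) hηC hηc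
  have iA : Integrable (fun x => u x * u x * lap η x) :=
    ((cu.mul cu).mul clη).integrable_of_hasCompactSupport (lap_cs hηc).mul_left
  have iB : Integrable (fun x => u x * lap u x * η x) :=
    ((cu.mul clu).mul cη).integrable_of_hasCompactSupport hηc.mul_left
  have e1 : ∫ x, G x * η x = ∫ x, ((1 / 2) * (u x * u x * lap η x) - u x * lap u x * η x) := by
    rw [integral_sub (iA.const_mul _) iB, integral_const_mul, hg]
    have : (fun x => lap (fun y => u y * u y) x * η x)
        = fun x => 2 * (u x * lap u x * η x) + 2 * (G x * η x) := by
      funext x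
      rw [lap_mul hu2 hu2]
      simp only [hG, pow_two]
      ring
    rw [this, integral_add (iB.const_mul _) (iGη.const_mul _), integral_const_mul,
      integral_const_mul]
    ring
  have e2 : ∫ x, G x * η x ≤ ∫ x, ((3 / 2 * C / R ^ 4) * U x + C * lap u x ^ 2) := by
    rw [e1]
    refine integral_mono ((iA.const_mul _).sub iB) ((iU.const_mul _).add (hlap.const_mul _)) ?_
    intro x
    have h1 := b2 x
    have h2 := b3 x
    show (1 / 2) * (u x * u x * lap η x) - u x * lap u x * η x
      ≤ (3 / 2 * C / R ^ 4) * U x + C * lap u x ^ 2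
    by_cases hx : x ∈ ann N R
    · rw [Set.indicator_of_mem hx] at h1 h2
      rw [hU, Set.indicator_of_mem hx]
      have h1' : η x ≤ C / R ^ 2 := h1
      have k1 : u x * u x * lap η x ≤ u x * u x * (C / R ^ 4) :=
        mul_le_mul_of_nonneg_left ((le_abs_self _).trans h2) (mul_self_nonneg _)
      have k2 : -(u x * lap u x * η x) ≤ |u x * lap u x| * (C / R ^ 2) := by
        have : -(u x * lap u x * η x) ≤ |u x * lap u x| * η x := by
          have := mul_le_mul_of_nonneg_right (neg_le_abs (u x * lap u x)) (hη0 x)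
          linarith
        exact this.trans (mul_le_mul_of_nonneg_left h1' (abs_nonneg _))
      have k3 : |u x * lap u x| / R ^ 2 ≤ u x ^ 2 / R ^ 4 + lap u x ^ 2 := by
        have e : u x ^ 2 / R ^ 4 = (|u x| / R ^ 2) ^ 2 := by
          rw [div_pow, sq_abs]; ring
        have e' : |u x * lap u x| / R ^ 2 = |u x| / R ^ 2 * |lap u x| := by
          rw [abs_mul]; ring
        rw [e, e', ← sq_abs (lap u x)]
        nlinarith [sq_nonneg (|u x| / R ^ 2 - |lap u x|), sq_nonneg (|u x| / R ^ 2),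
          sq_nonneg (|lap u x|)]
      have k4 := mul_le_mul_of_nonneg_left k3 hC
      calc (1 / 2) * (u x * u x * lap η x) - u x * lap u x * η x
          ≤ (1 / 2) * (u x * u x * (C / R ^ 4)) + |u x * lap u x| * (C / R ^ 2) := by linarith
        _ = (1 / 2) * (u x * u x * (C / R ^ 4)) + C * (|u x * lap u x| / R ^ 2) := by ring
        _ ≤ (1 / 2) * (u x * u x * (C / R ^ 4)) + C * (u x ^ 2 / R ^ 4 + lap u x ^ 2) := by linarith
        _ = _ := by ring
    · rw [Set.indicator_of_notMem hx] at h1 h2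
      rw [hU, Set.indicator_of_notMem hx]
      have h1' : η x = 0 := le_antisymm h1 (hη0 x)
      have h2' : lap η x = 0 := abs_eq_zero.1 (le_antisymm h2 (abs_nonneg _))
      rw [h1', h2']
      have : 0 ≤ C * lap u x ^ 2 := by positivity
      linarith
  have e3 : ∫ x, FF u ψ x ^ 2 ≤ ∫ x, (8 * (G x * η x) + (2 * C ^ 2 / R ^ 4) * U x) := by
    refine integral_mono (((FF_cont hu hψ).pow 2).integrable_of_hasCompactSupport ?_)
      ((iGη.const_mul _).add (iU.const_mul _)) ?_
    · have := (FF_cs (u := u) hc)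
      simp only [pow_two]
      exact this.mul_left
    intro x
    show FF u ψ x ^ 2 ≤ 8 * (G x * η x) + (2 * C ^ 2 / R ^ 4) * U x
    have cs : (∑ i, pd i u x * pd i ψ x) ^ 2 ≤ G x * η x :=
      Finset.sum_mul_sq_le_sq_mul_sq _ _ _
    have k : (u x * lap ψ x) ^ 2 ≤ (C ^ 2 / R ^ 4) * U x := by
      have h1 := b1 x
      by_cases hx : x ∈ ann N R
      · rw [Set.indicator_of_mem hx] at h1
        rw [hU, Set.indicator_of_mem hx, mul_pow, mul_comm]
        gcongr
        rw [← sq_abs]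
        calc |lap ψ x| ^ 2 ≤ (C / R ^ 2) ^ 2 := by gcongr
          _ = _ := by rw [div_pow]; ring
      · rw [Set.indicator_of_notMem hx] at h1
        have h2' : lap ψ x = 0 := abs_eq_zero.1 (le_antisymm h1 (abs_nonneg _))
        rw [hU, Set.indicator_of_notMem hx, h2']
        simp
    have k' : (2 * C ^ 2 / R ^ 4) * U x = 2 * ((C ^ 2 / R ^ 4) * U x) := by ring
    rw [k']
    unfold FF
    nlinarith [sq_nonneg (2 * ∑ i, pd i u x * pd i ψ x - u x * lap ψ x)]
  rw [integral_add (iU.const_mul _) (hlap.const_mul _), integral_const_mul,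
    integral_const_mul] at e2
  rw [integral_add (iGη.const_mul _) (iU.const_mul _), integral_const_mul,
    integral_const_mul] at e3
  have k5 : (∫ x, U x) / R ^ 4 ≤ M := by rw [div_le_iff₀ (by positivity)]; exact hUM
  have k6 : 12 * C * ((∫ x, U x) / R ^ 4) + 2 * C ^ 2 * ((∫ x, U x) / R ^ 4)
      ≤ 12 * C * M + 2 * C ^ 2 * M := by gcongr
  calc ∫ x, FF u ψ x ^ 2 ≤ 8 * ((3 / 2 * C / R ^ 4) * (∫ x, U x) + C * ∫ x, lap u x ^ 2)
        + 2 * C ^ 2 / R ^ 4 * ∫ x, U x := by linarith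
    _ = 12 * C * ((∫ x, U x) / R ^ 4) + 2 * C ^ 2 * ((∫ x, U x) / R ^ 4)
        + 8 * C * ∫ x, lap u x ^ 2 := by ring
    _ ≤ _ := by linarith

end Henon

/-- **Energy identity for solutions of the fourth-order Hénon equation stable outside a
compact set.** Let `a ≥ 0`, `N ≥ 5`, `1 < p < (N+4+2a)/(N-4)`, and let `u` be a positive
`C⁴` solution of `Δ²u = |x|^a u^p` on `ℝ^N` which is stable outside a compact set and
satisfies `Δu ∈ L²(ℝ^N)` and `|x|^a u^(p+1) ∈ L¹(ℝ^N)`.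
Then `∫ |Δu|² = ∫ |x|^a u^(p+1)`. -/
theorem fourth_order_henon_energy_identity
    (N : ℕ) (hN : 5 ≤ N) (a p : ℝ) (ha : 0 ≤ a) (hp : 1 < p)
    (hsub : p < ((N : ℝ) + 4 + 2 * a) / ((N : ℝ) - 4))
    (u : EuclideanSpace ℝ (Fin N) → ℝ)
    (hu : ContDiff ℝ 4 u) (hupos : ∀ x, 0 < u x)
    (hequ : ∀ x, lap (lap u) x = ‖x‖ ^ a * u x ^ p)
    (K : Set (EuclideanSpace ℝ (Fin N))) (hK : IsCompact K)
    (hstable : ∀ φ : EuclideanSpace ℝ (Fin N) → ℝ,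
      ContDiff ℝ 4 φ → HasCompactSupport φ → Disjoint (tsupport φ) K →
      0 ≤ (∫ x, (lap φ x) ^ 2) - p * ∫ x, ‖x‖ ^ a * u x ^ (p - 1) * φ x ^ 2)
    (hlap : Integrable (fun x => (lap u x) ^ 2)
      (volume : Measure (EuclideanSpace ℝ (Fin N))))
    (hpot : Integrable (fun x => ‖x‖ ^ a * u x ^ (p + 1))
      (volume : Measure (EuclideanSpace ℝ (Fin N)))) :
    ∫ x, (lap u x) ^ 2 = ∫ x, ‖x‖ ^ a * u x ^ (p + 1) := by
  classical
  obtain ⟨C, hC, hcut⟩ := Henon.cutoff N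
  obtain ⟨M, hM0, hM⟩ := Henon.ann_bound hN ha hp hsub hu.continuous hupos hpot
  have hR : ∀ n : ℕ, (1 : ℝ) ≤ (n : ℝ) + 1 := fun n => by
    have : (0 : ℝ) ≤ n := n.cast_nonneg
    linarith
  choose ψ hψ hψc hψ0 hψ1 hψR b1 b2 b3 using fun n : ℕ => hcut ((n : ℝ) + 1) (hR n)
  set D := (12 * C + 2 * C ^ 2) * M + 8 * C * ∫ x, lap u x ^ 2 with hD
  have hF : ∀ n, ∫ x, Henon.FF u (ψ n) x ^ 2 ≤ D := fun n =>
    Henon.FF_bound hu hlap hC (hR n) (hM _ (hR n)) (hψ n) (hψc n) (b1 n) (b2 n) (b3 n)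
  have hu2 : ContDiff ℝ 2 u := hu.of_le (by norm_num)
  have clu : ContDiff ℝ 2 (lap u) := Henon.lap_contDiff (m := 3) hu (by norm_num) (by norm_num)
  have iF : ∀ n, Integrable (fun x => lap u x * Henon.FF u (ψ n) x) := fun n =>
    (clu.continuous.mul (Henon.FF_cont hu (hψ n))).integrable_of_hasCompactSupport
      (Henon.FF_cs (hψc n)).mul_left
  have iF2 : ∀ n, Integrable (fun x => Henon.FF u (ψ n) x ^ 2) := fun n => by
    refine ((Henon.FF_cont hu (hψ n)).pow 2).integrable_of_hasCompactSupport ?_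
    simp only [pow_two]
    exact (Henon.FF_cs (hψc n)).mul_left
  have bd : ∀ (f : EuclideanSpace ℝ (Fin N) → ℝ), Integrable f → ∀ n,
      Integrable (fun x => f x * ψ n x) := fun f hf n =>
    hf.mul_bdd (c := 1) (hψ n).continuous.aestronglyMeasurable
      (Filter.Eventually.of_forall fun x => by
        rw [Real.norm_of_nonneg (hψ0 n x)]; exact hψ1 n x)
  have evR : ∀ x : EuclideanSpace ℝ (Fin N), ∀ᶠ n : ℕ in Filter.atTop, ‖x‖ < (n : ℝ) + 1 := by
    intro x
    obtain ⟨m, hm⟩ := exists_nat_gt ‖x‖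
    filter_upwards [Filter.eventually_ge_atTop m] with n hn
    have : (m : ℝ) ≤ n := by exact_mod_cast hn
    linarith
  have lim : ∀ (f : EuclideanSpace ℝ (Fin N) → ℝ), Integrable f →
      Filter.Tendsto (fun n => ∫ x, f x * ψ n x) Filter.atTop (nhds (∫ x, f x)) := by
    intro f hf
    refine tendsto_integral_of_dominated_convergence (fun x => ‖f x‖)
      (fun n => (bd f hf n).aestronglyMeasurable) hf.norm ?_ ?_
    · intro n
      refine Filter.Eventually.of_forall fun x => ?_
      rw [norm_mul, Real.norm_of_nonneg (hψ0 n x)]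
      exact mul_le_of_le_one_right (norm_nonneg _) (hψ1 n x)
    · refine Filter.Eventually.of_forall fun x => ?_
      refine tendsto_const_nhds.congr' ?_
      filter_upwards [evR x] with n hn
      rw [hψR n x hn, mul_one]
  -- the identity
  have ident : ∀ n, (∫ x, ‖x‖ ^ a * u x ^ (p + 1) * ψ n x) - ∫ x, lap u x ^ 2 * ψ n x
      = ∫ x, lap u x * Henon.FF u (ψ n) x := by
    intro n
    have hψ2 : ContDiff ℝ 2 (ψ n) := (hψ n).of_le (by norm_num)
    have g := Henon.green (f := lap u) (g := fun y => u y * ψ n y) clu (hu2.mul hψ2)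
      (hψc n).mul_left
    have e1 : (fun x => lap (lap u) x * (u x * ψ n x))
        = fun x => ‖x‖ ^ a * u x ^ (p + 1) * ψ n x := by
      funext x
      rw [hequ, Real.rpow_add (hupos x), Real.rpow_one]
      ring
    have e2 : (fun x => lap u x * lap (fun y => u y * ψ n y) x)
        = fun x => lap u x * Henon.FF u (ψ n) x + lap u x ^ 2 * ψ n x := by
      funext x
      rw [Henon.lap_mul hu2 hψ2, Henon.FF]
      ring
    rw [e1, e2, integral_add (iF n) (bd _ hlap n)] at g
    linarith
  set T : ℕ → ℝ := fun n => ∫ x, (ball (0 : EuclideanSpace ℝ (Fin N)) ((n : ℝ) + 1))ᶜ.indicator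
    (fun x => lap u x ^ 2) x with hT
  have iT : ∀ n : ℕ, Integrable ((ball (0 : EuclideanSpace ℝ (Fin N)) ((n : ℝ) + 1))ᶜ.indicator
    (fun x => lap u x ^ 2)) := fun n => hlap.indicator measurableSet_ball.compl
  have hT0 : Filter.Tendsto T Filter.atTop (nhds 0) := by
    have : (0 : ℝ) = ∫ x : EuclideanSpace ℝ (Fin N), (0 : ℝ) := by simp
    rw [this]
    refine tendsto_integral_of_dominated_convergence (fun x => lap u x ^ 2)
      (fun n => (iT n).aestronglyMeasurable) hlap ?_ ?_
    · intro n
      refine Filter.Eventually.of_forall fun x => ?_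
      refine (norm_indicator_le_norm_self _ _).trans ?_
      rw [Real.norm_of_nonneg (sq_nonneg _)]
    · refine Filter.Eventually.of_forall fun x => ?_
      refine tendsto_const_nhds.congr' ?_
      filter_upwards [evR x] with n hn
      rw [Set.indicator_of_notMem]
      simpa using hn
  have est : ∀ ε : ℝ, 0 < ε → ∀ n, |∫ x, lap u x * Henon.FF u (ψ n) x| ≤ ε⁻¹ * T n + ε * D := by
    intro ε hε n
    calc |∫ x, lap u x * Henon.FF u (ψ n) x| ≤ ∫ x, |lap u x * Henon.FF u (ψ n) x| :=
          abs_integral_le_integral_abs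
      _ ≤ ∫ x, (ε⁻¹ * (ball (0 : EuclideanSpace ℝ (Fin N)) ((n : ℝ) + 1))ᶜ.indicator
            (fun x => lap u x ^ 2) x + ε * Henon.FF u (ψ n) x ^ 2) := by
          refine integral_mono (iF n).abs (((iT n).const_mul _).add ((iF2 n).const_mul _)) ?_
          intro x
          show |lap u x * Henon.FF u (ψ n) x|
            ≤ ε⁻¹ * (ball (0 : EuclideanSpace ℝ (Fin N)) ((n : ℝ) + 1))ᶜ.indicator
              (fun x => lap u x ^ 2) x + ε * Henon.FF u (ψ n) x ^ 2
          by_cases hx : ‖x‖ < (n : ℝ) + 1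
          · rw [Henon.FF_zero (hψR n) x hx, Set.indicator_of_notMem (by simpa using hx)]
            simp
          · rw [Set.indicator_of_mem (by simpa using hx), abs_mul, ← sq_abs (lap u x),
              ← sq_abs (Henon.FF u (ψ n) x)]
            generalize |lap u x| = s
            generalize |Henon.FF u (ψ n) x| = t
            have h : ε⁻¹ * s ^ 2 + ε * t ^ 2 - 2 * (s * t) = ε⁻¹ * (s - ε * t) ^ 2 := by
              field_simp
              ring
            have h' : ε⁻¹ * s ^ 2 + ε * t ^ 2 + 2 * (s * t) = ε⁻¹ * (s + ε * t) ^ 2 := by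
              field_simp
              ring
            have h2 : 0 ≤ ε⁻¹ * (s - ε * t) ^ 2 := by positivity
            have h3 : 0 ≤ ε⁻¹ * s ^ 2 + ε * t ^ 2 := by positivity
            linarith
      _ = ε⁻¹ * T n + ε * ∫ x, Henon.FF u (ψ n) x ^ 2 := by
          rw [integral_add ((iT n).const_mul _) ((iF2 n).const_mul _), integral_const_mul,
            integral_const_mul]
      _ ≤ ε⁻¹ * T n + ε * D := by
          have := mul_le_mul_of_nonneg_left (hF n) hε.le
          linarith
  have hD0 : 0 ≤ D := by
    have : 0 ≤ ∫ x, lap u x ^ 2 := integral_nonneg fun x => sq_nonneg _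
    positivity
  have fin : ∀ ε : ℝ, 0 < ε →
      |(∫ x, ‖x‖ ^ a * u x ^ (p + 1)) - ∫ x, lap u x ^ 2| ≤ ε * D := by
    intro ε hε
    have l1 := ((lim _ hpot).sub (lim _ hlap)).abs
    have l2 : Filter.Tendsto (fun n => ε⁻¹ * T n + ε * D) Filter.atTop (nhds (ε⁻¹ * 0 + ε * D)) :=
      (hT0.const_mul _).add tendsto_const_nhds
    rw [mul_zero, zero_add] at l2
    refine le_of_tendsto_of_tendsto' l1 l2 fun n => ?_
    rw [ident n]
    exact est ε hε n
  have hz : |(∫ x, ‖x‖ ^ a * u x ^ (p + 1)) - ∫ x, lap u x ^ 2| ≤ 0 := by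
    refine le_of_forall_pos_le_add fun δ hδ => ?_
    have h := fin (δ / (D + 1)) (by positivity)
    have h2 : δ / (D + 1) * D ≤ δ := by
      rw [div_mul_eq_mul_div, div_le_iff₀ (by positivity)]
      nlinarith
    linarith
  have := abs_nonpos_iff.1 hz
  linarith
end

section
/- Let p ≥ q, a, b ≥ 0 with pq > 1 and suppose 0 ≤ a − b ≤ (N−2)(p−q). If (u, v) is a positive classical solution of the Hénon–Lane–Emden system −Δu = |x|^a v^p, −Δv = |x|^b u^q on ℝ^N, then the pointwise comparison |x|^a v(x)^{p+1} ≤ ((p+1)/(q+1)) |x|^b u(x)^{q+1} holds for all x ∈ ℝ^N. -/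
open MeasureTheory Real Metric

set_option maxHeartbeats 4000000

/-- second order one-variable data at a point -/
def D2 (f : ℝ → ℝ) (t f1 f2 : ℝ) : Prop :=
  ∃ f' : ℝ → ℝ, (∀ᶠ y in nhds t, HasDerivAt f (f' y) y) ∧ f' t = f1 ∧ HasDerivAt f' f2 t

lemma D2.sub {f g : ℝ → ℝ} {t f1 f2 g1 g2 : ℝ} (hf : D2 f t f1 f2) (hg : D2 g t g1 g2) :
    D2 (fun y => f y - g y) t (f1 - g1) (f2 - g2) := by
  obtain ⟨f', h1, h2, h3⟩ := hf
  obtain ⟨g', k1, k2, k3⟩ := hg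
  refine ⟨fun y => f' y - g' y, ?_, by simp [h2, k2], h3.sub k3⟩
  filter_upwards [h1, k1] with y a b using a.sub b

lemma D2.add {f g : ℝ → ℝ} {t f1 f2 g1 g2 : ℝ} (hf : D2 f t f1 f2) (hg : D2 g t g1 g2) :
    D2 (fun y => f y + g y) t (f1 + g1) (f2 + g2) := by
  obtain ⟨f', h1, h2, h3⟩ := hf
  obtain ⟨g', k1, k2, k3⟩ := hg
  refine ⟨fun y => f' y + g' y, ?_, by simp [h2, k2], h3.add k3⟩
  filter_upwards [h1, k1] with y a b using a.add b

lemma D2.const_mul {f : ℝ → ℝ} {t f1 f2 : ℝ} (c : ℝ) (hf : D2 f t f1 f2) :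
    D2 (fun y => c * f y) t (c * f1) (c * f2) := by
  obtain ⟨f', h1, h2, h3⟩ := hf
  refine ⟨fun y => c * f' y, ?_, by simp [h2], h3.const_mul c⟩
  filter_upwards [h1] with y a using a.const_mul c

lemma D2.mul {f g : ℝ → ℝ} {t f1 f2 g1 g2 : ℝ} (hf : D2 f t f1 f2) (hg : D2 g t g1 g2) :
    D2 (fun y => f y * g y) t (f1 * g t + f t * g1) (f2 * g t + 2 * (f1 * g1) + f t * g2) := by
  obtain ⟨f', h1, h2, h3⟩ := hf
  obtain ⟨g', k1, k2, k3⟩ := hg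
  refine ⟨fun y => f' y * g y + f y * g' y, ?_, by simp [h2, k2], ?_⟩
  · filter_upwards [h1, k1] with y a b using a.mul b
  · have := (h3.mul k1.self_of_nhds).add (h1.self_of_nhds.mul k3)
    refine this.congr_deriv ?_
    rw [h2, k2]; ring

lemma D2.comp {φ f : ℝ → ℝ} {t f1 f2 p1 p2 : ℝ} (hp : D2 φ (f t) p1 p2) (hf : D2 f t f1 f2) :
    D2 (fun y => φ (f y)) t (p1 * f1) (p2 * f1 ^ 2 + p1 * f2) := by
  obtain ⟨f', h1, h2, h3⟩ := hf
  obtain ⟨g', k1, k2, k3⟩ := hp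
  refine ⟨fun y => g' (f y) * f' y, ?_, by simp [h2, k2], ?_⟩
  · have hc : Filter.Tendsto f (nhds t) (nhds (f t)) := h1.self_of_nhds.continuousAt
    filter_upwards [h1, hc.eventually k1] with y a b using b.comp y a
  · have := (HasDerivAt.comp t k3 h1.self_of_nhds).mul h3
    refine this.congr_deriv ?_
    simp only [Function.comp_apply, h2, k2]; ring

lemma D2.nonpos {f : ℝ → ℝ} {t f1 f2 : ℝ} (hf : D2 f t f1 f2) (hm : IsLocalMax f t) : f2 ≤ 0 := by
  obtain ⟨f', h1, h2, h3⟩ := hf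
  by_contra hpos
  push Not at hpos
  have hd : deriv f =ᶠ[nhds t] f' := by
    filter_upwards [h1] with y a using a.deriv
  have hdd : deriv (deriv f) t = f2 := by
    rw [hd.deriv_eq, h3.deriv]
  have hd0 : deriv f t = 0 := hm.deriv_eq_zero
  have hmin : IsLocalMin f t :=
    isLocalMin_of_deriv_deriv_pos (by rw [hdd]; exact hpos) hd0 h1.self_of_nhds.continuousAt
  have hconst : f =ᶠ[nhds t] fun _ => f t := by
    filter_upwards [hm, hmin] with y a b using le_antisymm a b
  have h0 : deriv f =ᶠ[nhds t] fun _ => 0 := by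
    have := hconst.deriv
    simpa using this
  have : deriv (deriv f) t = 0 := by rw [h0.deriv_eq]; simp
  linarith

lemma D2_rpow {t : ℝ} (ht : 0 < t) (r : ℝ) :
    D2 (fun y => y ^ r) t (r * t ^ (r - 1)) (r * (r - 1) * t ^ (r - 2)) := by
  refine ⟨fun y => r * y ^ (r - 1), ?_, rfl, ?_⟩
  · filter_upwards [lt_mem_nhds ht] with y hy
    exact Real.hasDerivAt_rpow_const (Or.inl hy.ne')
  · have := (Real.hasDerivAt_rpow_const (x := t) (p := r - 1) (Or.inl ht.ne')).const_mul r
    refine this.congr_deriv ?_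
    rw [show r - 1 - 1 = r - 2 by ring]; ring

lemma D2_rpow_zero (t : ℝ) (r : ℝ) (h : 0 < t ∨ r = 0) :
    D2 (fun y => y ^ r) t (r * t ^ (r - 1)) (r * (r - 1) * t ^ (r - 2)) := by
  rcases h with h | rfl
  · exact D2_rpow h r
  · refine ⟨fun _ => 0, ?_, by simp, ?_⟩
    · simp [hasDerivAt_const]
    · simpa using hasDerivAt_const t (0 : ℝ)

lemma D2_line {N : ℕ} {f : EuclideanSpace ℝ (Fin N) → ℝ} (hf : ContDiff ℝ 2 f)
    (x e : EuclideanSpace ℝ (Fin N)) :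
    D2 (fun t : ℝ => f (x + t • e)) 0 (fderiv ℝ f x e)
      (fderiv ℝ (fun y => fderiv ℝ f y e) x e) := by
  have hl : ∀ t : ℝ, HasDerivAt (fun t : ℝ => x + t • e) e t := fun t => by
    simpa using ((hasDerivAt_id t).smul_const e).const_add x
  refine ⟨fun t => fderiv ℝ f (x + t • e) e, ?_, by simp, ?_⟩
  · refine Filter.Eventually.of_forall fun t => ?_
    have := (hf.differentiable (by norm_num) (x + t • e)).hasFDerivAt
    exact this.comp_hasDerivAt t (hl t)
  · have h1 : ContDiff ℝ 1 (fun y => fderiv ℝ f y e) :=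
      (hf.fderiv_right (m := 1) (by norm_num)).clm_apply contDiff_const
    have h2 : HasFDerivAt (fun y => fderiv ℝ f y e) (fderiv ℝ (fun y => fderiv ℝ f y e) x)
      (x + (0:ℝ) • e) := by
      simpa using (h1.differentiable (by norm_num) x).hasFDerivAt
    exact h2.comp_hasDerivAt (0:ℝ) (hl 0)

lemma D2_normsq {N : ℕ} (x : EuclideanSpace ℝ (Fin N)) (i : Fin N) :
    D2 (fun t : ℝ => ‖x + t • EuclideanSpace.single i (1:ℝ)‖ ^ 2) 0 (2 * x i) 2 := by
  have : (fun t : ℝ => ‖x + t • EuclideanSpace.single i (1:ℝ)‖ ^ 2) =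
      fun t => ‖x‖ ^ 2 + 2 * x i * t + t ^ 2 := by
    funext t
    rw [norm_add_sq_real]
    simp [norm_smul, inner_smul_right, EuclideanSpace.inner_single_right]
    ring
  rw [this]
  refine ⟨fun t => 2 * x i + 2 * t, ?_, by simp, ?_⟩
  · refine Filter.Eventually.of_forall fun t => ?_
    have := (((hasDerivAt_id t).const_mul (2 * x i)).const_add (‖x‖^2)).add (hasDerivAt_pow 2 t)
    refine this.congr_deriv ?_
    simp
  · simpa using ((hasDerivAt_id (0:ℝ)).const_mul 2).const_add (2 * x i)

/-- nonlinear lower bound -/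
lemma nonlin {p q σ l k δ S T u v : ℝ} (hσ : 0 < σ) (hS : 0 < S) (hT : 0 ≤ T)
    (hl : 0 < l) (hu : 0 < u) (hv : 0 < v) (hσ1 : σ * (p + 1) = q + 1)
    (hl1 : l ^ (p + 1) * σ = 1) (hk : σ * k = 1 - σ) (hk0 : 0 ≤ k) (hδ : 1 + δ = p - k)
    (hδ0 : 0 < δ) (hz : l * S * u ^ σ < v) :
    σ * l ^ (1 + k) * (T * S ^ (1 + k)) * (v - l * S * u ^ σ) ^ (1 + δ) ≤
      -((T * S ^ (1 + p)) * u ^ q) + l * σ * S * u ^ (σ - 1) * (T * v ^ p) := by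
  set z := l * S * u ^ σ with hzdef
  have hzpos : 0 < z := by positivity
  have e1 : z ^ k = l ^ k * S ^ k * u ^ (1 - σ) := by
    rw [hzdef, Real.mul_rpow (by positivity) (by positivity), Real.mul_rpow hl.le hS.le,
      ← Real.rpow_mul hu.le, hk]
  have e2 : z ^ p = l ^ p * S ^ p * u ^ (σ * p) := by
    rw [hzdef, Real.mul_rpow (by positivity) (by positivity), Real.mul_rpow hl.le hS.le,
      ← Real.rpow_mul hu.le]
  have e3 : u ^ (1 - σ) * u ^ (σ - 1) = 1 := by
    rw [← Real.rpow_add hu]; simp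
  have e4 : u ^ (σ * p) * u ^ (σ - 1) = u ^ q := by
    rw [← Real.rpow_add hu]; congr 1; linarith
  have e5 : l ^ (p + 1) = l ^ p * l := by rw [Real.rpow_add hl]; simp
  have e6 : l ^ (1 + k) = l * l ^ k := by rw [Real.rpow_add hl]; simp
  have e7 : S ^ (1 + k) = S * S ^ k := by rw [Real.rpow_add hS]; simp
  have e8 : S ^ (1 + p) = S * S ^ p := by rw [Real.rpow_add hS]; simp
  have key : z ^ k * (v - z) ^ (1 + δ) ≤ v ^ p - z ^ p := by
    have h1 : z ^ (1 + δ) + (v - z) ^ (1 + δ) ≤ v ^ (1 + δ) := by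
      have := Real.add_rpow_le_rpow_add hzpos.le (sub_pos.2 hz).le (by linarith : 1 ≤ 1 + δ)
      simpa using this
    have h2 : z ^ p = z ^ k * z ^ (1 + δ) := by rw [← Real.rpow_add hzpos]; congr 1; linarith
    have h3 : v ^ p = v ^ k * v ^ (1 + δ) := by rw [← Real.rpow_add hv]; congr 1; linarith
    have h4 : z ^ k ≤ v ^ k := Real.rpow_le_rpow hzpos.le hz.le hk0
    have h5 : 0 < z ^ k := by positivity
    have h6 : 0 < v ^ (1 + δ) := by positivity
    rw [h2, h3]
    nlinarith [mul_le_mul_of_nonneg_right h4 h6.le, mul_le_mul_of_nonneg_left h1 h5.le]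
  have rhs : -((T * S ^ (1 + p)) * u ^ q) + l * σ * S * u ^ (σ - 1) * (T * v ^ p) =
      l * σ * S * u ^ (σ - 1) * T * (v ^ p - z ^ p) := by
    rw [e5] at hl1
    rw [e8, ← e4, e2]
    linear_combination (T * (S * S ^ p) * (u ^ (σ * p) * u ^ (σ - 1))) * hl1
  rw [rhs]
  have hpos : 0 ≤ l * σ * S * u ^ (σ - 1) * T := by positivity
  refine le_trans (le_of_eq ?_) (mul_le_mul_of_nonneg_left key hpos)
  rw [e6, e7, e1]
  linear_combination -(σ * (l * l ^ k) * (T * (S * S ^ k)) * (v - z) ^ (1 + δ)) * e3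

/-- barrier -/
lemma barrier (n β : ℕ) (R2 s : ℝ) (h : 1 - (s / R2) ^ (n + 2) ≠ 0) :
    D2 (fun y => ((1 - (y / R2) ^ (n + 2)) ^ β)⁻¹) s
      (β * (n + 2) * (s / R2) ^ (n + 1) / R2 * ((1 - (s / R2) ^ (n + 2)) ^ (β + 1))⁻¹)
      (β * (β + 1) * (n + 2) ^ 2 * (s / R2) ^ (2 * n + 2) / R2 ^ 2 *
          ((1 - (s / R2) ^ (n + 2)) ^ (β + 2))⁻¹
        + β * (n + 2) * (n + 1) * (s / R2) ^ n / R2 ^ 2 *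
          ((1 - (s / R2) ^ (n + 2)) ^ (β + 1))⁻¹) := by
  have hh : D2 (fun y => 1 - (y / R2) ^ (n + 2)) s (-((n + 2) * (s / R2) ^ (n + 1) / R2))
      (-((n + 2) * (n + 1) * (s / R2) ^ n / R2 ^ 2)) := by
    refine ⟨fun y => (-((n + 2) * (y / R2) ^ (n + 1) / R2)), ?_, rfl, ?_⟩
    · refine Filter.Eventually.of_forall fun y => ?_
      have := (((hasDerivAt_id y).div_const R2).pow (n + 2)).const_sub 1
      refine this.congr_deriv ?_
      simp; ring
    · have := (((((hasDerivAt_id s).div_const R2).pow (n + 1)).const_mul ((n:ℝ) + 2)).div_const R2).neg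
      refine this.congr_deriv ?_
      simp; ring
  have hp : D2 (fun y : ℝ => (y ^ β)⁻¹) (1 - (s / R2) ^ (n + 2))
      (-(β * ((1 - (s / R2) ^ (n + 2)) ^ (β + 1))⁻¹))
      (β * (β + 1) * ((1 - (s / R2) ^ (n + 2)) ^ (β + 2))⁻¹) := by
    have gen : ∀ (m : ℕ) (y : ℝ), y ≠ 0 → HasDerivAt (fun y : ℝ => (y ^ m)⁻¹) (-(m * (y ^ (m + 1))⁻¹)) y := by
      intro m y hy
      have := (hasDerivAt_pow m y).inv (pow_ne_zero m hy)
      refine this.congr_deriv ?_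
      rcases m with _ | m
      · simp
      · push_cast
        field_simp
        simp
        ring
    refine ⟨fun y => -(β * (y ^ (β + 1))⁻¹), ?_, rfl, ?_⟩
    · filter_upwards [isOpen_ne.mem_nhds h] with y hy using gen β y hy
    · have := ((gen (β + 1) _ h).const_mul (β : ℝ)).neg
      refine this.congr_deriv ?_
      push_cast; ring
  have := D2.comp (f := fun y => 1 - (y / R2) ^ (n + 2)) hp hh
  convert this using 1
  · ring
  · ring

lemma barrier_bound (N n β : ℕ) (R2 s : ℝ) (hR : 0 < R2) (hs : 0 ≤ s) (h : 0 < 1 - (s / R2) ^ (n + 2)) :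
    4 * s * (β * (β + 1) * (n + 2) ^ 2 * (s / R2) ^ (2 * n + 2) / R2 ^ 2 *
          ((1 - (s / R2) ^ (n + 2)) ^ (β + 2))⁻¹
        + β * (n + 2) * (n + 1) * (s / R2) ^ n / R2 ^ 2 *
          ((1 - (s / R2) ^ (n + 2)) ^ (β + 1))⁻¹) +
      2 * N * (β * (n + 2) * (s / R2) ^ (n + 1) / R2 * ((1 - (s / R2) ^ (n + 2)) ^ (β + 1))⁻¹)
    ≤ (4 * β * (β + 1) * (n + 2) ^ 2 + 4 * β * (n + 2) * (n + 1) + 2 * N * β * (n + 2)) / R2 *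
        (s / R2) ^ (n + 1) * ((1 - (s / R2) ^ (n + 2)) ^ (β + 2))⁻¹ := by
  obtain ⟨r, rfl⟩ : ∃ r, s = r * R2 := ⟨s / R2, by field_simp⟩
  have e : r * R2 / R2 = r := by field_simp
  rw [e] at h ⊢
  have hr : 0 ≤ r := by
    by_contra hc
    push Not at hc
    nlinarith
  have hr1 : r ≤ 1 := by
    by_contra hc
    push Not at hc
    have := one_le_pow₀ hc.le (n := n + 2)
    linarith
  set H := 1 - r ^ (n + 2) with hH
  have hH1 : H ≤ 1 := by have : 0 ≤ r ^ (n + 2) := by positivity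
                         linarith
  have hI : (H ^ (β + 1))⁻¹ ≤ (H ^ (β + 2))⁻¹ :=
    inv_anti₀ (by positivity) (pow_le_pow_of_le_one h.le hH1 (by omega))
  have hP : r ^ (2 * n + 3) ≤ r ^ (n + 1) := pow_le_pow_of_le_one hr hr1 (by omega)
  set I1 := (H ^ (β + 1))⁻¹
  set I2 := (H ^ (β + 2))⁻¹
  have hI2 : 0 ≤ I2 := by positivity
  have lhs : 4 * (r * R2) * (β * (β + 1) * (n + 2) ^ 2 * r ^ (2 * n + 2) / R2 ^ 2 * I2
        + β * (n + 2) * (n + 1) * r ^ n / R2 ^ 2 * I1) +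
      2 * N * (β * (n + 2) * r ^ (n + 1) / R2 * I1) =
      (4 * β * (β + 1) * (n + 2) ^ 2) / R2 * r ^ (2 * n + 3) * I2 +
      (4 * β * (n + 2) * (n + 1) + 2 * N * β * (n + 2)) / R2 * r ^ (n + 1) * I1 := by
    field_simp
    ring
  rw [lhs]
  have a1 : (4 * β * (β + 1) * (n + 2) ^ 2) / R2 * r ^ (2 * n + 3) * I2 ≤
      (4 * β * (β + 1) * (n + 2) ^ 2) / R2 * r ^ (n + 1) * I2 := by gcongr
  have a2 : (4 * β * (n + 2) * (n + 1) + 2 * N * β * (n + 2)) / R2 * r ^ (n + 1) * I1 ≤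
      (4 * β * (n + 2) * (n + 1) + 2 * N * β * (n + 2)) / R2 * r ^ (n + 1) * I2 := by gcongr
  refine (add_le_add a1 a2).trans (le_of_eq ?_)
  ring

lemma coord_bound {τ σ s S U u x d u2 : ℝ} (hτ : 0 < τ) (hσ : 0 < σ) (hσ1 : σ < 1) (hs : 0 < s)
    (hS : 0 < S) (hU : 0 < U) (hu : 0 < u) :
    (-τ * (-τ - 1) * (S / s ^ 2) * (2 * x) ^ 2 + -τ * (S / s) * 2) * U
      + 2 * ((-τ * (S / s) * (2 * x)) * (σ * (U / u) * d))
      + S * (σ * (σ - 1) * (U / u ^ 2) * d ^ 2 + σ * (U / u) * u2)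
    ≤ S * U * (4 * τ * (τ + 1) + 4 * τ ^ 2 * σ / (1 - σ)) / s ^ 2 * x ^ 2 - 2 * τ * S * U / s
      + S * (σ * (U / u) * u2) := by
  have h1 : 0 < 1 - σ := by linarith
  have key : 0 ≤ S * U * (σ / (1 - σ)) * (2 * τ * x / s + (1 - σ) * d / u) ^ 2 := by positivity
  refine sub_nonneg.1 (key.trans (le_of_eq ?_))
  field_simp
  ring

lemma calc_max {N : ℕ} {u v : EuclideanSpace ℝ (Fin N) → ℝ} (hu : ContDiff ℝ 2 u)
    (hv : ContDiff ℝ 2 v) (hupos : ∀ x, 0 < u x) (x : EuclideanSpace ℝ (Fin N))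
    {τ σ l ε M G1 G2 : ℝ} {G : ℝ → ℝ} (hσ : 0 < σ) (hτ : 0 ≤ τ) (hσ1 : σ ≤ 1) (hl : 0 ≤ l)
    (hs : 0 < ‖x‖ ^ 2 ∨ τ = 0) (hτN : 2 * τ ≤ ((N : ℝ) - 2) * (1 - σ))
    (hG : D2 G (‖x‖ ^ 2) G1 G2)
    (hmax : IsLocalMax (fun y => v y - l * ((‖y‖ ^ 2) ^ (-τ) * u y ^ σ) + ε * ‖y‖ ^ 2
      - M * G (‖y‖ ^ 2)) x) :
    lap v x - l * ((‖x‖ ^ 2) ^ (-τ) * (σ * u x ^ (σ - 1) * lap u x)) + 2 * N * ε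
      - M * (4 * ‖x‖ ^ 2 * G2 + 2 * N * G1) ≤ 0 := by
  set s := ‖x‖ ^ 2 with hsdef
  have hux := hupos x
  let e : Fin N → EuclideanSpace ℝ (Fin N) := fun i => EuclideanSpace.single i 1
  let du : Fin N → ℝ := fun i => fderiv ℝ u x (e i)
  let u2 : Fin N → ℝ := fun i => fderiv ℝ (fun y => fderiv ℝ u y (e i)) x (e i)
  let v2 : Fin N → ℝ := fun i => fderiv ℝ (fun y => fderiv ℝ v y (e i)) x (e i)
  have hsum : ∑ i, x i ^ 2 = s := by
    rw [hsdef, EuclideanSpace.norm_sq_eq]; simp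
  have hi : ∀ i, v2 i - l * ((-τ * (-τ - 1) * s ^ (-τ - 2) * (2 * x i) ^ 2
      + -τ * s ^ (-τ - 1) * 2) * u x ^ σ
      + 2 * ((-τ * s ^ (-τ - 1) * (2 * x i)) * (σ * u x ^ (σ - 1) * du i))
      + s ^ (-τ) * (σ * (σ - 1) * u x ^ (σ - 2) * du i ^ 2 + σ * u x ^ (σ - 1) * u2 i)) + ε * 2
      - M * (G2 * (2 * x i) ^ 2 + G1 * 2) ≤ 0 := by
    intro i
    have hc : Filter.Tendsto (fun t : ℝ => x + t • e i) (nhds 0) (nhds x) := by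
      have : Continuous (fun t : ℝ => x + t • e i) := by fun_prop
      simpa using this.tendsto 0
    have hS := D2_normsq x i
    have hU := D2_line hu x (e i)
    have hV := D2_line hv x (e i)
    have hS' : D2 (fun t : ℝ => (‖x + t • e i‖ ^ 2) ^ (-τ)) 0 _ _ :=
      D2.comp (φ := fun y => y ^ (-τ)) (f := fun t : ℝ => ‖x + t • e i‖ ^ 2)
        (p1 := -τ * s ^ (-τ - 1)) (p2 := -τ * (-τ - 1) * s ^ (-τ - 2))
        (by simpa [hsdef] using D2_rpow_zero s (-τ) (by simpa using hs)) hS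
    have hG' : D2 (fun t : ℝ => G (‖x + t • e i‖ ^ 2)) 0 _ _ :=
      D2.comp (φ := G) (f := fun t : ℝ => ‖x + t • e i‖ ^ 2)
        (p1 := G1) (p2 := G2) (by simpa [hsdef] using hG) hS
    have hU' : D2 (fun t : ℝ => (u (x + t • e i)) ^ σ) 0 _ _ :=
      D2.comp (φ := fun y => y ^ σ) (f := fun t : ℝ => u (x + t • e i))
        (p1 := σ * u x ^ (σ - 1)) (p2 := σ * (σ - 1) * u x ^ (σ - 2))
        (by simpa using D2_rpow hux σ) hU
    have tot := ((hV.sub ((hS'.mul hU').const_mul l)).add (hS.const_mul ε)).sub (hG'.const_mul M)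
    have hm : IsLocalMax (fun t : ℝ => v (x + t • e i) - l * ((‖x + t • e i‖ ^ 2) ^ (-τ)
        * u (x + t • e i) ^ σ) + ε * ‖x + t • e i‖ ^ 2 - M * G (‖x + t • e i‖ ^ 2)) 0 := by
      have := hc.eventually hmax
      simpa [IsLocalMax, IsMaxFilter] using this
    have := D2.nonpos tot hm
    simpa [hsdef] using this
  have hgood : ∃ α γ : ℝ, α * s - N * γ ≤ 0 ∧ ∀ i, (-τ * (-τ - 1) * s ^ (-τ - 2) * (2 * x i) ^ 2
      + -τ * s ^ (-τ - 1) * 2) * u x ^ σ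
      + 2 * ((-τ * s ^ (-τ - 1) * (2 * x i)) * (σ * u x ^ (σ - 1) * du i))
      + s ^ (-τ) * (σ * (σ - 1) * u x ^ (σ - 2) * du i ^ 2 + σ * u x ^ (σ - 1) * u2 i) ≤
      α * x i ^ 2 - γ + s ^ (-τ) * (σ * u x ^ (σ - 1) * u2 i) := by
    rcases hτ.eq_or_lt with h0 | h0
    · refine ⟨0, 0, by simp, fun i => ?_⟩
      have h1 : 0 ≤ σ * (1 - σ) * u x ^ (σ - 2) * du i ^ 2 := by
        have : 0 ≤ 1 - σ := by linarith
        positivity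
      rw [← h0]
      simp
      nlinarith
    · have hs0 : 0 < s := hs.resolve_right h0.ne'
      have hσ2 : σ < 1 := by
        rcases hσ1.eq_or_lt with h | h
        · rw [h] at hτN; linarith
        · exact h
      have h1 : 0 < 1 - σ := by linarith
      have hSp : 0 < s ^ (-τ) := by positivity
      have hUp : 0 < u x ^ σ := by positivity
      refine ⟨s ^ (-τ) * u x ^ σ * (4 * τ * (τ + 1) + 4 * τ ^ 2 * σ / (1 - σ)) / s ^ 2,
        2 * τ * s ^ (-τ) * u x ^ σ / s, ?_, fun i => ?_⟩
      · have : s ^ (-τ) * u x ^ σ * (4 * τ * (τ + 1) + 4 * τ ^ 2 * σ / (1 - σ)) / s ^ 2 * s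
          - N * (2 * τ * s ^ (-τ) * u x ^ σ / s) =
          (s ^ (-τ) * u x ^ σ * (2 * τ) / (s * (1 - σ))) * (2 * τ - (N - 2) * (1 - σ)) := by
          field_simp
          ring
        rw [this]
        exact mul_nonpos_of_nonneg_of_nonpos (by positivity) (by linarith)
      · have := coord_bound (x := x i) (d := du i) (u2 := u2 i) h0 hσ hσ2 hs0 hSp hUp hux
        have r1 : s ^ (-τ - 1) = s ^ (-τ) / s := Real.rpow_sub_one hs0.ne' _
        have r2 : s ^ (-τ - 2) = s ^ (-τ) / s ^ 2 := by
          rw [Real.rpow_sub hs0]; norm_num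
        have r3 : u x ^ (σ - 1) = u x ^ σ / u x := Real.rpow_sub_one hux.ne' _
        have r4 : u x ^ (σ - 2) = u x ^ σ / u x ^ 2 := by
          rw [Real.rpow_sub hux]; norm_num
        rw [r1, r2, r3, r4]
        exact this
  obtain ⟨α, γ, hαγ, hQ⟩ := hgood
  have hi2 : ∀ i, v2 i - l * (α * x i ^ 2 - γ + s ^ (-τ) * (σ * u x ^ (σ - 1) * u2 i)) + ε * 2
      - M * (G2 * (2 * x i) ^ 2 + G1 * 2) ≤ 0 := fun i => by
    have := mul_le_mul_of_nonneg_left (hQ i) hl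
    have := hi i
    linarith
  have hfin := Finset.sum_nonpos (s := Finset.univ) fun i _ => hi2 i
  have hlv : lap v x = ∑ i, v2 i := rfl
  have hlu : lap u x = ∑ i, u2 i := rfl
  have hcomp : ∑ i, (v2 i - l * (α * x i ^ 2 - γ + s ^ (-τ) * (σ * u x ^ (σ - 1) * u2 i)) + ε * 2
      - M * (G2 * (2 * x i) ^ 2 + G1 * 2)) =
      lap v x - l * (α * s - N * γ + s ^ (-τ) * (σ * u x ^ (σ - 1) * lap u x)) + 2 * N * ε
      - M * (4 * s * G2 + 2 * N * G1) := by
    rw [hlv, hlu, ← hsum]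
    simp only [mul_pow, Finset.sum_add_distrib, Finset.sum_sub_distrib, ← Finset.mul_sum,
      Finset.sum_const, Finset.card_univ, Fintype.card_fin, nsmul_eq_mul]
    ring
  rw [hcomp] at hfin
  have := mul_nonpos_of_nonneg_of_nonpos hl hαγ
  linarith

lemma max_bound {N : ℕ} (hN : 0 < N) {u v : EuclideanSpace ℝ (Fin N) → ℝ} (hu : ContDiff ℝ 2 u)
    (hv : ContDiff ℝ 2 v) (hupos : ∀ x, 0 < u x)
    {τ σ l c A δ : ℝ} (hσ : 0 < σ) (hτ : 0 ≤ τ) (hσ1 : σ ≤ 1) (hl : 0 < l)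
    (hτN : 2 * τ ≤ ((N : ℝ) - 2) * (1 - σ)) (hc : 0 < c) (hA : 0 ≤ A) (hδ : 0 < δ)
    (hlow : ∀ x, (0 < ‖x‖ ^ 2 ∨ τ = 0) → 0 < v x - l * ((‖x‖ ^ 2) ^ (-τ) * u x ^ σ) →
      c * (‖x‖ ^ 2) ^ A * (v x - l * ((‖x‖ ^ 2) ^ (-τ) * u x ^ σ)) ^ (1 + δ) ≤
      lap v x - l * ((‖x‖ ^ 2) ^ (-τ) * (σ * u x ^ (σ - 1) * lap u x)))
    (n β : ℕ) (hn : A ≤ n + 1) (hβ : 2 ≤ β * δ) (R2 : ℝ) (hR : 1 ≤ R2)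
    (x0 : EuclideanSpace ℝ (Fin N)) (hx0 : ‖x0‖ ^ 2 < R2) (hs0 : 0 < ‖x0‖ ^ 2 ∨ τ = 0)
    (hw0 : 0 < v x0 - l * ((‖x0‖ ^ 2) ^ (-τ) * u x0 ^ σ)) (d : ℝ) (hd0 : 0 < d)
    (hd : d ≤ (v x0 - l * ((‖x0‖ ^ 2) ^ (-τ) * u x0 ^ σ)) *
      (1 - (‖x0‖ ^ 2 / R2) ^ (n + 2)) ^ β) :
    c * (1 / 2) ^ (1 + δ) * d ^ δ ≤
      (4 * β * (β + 1) * (n + 2) ^ 2 + 4 * β * (n + 2) * (n + 1) + 2 * N * β * (n + 2)) / R2 := by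
  have hR0 : 0 < R2 := by linarith
  set K : ℝ := 4 * β * (β + 1) * (n + 2) ^ 2 + 4 * β * (n + 2) * (n + 1) + 2 * N * β * (n + 2)
    with hK
  have hβ0 : β ≠ 0 := by
    rintro rfl
    norm_num at hβ
  let w : EuclideanSpace ℝ (Fin N) → ℝ := fun x => v x - l * ((‖x‖ ^ 2) ^ (-τ) * u x ^ σ)
  let η : EuclideanSpace ℝ (Fin N) → ℝ := fun x => (1 - (‖x‖ ^ 2 / R2) ^ (n + 2)) ^ β
  obtain ⟨ε, hε, hεR⟩ : ∃ ε : ℝ, 0 < ε ∧ ε * R2 ≤ d / 2 :=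
    ⟨d / 2 / R2, by positivity, by rw [div_mul_cancel₀ _ hR0.ne']⟩
  let Kset : Set (EuclideanSpace ℝ (Fin N)) :=
    {x | ‖x‖ ^ 2 ≤ R2 ∧ l * u x ^ σ ≤ (‖x‖ ^ 2) ^ τ * v x}
  have cu : Continuous fun x => l * u x ^ σ :=
    continuous_const.mul (hu.continuous.rpow_const fun x => Or.inl (hupos x).ne')
  have cv : Continuous fun x => (‖x‖ ^ 2) ^ τ * v x :=
    ((continuous_norm.pow 2).rpow_const fun x => Or.inr hτ).mul hv.continuous
  have hKc : IsCompact Kset := by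
    refine Metric.isCompact_of_isClosed_isBounded ?_ ?_
    · exact (isClosed_le (continuous_norm.pow 2) continuous_const).inter (isClosed_le cu cv)
    · refine (Metric.isBounded_closedBall (x := (0 : EuclideanSpace ℝ (Fin N))) (r := R2)).subset ?_
      intro x hx
      have := hx.1
      simp only [mem_closedBall, dist_zero_right]
      by_contra hcon
      push Not at hcon
      nlinarith
  have hsK : ∀ x ∈ Kset, 0 < ‖x‖ ^ 2 ∨ τ = 0 := by
    intro x hx
    by_contra hcon
    push Not at hcon
    have h0 : ‖x‖ ^ 2 = 0 := le_antisymm hcon.1 (by positivity)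
    have := hx.2
    rw [h0, Real.zero_rpow hcon.2, zero_mul] at this
    have h2 : 0 < l * u x ^ σ := mul_pos hl (Real.rpow_pos_of_pos (hupos x) _)
    linarith
  have hSS : ∀ x : EuclideanSpace ℝ (Fin N), (0 < ‖x‖ ^ 2 ∨ τ = 0) →
      (‖x‖ ^ 2) ^ τ * w x = (‖x‖ ^ 2) ^ τ * v x - l * u x ^ σ ∧ 0 < (‖x‖ ^ 2) ^ τ := by
    intro x hx
    have h1 : (‖x‖ ^ 2) ^ τ * (‖x‖ ^ 2) ^ (-τ) = 1 := by
      rcases hx with h | h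
      · rw [← Real.rpow_add h]; simp
      · simp [h]
    refine ⟨?_, ?_⟩
    · simp only [w]
      linear_combination (-l * u x ^ σ) * h1
    · rcases hx with h | h
      · exact Real.rpow_pos_of_pos h _
      · simp [h]
  have hwK : ContinuousOn (fun x => (w x + ε * ‖x‖ ^ 2) * η x) Kset := by
    have h1 : ContinuousOn (fun x : EuclideanSpace ℝ (Fin N) => (‖x‖ ^ 2) ^ (-τ)) Kset := by
      intro x hx
      refine ContinuousAt.continuousWithinAt ?_
      rcases hsK x hx with h | h
      · exact ((continuous_norm.pow 2).continuousAt).rpow_const (Or.inl h.ne')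
      · simp only [h, neg_zero, Real.rpow_zero]; exact continuousAt_const
    have h2 : ContinuousOn w Kset := by
      refine hv.continuous.continuousOn.sub (continuousOn_const.mul (h1.mul ?_))
      exact (hu.continuous.rpow_const fun x => Or.inl (hupos x).ne').continuousOn
    have h3 : Continuous η := by fun_prop
    have h4 : Continuous fun x : EuclideanSpace ℝ (Fin N) => ε * ‖x‖ ^ 2 := by fun_prop
    exact (h2.add h4.continuousOn).mul h3.continuousOn
  have hx0K : x0 ∈ Kset := by
    refine ⟨hx0.le, ?_⟩
    obtain ⟨h1, h2⟩ := hSS x0 hs0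
    have : 0 < (‖x0‖ ^ 2) ^ τ * w x0 := mul_pos h2 hw0
    linarith
  obtain ⟨x, hxK, hxmax⟩ := hKc.exists_isMaxOn ⟨x0, hx0K⟩ hwK
  set M := (w x + ε * ‖x‖ ^ 2) * η x with hM
  have hη1 : ∀ y : EuclideanSpace ℝ (Fin N), ‖y‖ ^ 2 ≤ R2 → 0 ≤ η y ∧ η y ≤ 1 := by
    intro y hy
    have h0 : 0 ≤ ‖y‖ ^ 2 / R2 := by positivity
    have h1 : ‖y‖ ^ 2 / R2 ≤ 1 := (div_le_one hR0).2 hy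
    have h2 := pow_le_one₀ h0 h1 (n := n + 2)
    have h3 : 0 ≤ (‖y‖ ^ 2 / R2) ^ (n + 2) := by positivity
    exact ⟨pow_nonneg (by linarith) _, pow_le_one₀ (by linarith) (by linarith)⟩
  have hMd : d ≤ M := by
    have h1 : (w x0 + ε * ‖x0‖ ^ 2) * η x0 ≤ M := hxmax hx0K
    have h2 : 0 ≤ ε * ‖x0‖ ^ 2 * η x0 := mul_nonneg (by positivity) (hη1 x0 hx0.le).1
    have h3 : d ≤ w x0 * η x0 := hd
    nlinarith
  have hM0 : 0 < M := by linarith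
  have hηx0 : η x ≠ 0 := by
    intro h
    rw [hM, h, mul_zero] at hM0
    exact lt_irrefl _ hM0
  have hηx : 0 < η x := lt_of_le_of_ne (hη1 x hxK.1).1 (Ne.symm hηx0)
  have hxR : ‖x‖ ^ 2 < R2 := by
    refine lt_of_le_of_ne hxK.1 fun h => hηx0 ?_
    simp only [η, h, div_self hR0.ne', one_pow, sub_self]
    exact zero_pow hβ0
  have hH : ∀ y : EuclideanSpace ℝ (Fin N), ‖y‖ ^ 2 < R2 → 0 < 1 - (‖y‖ ^ 2 / R2) ^ (n + 2) := by
    intro y hy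
    have := pow_lt_one₀ (by positivity) ((div_lt_one hR0).2 hy) (n := n + 2) (by omega)
    linarith
  have hsx := hsK x hxK
  have hwx : w x + ε * ‖x‖ ^ 2 = M * (η x)⁻¹ := by rw [hM, mul_assoc, mul_inv_cancel₀ hηx0, mul_one]
  have hMη : M ≤ M * (η x)⁻¹ := by
    have := (one_le_inv₀ hηx).2 (hη1 x hxK.1).2
    nlinarith
  have hwx2 : M / 2 * (η x)⁻¹ ≤ w x := by
    have : ε * ‖x‖ ^ 2 ≤ ε * R2 := mul_le_mul_of_nonneg_left hxK.1 hε.le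
    linarith
  have hwpos : 0 < w x := lt_of_lt_of_le (by positivity) hwx2
  have hnear : ∀ᶠ y in nhds x, y ∈ Kset ∧ ‖y‖ ^ 2 < R2 := by
    obtain ⟨h1, h2⟩ := hSS x hsx
    have h3 : l * u x ^ σ < (‖x‖ ^ 2) ^ τ * v x := by
      have := mul_pos h2 hwpos
      linarith
    have h4 := cu.continuousAt.eventually_lt cv.continuousAt h3
    have h5 : ∀ᶠ y in nhds x, ‖y‖ ^ 2 < R2 :=
      (continuous_norm.pow 2).continuousAt.eventually_lt continuousAt_const hxR
    filter_upwards [h4, h5] with y a b using ⟨⟨b.le, a.le⟩, b⟩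
  let G : ℝ → ℝ := fun y => ((1 - (y / R2) ^ (n + 2)) ^ β)⁻¹
  have hloc : IsLocalMax (fun y => v y - l * ((‖y‖ ^ 2) ^ (-τ) * u y ^ σ) + ε * ‖y‖ ^ 2
      - M * G (‖y‖ ^ 2)) x := by
    filter_upwards [hnear] with y hy
    have h1 : (w y + ε * ‖y‖ ^ 2) * η y ≤ M := hxmax hy.1
    have h2 : 0 < η y := pow_pos (hH y hy.2) _
    have h3 : w y + ε * ‖y‖ ^ 2 ≤ M * (η y)⁻¹ := by
      rw [← div_eq_mul_inv, le_div_iff₀ h2]; exact h1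
    have e1 : v y - l * ((‖y‖ ^ 2) ^ (-τ) * u y ^ σ) + ε * ‖y‖ ^ 2 - M * G (‖y‖ ^ 2) =
      w y + ε * ‖y‖ ^ 2 - M * (η y)⁻¹ := rfl
    have e2 : v x - l * ((‖x‖ ^ 2) ^ (-τ) * u x ^ σ) + ε * ‖x‖ ^ 2 - M * G (‖x‖ ^ 2) =
      w x + ε * ‖x‖ ^ 2 - M * (η x)⁻¹ := rfl
    rw [e1, e2]
    linarith
  have hcalc := calc_max hu hv hupos x hσ hτ hσ1 hl.le hsx hτN
    (barrier n β R2 (‖x‖ ^ 2) (hH x hxR).ne') hloc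
  have hbb := barrier_bound N n β R2 (‖x‖ ^ 2) hR0 (by positivity) (hH x hxR)
  rw [← hK] at hbb
  have hl2 := hlow x hsx hwpos
  set H := 1 - (‖x‖ ^ 2 / R2) ^ (n + 2) with hHdef
  have hHpos : 0 < H := hH x hxR
  have hH1 : H ≤ 1 := by
    have : 0 ≤ (‖x‖ ^ 2 / R2) ^ (n + 2) := by positivity
    linarith
  have hNε : 0 < 2 * (N : ℝ) * ε := by positivity
  have hmain : c * (‖x‖ ^ 2) ^ A * (w x) ^ (1 + δ) <
      M * (K / R2 * (‖x‖ ^ 2 / R2) ^ (n + 1) * (H ^ (β + 2))⁻¹) := by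
    have := mul_le_mul_of_nonneg_left hbb hM0.le
    have e : w x = v x - l * ((‖x‖ ^ 2) ^ (-τ) * u x ^ σ) := rfl
    rw [e]
    linarith
  have hspos : 0 < ‖x‖ ^ 2 := by
    by_contra hcon
    have h0 : ‖x‖ ^ 2 = 0 := le_antisymm (not_lt.1 hcon) (by positivity)
    have h1 : 0 ≤ c * (‖x‖ ^ 2) ^ A * (w x) ^ (1 + δ) := by positivity
    have h2 : (‖x‖ ^ 2 / R2) ^ (n + 1) = 0 := by rw [h0]; simp
    rw [h2] at hmain
    simp only [mul_zero, zero_mul] at hmain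
    linarith
  set r := ‖x‖ ^ 2 / R2 with hr
  have hr0 : 0 < r := by positivity
  have hr1 : r ≤ 1 := (div_le_one hR0).2 hxK.1
  have hsA : r ^ (n + 1) ≤ (‖x‖ ^ 2) ^ A := by
    have h1 : r ^ (n + 1) = r ^ ((n : ℝ) + 1) := by
      rw [← Real.rpow_natCast]; push_cast; rfl
    rw [h1]
    refine (Real.rpow_le_rpow_of_exponent_ge hr0 hr1 hn).trans ?_
    refine Real.rpow_le_rpow hr0.le ?_ hA
    rw [hr]
    exact div_le_self (by positivity) hR
  have hHI : (H ^ (β + 2))⁻¹ ≤ ((η x)⁻¹) ^ (1 + δ) := by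
    have e1 : η x = H ^ β := rfl
    rw [e1, Real.inv_rpow (by positivity)]
    refine inv_anti₀ (by positivity) ?_
    rw [← Real.rpow_natCast, ← Real.rpow_mul hHpos.le, ← Real.rpow_natCast]
    refine Real.rpow_le_rpow_of_exponent_ge hHpos hH1 ?_
    push_cast
    nlinarith
  have hwlow : (M / 2) ^ (1 + δ) * ((η x)⁻¹) ^ (1 + δ) ≤ (w x) ^ (1 + δ) := by
    rw [← Real.mul_rpow (by positivity) (by positivity)]
    exact Real.rpow_le_rpow (by positivity) hwx2 (by linarith)
  set E := ((η x)⁻¹) ^ (1 + δ) with hE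
  have hEpos : 0 < E := by positivity
  have hK0 : 0 ≤ K := by positivity
  have hL : c * r ^ (n + 1) * ((M / 2) ^ (1 + δ) * E) ≤ c * (‖x‖ ^ 2) ^ A * (w x) ^ (1 + δ) := by
    gcongr
  have hU : M * (K / R2 * r ^ (n + 1) * (H ^ (β + 2))⁻¹) ≤ M * (K / R2 * r ^ (n + 1) * E) := by
    gcongr
  have hfin : (c * (M / 2) ^ (1 + δ)) * (r ^ (n + 1) * E) < (M * (K / R2)) * (r ^ (n + 1) * E) := by
    linarith
  have hfin2 := lt_of_mul_lt_mul_right hfin (by positivity)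
  have e3 : (M / 2) ^ (1 + δ) = (1 / 2) ^ (1 + δ) * (M * M ^ δ) := by
    rw [show M / 2 = (1 / 2) * M by ring, Real.mul_rpow (by norm_num) hM0.le, Real.rpow_add hM0]
    simp
  have hfin3 : M * (c * (1 / 2) ^ (1 + δ) * M ^ δ) < M * (K / R2) := by
    rw [e3] at hfin2
    linarith
  have hfin4 := lt_of_mul_lt_mul_left hfin3 hM0.le
  refine le_trans ?_ hfin4.le
  gcongr

/-- **Pointwise comparison for the Hénon–Lane–Emden system (Phan).**
Let `p ≥ q ≥ 0`, `a, b ≥ 0`, `pq > 1` and `0 ≤ a - b ≤ (N-2)(p-q)`.  If `(u, v)` is a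
positive classical solution of `-Δu = |x|^a v^p`, `-Δv = |x|^b u^q` on `ℝ^N`, then
`|x|^a v(x)^(p+1) ≤ ((p+1)/(q+1)) |x|^b u(x)^(q+1)` for all `x`. -/
theorem henon_lane_emden_pointwise_comparison
    (N : ℕ) (p q a b : ℝ) (hpq' : q ≤ p) (hq : 0 ≤ q) (ha : 0 ≤ a) (hb : 0 ≤ b)
    (hpq : 1 < p * q)
    (hab : 0 ≤ a - b) (hab' : a - b ≤ ((N : ℝ) - 2) * (p - q))
    (u v : EuclideanSpace ℝ (Fin N) → ℝ)
    (hu : ContDiff ℝ 2 u) (hv : ContDiff ℝ 2 v)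
    (hupos : ∀ x, 0 < u x) (hvpos : ∀ x, 0 < v x)
    (hequ : ∀ x, -lap u x = ‖x‖ ^ a * v x ^ p)
    (heqv : ∀ x, -lap v x = ‖x‖ ^ b * u x ^ q) :
    ∀ x, ‖x‖ ^ a * v x ^ (p + 1) ≤ ((p + 1) / (q + 1)) * (‖x‖ ^ b * u x ^ (q + 1)) := by
  have hq0 : 0 < q := by
    rcases hq.eq_or_lt with h | h
    · rw [← h] at hpq; norm_num at hpq
    · exact h
  have hp0 : 0 < p := by linarith
  obtain ⟨σ, hσd⟩ : ∃ σ, σ = (q + 1) / (p + 1) := ⟨_, rfl⟩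
  have hσ : 0 < σ := by rw [hσd]; positivity
  have hσ1 : σ ≤ 1 := by rw [hσd]; exact (div_le_one (by linarith)).2 (by linarith)
  have hσe : σ * (p + 1) = q + 1 := by rw [hσd]; field_simp
  obtain ⟨k, hkd⟩ : ∃ k, k = (p - q) / (q + 1) := ⟨_, rfl⟩
  have hk0 : 0 ≤ k := by rw [hkd]; exact div_nonneg (by linarith) (by linarith)
  have hk : σ * k = 1 - σ := by rw [hσd, hkd]; field_simp; ring
  obtain ⟨δ, hδd⟩ : ∃ δ, δ = p - k - 1 := ⟨_, rfl⟩
  have hδ : 0 < δ := by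
    have : δ = (p * q - 1) / (q + 1) := by rw [hδd, hkd]; field_simp; ring
    rw [this]
    exact div_pos (by linarith) (by linarith)
  obtain ⟨τ, hτd⟩ : ∃ τ, τ = (a - b) / (2 * (p + 1)) := ⟨_, rfl⟩
  have hτ : 0 ≤ τ := by rw [hτd]; positivity
  have hτe : 2 * τ * (p + 1) = a - b := by rw [hτd]; field_simp
  obtain ⟨l, hld⟩ : ∃ l, l = (1 / σ) ^ (1 / (p + 1)) := ⟨_, rfl⟩
  have hl : 0 < l := by rw [hld]; positivity
  have hl1' : l ^ (p + 1) = 1 / σ := by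
    rw [hld, ← Real.rpow_mul (by positivity), one_div_mul_cancel (by linarith), Real.rpow_one]
  have hl1 : l ^ (p + 1) * σ = 1 := by rw [hl1']; field_simp
  have hτN : 2 * τ ≤ ((N : ℝ) - 2) * (1 - σ) := by
    have e1 : 2 * τ = (a - b) / (p + 1) := by rw [hτd]; field_simp
    have e2 : ((N : ℝ) - 2) * (1 - σ) = ((N : ℝ) - 2) * (p - q) / (p + 1) := by
      rw [hσd]; field_simp; ring
    rw [e1, e2]
    gcongr
  obtain ⟨A, hAd⟩ : ∃ A, A = a / 2 - τ * (1 + k) := ⟨_, rfl⟩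
  have hA : 0 ≤ A := by
    have e1 : τ * (1 + k) = (a - b) / (2 * (q + 1)) := by
      rw [hτd, hkd]; field_simp; ring
    have e2 : (a - b) / (2 * (q + 1)) ≤ (a - b) / 2 := by
      gcongr; linarith
    rw [hAd, e1]; linarith
  have hnorm : ∀ (x : EuclideanSpace ℝ (Fin N)) (r : ℝ), ‖x‖ ^ r = (‖x‖ ^ 2) ^ (r / 2) := by
    intro x r
    rw [← Real.rpow_natCast, ← Real.rpow_mul (norm_nonneg x)]
    congr 1; push_cast; ring
  have hpow : ∀ s : ℝ, (0 < s ∨ τ = 0) → 0 < s ^ (-τ) ∧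
      s ^ (b / 2) = s ^ (a / 2) * (s ^ (-τ)) ^ (1 + p) ∧
      s ^ A = s ^ (a / 2) * (s ^ (-τ)) ^ (1 + k) := by
    rintro s (h | h)
    · refine ⟨by positivity, ?_, ?_⟩
      · rw [← Real.rpow_mul h.le, ← Real.rpow_add h]; congr 1; linarith
      · rw [← Real.rpow_mul h.le, ← Real.rpow_add h]; congr 1; rw [hAd]; ring
    · have e : a = b := by rw [h] at hτe; linarith
      rw [hAd, h, e]
      simp
  rcases Nat.eq_zero_or_pos N with hN | hN
  · intro x
    subst hN
    have h1 := hequ x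
    simp only [lap, Finset.univ_eq_empty, Finset.sum_empty, neg_zero] at h1
    have h2 : 0 < v x ^ p := Real.rpow_pos_of_pos (hvpos x) _
    have h3 : ‖x‖ ^ a = 0 := by
      rcases mul_eq_zero.1 h1.symm with h | h
      · exact h
      · exact absurd h h2.ne'
    rw [h3, zero_mul]
    have := hupos x
    positivity
  have hlow : ∀ x, (0 < ‖x‖ ^ 2 ∨ τ = 0) → 0 < v x - l * ((‖x‖ ^ 2) ^ (-τ) * u x ^ σ) →
      (σ * l ^ (1 + k)) * (‖x‖ ^ 2) ^ A * (v x - l * ((‖x‖ ^ 2) ^ (-τ) * u x ^ σ)) ^ (1 + δ) ≤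
      lap v x - l * ((‖x‖ ^ 2) ^ (-τ) * (σ * u x ^ (σ - 1) * lap u x)) := by
    intro x hx hw
    obtain ⟨h1, h2, h3⟩ := hpow _ hx
    have hT : 0 ≤ (‖x‖ ^ 2) ^ (a / 2) := by positivity
    have hnl := nonlin (p := p) (q := q) (k := k) (δ := δ) hσ h1 hT hl (hupos x) (hvpos x) hσe hl1 hk
      hk0 (by rw [hδd]; ring) hδ (by linarith)
    have e1 : lap u x = -((‖x‖ ^ 2) ^ (a / 2) * v x ^ p) := by
      rw [← hnorm, ← hequ x]; ring
    have e2 : lap v x = -((‖x‖ ^ 2) ^ (a / 2) * ((‖x‖ ^ 2) ^ (-τ)) ^ (1 + p) * u x ^ q) := by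
      rw [← h2, ← hnorm, ← heqv x]; ring
    rw [e1, e2, h3, ← mul_assoc l]
    refine hnl.trans (le_of_eq ?_)
    ring
  have hcomp : ∀ x, (0 < ‖x‖ ^ 2 ∨ τ = 0) → v x ≤ l * ((‖x‖ ^ 2) ^ (-τ) * u x ^ σ) := by
    intro x hx
    by_contra hcon
    push Not at hcon
    have hw : 0 < v x - l * ((‖x‖ ^ 2) ^ (-τ) * u x ^ σ) := by linarith
    obtain ⟨n, hn⟩ := exists_nat_ge A
    obtain ⟨β, hβ⟩ := exists_nat_ge (2 / δ)
    have hβ' : 2 ≤ β * δ := (div_le_iff₀ hδ).1 hβ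
    set w0 := v x - l * ((‖x‖ ^ 2) ^ (-τ) * u x ^ σ) with hw0
    have hd0 : 0 < w0 * (1 / 2) ^ β := by positivity
    have hc : 0 < σ * l ^ (1 + k) := by positivity
    set K : ℝ := 4 * β * (β + 1) * (n + 2) ^ 2 + 4 * β * (n + 2) * (n + 1) + 2 * N * β * (n + 2)
      with hK
    have hall : ∀ R2 : ℝ, 1 ≤ R2 → 2 * ‖x‖ ^ 2 < R2 →
        σ * l ^ (1 + k) * (1 / 2) ^ (1 + δ) * (w0 * (1 / 2) ^ β) ^ δ ≤ K / R2 := by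
      intro R2 hR hxR
      have hx2 : 0 ≤ ‖x‖ ^ 2 := by positivity
      have hr1 : ‖x‖ ^ 2 / R2 ≤ 1 / 2 := by
        rw [div_le_iff₀ (by linarith)]; linarith
      have hr0 : 0 ≤ ‖x‖ ^ 2 / R2 := by positivity
      have hr2 : (‖x‖ ^ 2 / R2) ^ (n + 2) ≤ 1 / 2 :=
        (pow_le_of_le_one hr0 (by linarith) (by omega)).trans hr1
      refine max_bound hN hu hv hupos hσ hτ hσ1 hl hτN hc hA hδ hlow n β (by linarith) hβ' R2 hR x
        (by linarith) hx hw _ hd0 ?_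
      rw [← hw0]
      have : (1 / 2 : ℝ) ^ β ≤ (1 - (‖x‖ ^ 2 / R2) ^ (n + 2)) ^ β :=
        pow_le_pow_left₀ (by norm_num) (by linarith) _
      exact mul_le_mul_of_nonneg_left this hw.le
    set D := σ * l ^ (1 + k) * (1 / 2) ^ (1 + δ) * (w0 * (1 / 2) ^ β) ^ δ with hD
    have hD0 : 0 < D := by positivity
    have hK0 : 0 ≤ K := by positivity
    have hx2 : 0 ≤ ‖x‖ ^ 2 := by positivity
    have hKD : 0 ≤ K / D := by positivity
    have h := hall (1 + 2 * ‖x‖ ^ 2 + K / D) (by linarith) (by linarith)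
    rw [le_div_iff₀ (by linarith)] at h
    have h2 : D * (K / D) = K := by field_simp
    nlinarith [mul_nonneg hD0.le hx2]
  intro x
  have hux := hupos x
  have hvx := hvpos x
  have hσi : (p + 1) / (q + 1) = l ^ (p + 1) := by rw [hl1', hσd]; field_simp
  by_cases hx : 0 < ‖x‖ ^ 2 ∨ τ = 0
  · obtain ⟨h1, h2, -⟩ := hpow _ hx
    have h3 := Real.rpow_le_rpow hvx.le (hcomp x hx) (by linarith : 0 ≤ p + 1)
    rw [Real.mul_rpow hl.le (by positivity), Real.mul_rpow h1.le (by positivity),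
      ← Real.rpow_mul hux.le, hσe] at h3
    rw [hσi, hnorm x a, hnorm x b, h2, add_comm 1 p]
    have hT : 0 ≤ (‖x‖ ^ 2) ^ (a / 2) := by positivity
    refine (mul_le_mul_of_nonneg_left h3 hT).trans (le_of_eq ?_)
    ring
  · push Not at hx
    have hx0 : ‖x‖ = 0 := by
      have : ‖x‖ ^ 2 = 0 := le_antisymm hx.1 (by positivity)
      exact pow_eq_zero_iff (two_ne_zero) |>.1 this
    have ha0 : a ≠ 0 := by
      intro h
      apply hx.2
      rw [hτd, show a - b = 0 by linarith, zero_div]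
    have h3 : ‖x‖ ^ a = 0 := by rw [hx0, Real.zero_rpow ha0]
    rw [h3, zero_mul]
    positivity
end
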